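/- arXiv:2001.11354 — 2 statements merged into one kernel-verified Lean document; each statement's English description precedes it below -/
import Mathlib

section
/- Let 𝒟,𝒟'∈TDT⁺. Then there exists c∈(0,+∞) such that ℋ^s(K(𝒟)) ≤ c^s·ℋ^s(K(𝒟')) for every s∈(0,+∞), where ℋ^s denotes the s-dimensional Hausdorff measure on ℂ with respect to the Euclidean metric. In particular, the Hausdorff dimensions of K(𝒟) and K(𝒟') coincide. -/
open MeasureTheory Filter Topology Matrix
open scoped ENNReal NNReal BigOperators

noncomputable section

/-- `D` is an open (round) disk in `ℂ`. -/
def IsOpenDisk (D : Set ℂ) : Prop := ∃ z : ℂ, ∃ r : ℝ, 0 < r ∧ D = Metric.ball z r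

/-- `D` is an open half-plane in `ℂ`. -/
def IsOpenHalfPlane (D : Set ℂ) : Prop :=
  ∃ a : ℂ, a ≠ 0 ∧ ∃ c : ℝ, D = {z : ℂ | (a * z).re < c}

/-- The center of an open disk (junk value otherwise). -/
noncomputable def diskCenter (D : Set ℂ) : ℂ :=
  Classical.epsilon fun z : ℂ => ∃ r : ℝ, 0 < r ∧ D = Metric.ball z r

/-- The radius of an open disk (junk value otherwise). -/
noncomputable def diskRadius (D : Set ℂ) : ℝ :=
  Classical.epsilon fun r : ℝ => 0 < r ∧ ∃ z : ℂ, D = Metric.ball z r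

/-- The curvature of `D`: the reciprocal of the radius for an open disk,
and `0` for a half-plane (or anything that is not an open disk). -/
noncomputable def curv (D : Set ℂ) : ℝ :=
  haveI := Classical.propDecidable (IsOpenDisk D)
  if IsOpenDisk D then (diskRadius D)⁻¹ else 0

/-- A tangential disk triple: each member is an open disk or an open half-plane
(at most one half-plane), and the closures of distinct members meet in exactly one point. -/
def IsTDT (𝒟 : Fin 3 → Set ℂ) : Prop :=
  ((∀ j, IsOpenDisk (𝒟 j)) ∨
    (∃ j, IsOpenHalfPlane (𝒟 j) ∧ ∀ k, k ≠ j → IsOpenDisk (𝒟 k))) ∧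
  ∀ j k, j ≠ k → ∃ p : ℂ, closure (𝒟 j) ∩ closure (𝒟 k) = {p}

/-- The ideal triangle `T(𝒟)`: the unique bounded connected component of
`ℂ ∖ (closure D₁ ∪ closure D₂ ∪ closure D₃)`. -/
noncomputable def idealTriangle (𝒟 : Fin 3 → Set ℂ) : Set ℂ :=
  Classical.epsilon fun T : Set ℂ =>
    Bornology.IsBounded T ∧
    ∃ z ∈ (⋃ j, closure (𝒟 j))ᶜ, T = connectedComponentIn (⋃ j, closure (𝒟 j))ᶜ z

/-- `q_j(𝒟)`: the tangency point of the two members other than the `j`-th one. -/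
noncomputable def tangencyPoint (𝒟 : Fin 3 → Set ℂ) (j : Fin 3) : ℂ :=
  Classical.epsilon fun p : ℂ => closure (𝒟 (j + 1)) ∩ closure (𝒟 (j + 2)) = {p}

/-- `𝒟` is a positively oriented tangential disk triple: the tangency points
`q₁(𝒟), q₂(𝒟), q₃(𝒟)` occur in counterclockwise order, i.e. the ideal triangle
lies to the left of its boundary oriented through `q₁(𝒟), q₂(𝒟), q₃(𝒟)` in this order. -/
def IsTDTplus (𝒟 : Fin 3 → Set ℂ) : Prop :=
  IsTDT 𝒟 ∧
  0 < ((tangencyPoint 𝒟 1 - tangencyPoint 𝒟 0).re *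
        (tangencyPoint 𝒟 2 - tangencyPoint 𝒟 0).im -
       (tangencyPoint 𝒟 1 - tangencyPoint 𝒟 0).im *
        (tangencyPoint 𝒟 2 - tangencyPoint 𝒟 0).re)

/-- `D` is an inscribed disk of the ideal triangle of `𝒟`. -/
def IsInscribedDisk (𝒟 : Fin 3 → Set ℂ) (D : Set ℂ) : Prop :=
  IsOpenDisk D ∧ D ⊆ idealTriangle 𝒟 ∧ ∀ j, ∃ p : ℂ, closure D ∩ closure (𝒟 j) = {p}

/-- The inscribed disk `D_in(𝒟)` of the ideal triangle of `𝒟`. -/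
noncomputable def Din (𝒟 : Fin 3 → Set ℂ) : Set ℂ := Classical.epsilon (IsInscribedDisk 𝒟)

/-- `Φ_j(𝒟)`: replace the `j`-th entry of `𝒟` by the inscribed disk `D_in(𝒟)`. -/
noncomputable def Phi (j : Fin 3) (𝒟 : Fin 3 → Set ℂ) : Fin 3 → Set ℂ :=
  Function.update 𝒟 j (Din 𝒟)

/-- Finite words over the alphabet `{1,2,3}` (represented by `Fin 3`). -/
abbrev Word := List (Fin 3)

/-- `𝒟_w = Φ_w(𝒟) = (Φ_{w_m} ∘ ⋯ ∘ Φ_{w_1})(𝒟)`. -/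
noncomputable def applyWord (𝒟 : Fin 3 → Set ℂ) (w : Word) : Fin 3 → Set ℂ :=
  w.foldl (fun D j => Phi j D) 𝒟

/-- The Apollonian gasket `K(𝒟)` associated with `𝒟`. -/
noncomputable def AG (𝒟 : Fin 3 → Set ℂ) : Set ℂ :=
  closure (idealTriangle 𝒟) \ ⋃ w : Word, Din (applyWord 𝒟 w)

/-- A concrete positively oriented tangential disk triple. -/
noncomputable def baseTriple : Fin 3 → Set ℂ :=
  ![{z : ℂ | 1 < z.im},
    Metric.ball (Complex.I / 2 - 1 / 2) (1 / 2),
    Metric.ball (Complex.I / 2 + 1 / 2) (1 / 2)]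

/-- `d`, the Hausdorff dimension of the Apollonian gasket
(independent of the choice of `𝒟 ∈ TDT⁺`). -/
noncomputable def dAG : ℝ := (dimH (AG baseTriple)).toReal

/-- The matrices `M₁, M₂, M₃`. -/
def Mmat : Fin 3 → Matrix (Fin 4) (Fin 4) ℝ :=
  ![!![1,0,0,0; 1,1,0,1; 1,0,1,1; 2,0,0,1],
    !![1,1,0,1; 0,1,0,0; 0,1,1,1; 0,2,0,1],
    !![1,0,1,1; 0,1,1,1; 0,0,1,0; 0,0,2,1]]

/-- `M_w := M_{w₁} ⋯ M_{w_m}` (`M_∅` is the identity matrix). -/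
def Mword (w : Word) : Matrix (Fin 4) (Fin 4) ℝ := (w.map Mmat).prod

/-- `κ(α,β,γ) := √(βγ + γα + αβ)`. -/
noncomputable def kappa (α β γ : ℝ) : ℝ := Real.sqrt (β * γ + γ * α + α * β)

/-- The row vector `(curv D₁, curv D₂, curv D₃, κ(𝒟))`. -/
noncomputable def curvVec (𝒟 : Fin 3 → Set ℂ) : Fin 4 → ℝ :=
  ![curv (𝒟 0), curv (𝒟 1), curv (𝒟 2),
    kappa (curv (𝒟 0)) (curv (𝒟 1)) (curv (𝒟 2))]

/-- The parameter space `Γ = {(g, κ(g)) : g ∈ [0,∞)³, κ(g) > 0} ⊆ [0,∞)⁴`. -/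
def Gamma : Set (Fin 4 → ℝ) :=
  {g | 0 ≤ g 0 ∧ 0 ≤ g 1 ∧ 0 ≤ g 2 ∧ g 3 = kappa (g 0) (g 1) (g 2) ∧ 0 < g 3}

/-- `Γ° := Γ ∩ (0,∞)⁴`. -/
def GammaInt : Set (Fin 4 → ℝ) := {g | g ∈ Gamma ∧ ∀ i, 0 < g i}

/-- The compact subset `Γ_ε` of `Γ`. -/
def GammaEps (ε : ℝ) : Set (Fin 4 → ℝ) :=
  {g | g 0 ∈ Set.Icc 0 ε⁻¹ ∧ g 1 ∈ Set.Icc 0 ε⁻¹ ∧ g 2 ∈ Set.Icc 0 ε⁻¹ ∧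
       g 3 = kappa (g 0) (g 1) (g 2) ∧
       ε ≤ g 1 + g 2 ∧ ε ≤ g 2 + g 0 ∧ ε ≤ g 0 + g 1}

/-- The Euclidean norm on `ℝ⁴`. -/
noncomputable def euclNorm4 (g : Fin 4 → ℝ) : ℝ := Real.sqrt (∑ i, g i ^ 2)

/-- The metric `ρ_Γ` on `Γ`: the Euclidean distance of the first three coordinates. -/
noncomputable def rhoGamma (g₁ g₂ : Fin 4 → ℝ) : ℝ :=
  Real.sqrt ((g₁ 0 - g₂ 0) ^ 2 + (g₁ 1 - g₂ 1) ^ 2 + (g₁ 2 - g₂ 2) ^ 2)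

/-- A positively oriented tangential disk triple with prescribed curvatures
`(g 0, g 1, g 2)` (junk value if none exists). -/
noncomputable def tripleOf (g : Fin 4 → ℝ) : Fin 3 → Set ℂ :=
  Classical.epsilon fun 𝒟 : Fin 3 → Set ℂ =>
    IsTDTplus 𝒟 ∧ curv (𝒟 0) = g 0 ∧ curv (𝒟 1) = g 1 ∧ curv (𝒟 2) = g 2

/-- `ℋ_Γ(g)`: the `d`-dimensional Hausdorff measure of the Apollonian gasket `K(𝒟)`
for any `𝒟 ∈ TDT⁺` whose members have curvatures `(g 0, g 1, g 2)`. -/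
noncomputable def HGamma (g : Fin 4 → ℝ) : ℝ :=
  (μH[dAG] (AG (tripleOf g))).toReal

/-- The operator norm of a `4 × 4` real matrix with respect to the Euclidean norm on `ℝ⁴`. -/
noncomputable def opNorm4 (M : Matrix (Fin 4) (Fin 4) ℝ) : ℝ :=
  sSup {t : ℝ | ∃ v : Fin 4 → ℝ, euclNorm4 v ≤ 1 ∧ t = euclNorm4 (M.mulVec v)}

/-- The set of words `I = {jⁿk : j,k ∈ S, j ≠ k, n ∈ ℕ}`. -/
def IdxI : Set Word :=
  {w | ∃ j k : Fin 3, j ≠ k ∧ ∃ n : ℕ, 0 < n ∧ w = List.replicate n j ++ [k]}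

end

/-- Coefficients of the real quadratic function
`z ↦ a |z|² + 2 (x Re z + y Im z) + c` on the plane. -/
structure CircleForm where
  a : ℝ
  x : ℝ
  y : ℝ
  c : ℝ

namespace CircleForm

/-- The Lorentzian inner product (inversive product) of two circle forms. -/
noncomputable def ip (u v : CircleForm) : ℝ := u.x * v.x + u.y * v.y - (u.a * v.c + v.a * u.c) / 2

/-- Evaluation of a circle form at a point. -/
noncomputable def ev (u : CircleForm) (z : ℂ) : ℝ :=
  u.a * (z.re ^ 2 + z.im ^ 2) + 2 * (u.x * z.re + u.y * z.im) + u.c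

/-- The open region where a circle form is negative. -/
def disk (u : CircleForm) : Set ℂ := {z | u.ev z < 0}

theorem continuous_ev (u : CircleForm) : Continuous u.ev := by
  unfold ev; fun_prop

theorem isOpen_disk (u : CircleForm) : IsOpen u.disk :=
  isOpen_lt u.continuous_ev continuous_const

theorem ip_comm (u v : CircleForm) : u.ip v = v.ip u := by
  unfold ip; ring

theorem closure_disk {u : CircleForm} (hu : u.ip u = 1) :
    closure u.disk = {z | u.ev z ≤ 0} := by
  apply Set.Subset.antisymm
  · exact closure_minimal (fun z (hz : u.ev z < 0) => (hz.le : u.ev z ≤ 0)) (isClosed_le u.continuous_ev continuous_const)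
  · intro p (hp : u.ev p ≤ 0)
    rcases hp.lt_or_eq with hp | hp
    · exact subset_closure hp
    · let g : ℂ := ⟨u.a * p.re + u.x, u.a * p.im + u.y⟩
      have hlim : Tendsto (fun t : ℝ => p - t * g) (𝓝[>] 0) (𝓝 p) := by
        have : Continuous (fun t : ℝ => p - t * g) := by fun_prop
        have h0 := this.tendsto 0
        simp only [Complex.ofReal_zero, zero_mul, sub_zero] at h0
        exact h0.mono_left nhdsWithin_le_nhds
      refine mem_closure_of_tendsto hlim ?_
      have hsmall : ∀ᶠ t : ℝ in 𝓝[>] 0, u.a * t < 2 := by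
        have : Continuous (fun t : ℝ => u.a * t) := by fun_prop
        have h0 := this.tendsto 0
        rw [mul_zero] at h0
        exact (h0.mono_left nhdsWithin_le_nhds).eventually (gt_mem_nhds two_pos)
      filter_upwards [hsmall, self_mem_nhdsWithin] with t ht (ht0 : 0 < t)
      have key : u.ev (p - t * g) = t * (u.a * t - 2) := by
        simp only [ev, ip, g, Complex.sub_re, Complex.sub_im, Complex.mul_re, Complex.mul_im,
          Complex.ofReal_re, Complex.ofReal_im] at hp hu ⊢
        linear_combination (1 - 2 * t * u.a + u.a ^ 2 * t ^ 2) * hp + (-2 * t + u.a * t ^ 2) * hu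
      change u.ev _ < 0
      rw [key]
      exact mul_neg_of_pos_of_neg ht0 (by linarith)

theorem disk_nonempty_inter_of_ev {u v : CircleForm} (hv : v.ip v = 1) {p : ℂ}
    (hup : u.ev p < 0) (hvp : v.ev p ≤ 0) : (u.disk ∩ v.disk).Nonempty := by
  have hp : p ∈ closure v.disk := by rw [closure_disk hv]; exact hvp
  exact mem_closure_iff.1 hp _ u.isOpen_disk hup

theorem ip_eq_neg_one {u v : CircleForm} (hu : u.ip u = 1) (hv : v.ip v = 1) {p : ℂ}
    (hp : closure u.disk ∩ closure v.disk = {p}) : u.ip v = -1 := by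
  have hempty : ¬ (u.disk ∩ v.disk).Nonempty := by
    rintro hne
    have hsub : u.disk ∩ v.disk ⊆ {p} :=
      hp ▸ Set.inter_subset_inter subset_closure subset_closure
    have heq := (Set.Nonempty.subset_singleton_iff hne).1 hsub
    exact not_isOpen_singleton p (heq ▸ u.isOpen_disk.inter v.isOpen_disk)
  have hmem : p ∈ closure u.disk ∩ closure v.disk := by rw [hp]; rfl
  rw [closure_disk hu, closure_disk hv] at hmem
  obtain ⟨hup, hvp⟩ : u.ev p ≤ 0 ∧ v.ev p ≤ 0 := hmem
  have hup0 : u.ev p = 0 := by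
    by_contra hne
    exact hempty (disk_nonempty_inter_of_ev hv (lt_of_le_of_ne hup hne) hvp)
  have hvp0 : v.ev p = 0 := by
    by_contra hne
    rw [Set.inter_comm] at hempty
    exact hempty (disk_nonempty_inter_of_ev hu (lt_of_le_of_ne hvp hne) hup)
  let g : ℂ := ⟨u.a * p.re + u.x + (v.a * p.re + v.x), u.a * p.im + u.y + (v.a * p.im + v.y)⟩
  have hg : g.re ^ 2 + g.im ^ 2 = 2 + 2 * u.ip v := by
    simp only [ev, ip, g] at hup0 hvp0 hu hv ⊢
    linear_combination (u.a + v.a) * hup0 + (u.a + v.a) * hvp0 + hu + hv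
  have hge : 0 ≤ 1 + u.ip v := by nlinarith [sq_nonneg g.re, sq_nonneg g.im]
  by_contra hne
  have hpos : 0 < 1 + u.ip v := lt_of_le_of_ne hge (fun h => hne (by linarith))
  apply hempty
  set ε : ℝ := 1 / (|u.a| + |v.a| + 1) with hε
  have hden : 0 < |u.a| + |v.a| + 1 := by positivity
  have hε0 : 0 < ε := by positivity
  have hεd : ε * (|u.a| + |v.a| + 1) = 1 := by rw [hε]; field_simp
  have hua : u.a * ε < 1 := by nlinarith [le_abs_self u.a, abs_nonneg v.a]
  have hva : v.a * ε < 1 := by nlinarith [le_abs_self v.a, abs_nonneg u.a]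
  refine ⟨p - ε * g, ?_, ?_⟩
  · have key : u.ev (p - ε * g) = -(2 * ε * (1 + u.ip v)) * (1 - u.a * ε) := by
      have e1 : u.ev (p - ε * g) = u.ev p - 2 * ε * (1 + u.ip v)
          + u.a * ε ^ 2 * (g.re ^ 2 + g.im ^ 2) := by
        simp only [ev, ip, g, Complex.sub_re, Complex.sub_im, Complex.mul_re, Complex.mul_im,
          Complex.ofReal_re, Complex.ofReal_im] at hup0 hvp0 hu hv ⊢
        linear_combination (- 2 * ε * u.a - ε * v.a) * hup0 + (- ε * u.a) * hvp0 - 2 * ε * hu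
      rw [e1, hg, hup0]; ring
    change u.ev _ < 0
    rw [key]
    exact mul_neg_of_neg_of_pos (neg_neg_of_pos (by positivity)) (by linarith)
  · have key : v.ev (p - ε * g) = -(2 * ε * (1 + u.ip v)) * (1 - v.a * ε) := by
      have e1 : v.ev (p - ε * g) = v.ev p - 2 * ε * (1 + u.ip v)
          + v.a * ε ^ 2 * (g.re ^ 2 + g.im ^ 2) := by
        simp only [ev, ip, g, Complex.sub_re, Complex.sub_im, Complex.mul_re, Complex.mul_im,
          Complex.ofReal_re, Complex.ofReal_im] at hup0 hvp0 hu hv ⊢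
        linear_combination (- 2 * ε * v.a - ε * u.a) * hvp0 + (- ε * v.a) * hup0 - 2 * ε * hv
      rw [e1, hg, hvp0]; ring
    change v.ev _ < 0
    rw [key]
    exact mul_neg_of_neg_of_pos (neg_neg_of_pos (by positivity)) (by linarith)

/-- The tangency point of two tangent circles. -/
noncomputable def touch (u v : CircleForm) : ℂ := ⟨-(u.x + v.x) / (u.a + v.a), -(u.y + v.y) / (u.a + v.a)⟩

theorem ev_add_ev {u v : CircleForm} (hu : u.ip u = 1) (hv : v.ip v = 1) (huv : u.ip v = -1)
    (ha : 0 < u.a + v.a) (z : ℂ) :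
    u.ev z + v.ev z =
      (u.a + v.a) * ((z.re - (touch u v).re) ^ 2 + (z.im - (touch u v).im) ^ 2) := by
  have ha' := ha.ne'
  simp only [ev, ip, touch] at *
  field_simp
  linear_combination -hu - hv - 2 * huv

theorem ev_touch {u v : CircleForm} (hu : u.ip u = 1) (hv : v.ip v = 1) (huv : u.ip v = -1)
    (ha : 0 < u.a + v.a) : u.ev (touch u v) = 0 := by
  have ha' := ha.ne'
  simp only [ev, ip, touch] at *
  field_simp
  linear_combination (-u.a - 2 * v.a) * hu + u.a * hv - 2 * v.a * huv

theorem closure_disk_inter_closure_disk {u v : CircleForm} (hu : u.ip u = 1) (hv : v.ip v = 1)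
    (huv : u.ip v = -1) (ha : 0 < u.a + v.a) :
    closure u.disk ∩ closure v.disk = {touch u v} := by
  rw [closure_disk hu, closure_disk hv]
  ext z
  simp only [Set.mem_inter_iff, Set.mem_ofPred_eq, Set.mem_singleton_iff]
  have hsum := ev_add_ev hu hv huv ha
  constructor
  · rintro ⟨h1, h2⟩
    have h3 := hsum z
    have h4 : (z.re - (touch u v).re) ^ 2 + (z.im - (touch u v).im) ^ 2 ≤ 0 := by
      by_contra! h5
      nlinarith [mul_pos ha h5]
    apply Complex.ext <;> nlinarith [sq_nonneg (z.re - (touch u v).re),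
      sq_nonneg (z.im - (touch u v).im)]
  · rintro rfl
    have h1 := ev_touch hu hv huv ha
    have h2 := hsum (touch u v)
    rw [h1] at h2
    norm_num at h2
    exact ⟨h1.le, h2.le⟩

theorem isOpenDisk_disk {u : CircleForm} (hu : u.ip u = 1) (ha : 0 < u.a) :
    u.disk = Metric.ball ⟨-u.x / u.a, -u.y / u.a⟩ (1 / u.a) := by
  ext z
  rw [Metric.mem_ball, Complex.dist_eq, ← abs_of_pos (one_div_pos.2 ha), ← abs_norm, ← sq_lt_sq,
    Complex.sq_norm, Complex.normSq_apply]
  have key : u.ev z = u.a * ((z - ⟨-u.x / u.a, -u.y / u.a⟩ : ℂ).re *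
      (z - ⟨-u.x / u.a, -u.y / u.a⟩ : ℂ).re + (z - ⟨-u.x / u.a, -u.y / u.a⟩ : ℂ).im *
      (z - ⟨-u.x / u.a, -u.y / u.a⟩ : ℂ).im - (1 / u.a) ^ 2) := by
    have ha' := ha.ne'
    simp only [ev, ip, Complex.sub_re, Complex.sub_im] at *
    field_simp
    linear_combination -hu
  change u.ev z < 0 ↔ _
  rw [key]
  constructor
  · intro h
    by_contra! h'
    nlinarith [mul_nonneg ha.le (sub_nonneg.2 h')]
  · intro h
    exact mul_neg_of_pos_of_neg ha (by linarith)

end CircleForm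

open CircleForm

theorem IsOpenDisk.exists_circleForm {D : Set ℂ} (h : IsOpenDisk D) :
    ∃ u : CircleForm, u.ip u = 1 ∧ 0 < u.a ∧ D = u.disk := by
  obtain ⟨z, r, hr, rfl⟩ := h
  have hr' := hr.ne'
  refine ⟨⟨1 / r, -z.re / r, -z.im / r, (z.re ^ 2 + z.im ^ 2 - r ^ 2) / r⟩, ?_, by positivity, ?_⟩
  · simp only [ip]; field_simp; ring
  · rw [isOpenDisk_disk _ (by positivity)]
    · congr 1
      · apply Complex.ext <;> simp <;> field_simp
      · simp
    · simp only [ip]; field_simp; ring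

theorem IsOpenHalfPlane.exists_circleForm {D : Set ℂ} (h : IsOpenHalfPlane D) :
    ∃ u : CircleForm, u.ip u = 1 ∧ u.a = 0 ∧ D = u.disk := by
  obtain ⟨a, ha, c, rfl⟩ := h
  have hn : 0 < ‖a‖ := norm_pos_iff.2 ha
  have hn' := hn.ne'
  have hsq : a.re ^ 2 + a.im ^ 2 = ‖a‖ ^ 2 := by
    rw [Complex.sq_norm, Complex.normSq_apply]; ring
  refine ⟨⟨0, a.re / ‖a‖, -a.im / ‖a‖, -2 * c / ‖a‖⟩, ?_, rfl, ?_⟩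
  · simp only [ip]; field_simp; linarith
  · ext z
    have key : ev ⟨0, a.re / ‖a‖, -a.im / ‖a‖, -2 * c / ‖a‖⟩ z = (2 / ‖a‖) * ((a * z).re - c) := by
      simp only [ev, Complex.mul_re]; field_simp; ring
    change _ ↔ ev _ z < 0
    rw [key, Set.mem_ofPred_eq]
    constructor
    · intro h; exact mul_neg_of_pos_of_neg (by positivity) (by linarith)
    · intro h
      by_contra! h'
      have : 0 ≤ 2 / ‖a‖ * ((a * z).re - c) := mul_nonneg (by positivity) (by linarith)
      linarith

/-- Circle forms `u 0, u 1, u 2` of three pairwise tangent disks (at most one of them a half-plane)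
together with the form `b` of the disk whose boundary is orthogonal to the three boundaries. -/
structure IsTangentFrame (u : Fin 3 → CircleForm) (b : CircleForm) : Prop where
  ip_self : ∀ j, (u j).ip (u j) = 1
  ip_ne : ∀ j k, j ≠ k → (u j).ip (u k) = -1
  ip_orth : ∀ j, (u j).ip b = 0
  ip_b : b.ip b = 1
  a_nonneg : ∀ j, 0 ≤ (u j).a
  a_add_pos : ∀ j k, j ≠ k → 0 < (u j).a + (u k).a
  b_pos : 0 < b.a

/-- The bilinear form on `ℝ³ × ℝ` dual to the Gram form of a tangent frame. -/
noncomputable def dualForm (p : Fin 3 → ℝ) (p' : ℝ) (q : Fin 3 → ℝ) (q' : ℝ) : ℝ :=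
  (∑ j, p j * q j - (∑ j, p j) * ∑ j, q j) / 2 + p' * q'

set_option maxHeartbeats 1600000 in
theorem dualForm_completeness {u : Fin 3 → CircleForm} {b : CircleForm}
    (ip_self : ∀ j, (u j).ip (u j) = 1) (ip_ne : ∀ j k, j ≠ k → (u j).ip (u k) = -1)
    (ip_orth : ∀ j, (u j).ip b = 0) (ip_b : b.ip b = 1) :
    (dualForm (fun j => (u j).a) b.a (fun j => (u j).a) b.a = 0 ∧
      dualForm (fun j => (u j).a) b.a (fun j => (u j).x) b.x = 0 ∧
      dualForm (fun j => (u j).a) b.a (fun j => (u j).y) b.y = 0 ∧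
      dualForm (fun j => (u j).a) b.a (fun j => (u j).c) b.c = -2) ∧
    (dualForm (fun j => (u j).x) b.x (fun j => (u j).x) b.x = 1 ∧
      dualForm (fun j => (u j).x) b.x (fun j => (u j).y) b.y = 0 ∧
      dualForm (fun j => (u j).x) b.x (fun j => (u j).c) b.c = 0) ∧
    (dualForm (fun j => (u j).y) b.y (fun j => (u j).y) b.y = 1 ∧
      dualForm (fun j => (u j).y) b.y (fun j => (u j).c) b.c = 0) ∧
    dualForm (fun j => (u j).c) b.c (fun j => (u j).c) b.c = 0 := by
  have s0 := ip_self 0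
  have s1 := ip_self 1
  have s2 := ip_self 2
  have n01 := ip_ne 0 1 (by decide)
  have n02 := ip_ne 0 2 (by decide)
  have n12 := ip_ne 1 2 (by decide)
  have o0 := ip_orth 0
  have o1 := ip_orth 1
  have o2 := ip_orth 2
  let G : Matrix (Fin 4) (Fin 4) ℝ := !![(u 0).a, (u 0).x, (u 0).y, (u 0).c;
    (u 1).a, (u 1).x, (u 1).y, (u 1).c; (u 2).a, (u 2).x, (u 2).y, (u 2).c; b.a, b.x, b.y, b.c]
  let P : Matrix (Fin 4) (Fin 4) ℝ :=
    !![((u 1).c + (u 2).c) / 4, ((u 0).c + (u 2).c) / 4, ((u 0).c + (u 1).c) / 4, -b.c / 2;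
      -((u 1).x + (u 2).x) / 2, -((u 0).x + (u 2).x) / 2, -((u 0).x + (u 1).x) / 2, b.x;
      -((u 1).y + (u 2).y) / 2, -((u 0).y + (u 2).y) / 2, -((u 0).y + (u 1).y) / 2, b.y;
      ((u 1).a + (u 2).a) / 4, ((u 0).a + (u 2).a) / 4, ((u 0).a + (u 1).a) / 4, -b.a / 2]
  have hGP : G * P = 1 := by
    simp only [ip] at *
    ext i j
    fin_cases i <;> fin_cases j <;>
      simp [G, P, Matrix.mul_apply, Fin.sum_univ_four] <;> linarith
  have hPG : P * G = 1 := mul_eq_one_comm.1 hGP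
  have e : ∀ i j, (P * G) i j = (1 : Matrix (Fin 4) (Fin 4) ℝ) i j := fun i j => by rw [hPG]
  have e30 := e 3 0
  have e31 := e 3 1
  have e32 := e 3 2
  have e33 := e 3 3
  have e11 := e 1 1
  have e12 := e 1 2
  have e13 := e 1 3
  have e22 := e 2 2
  have e23 := e 2 3
  have e03 := e 0 3
  simp [G, P, Matrix.mul_apply, Fin.sum_univ_four] at e30 e31 e32 e33 e11 e12 e13 e22 e23 e03
  simp only [dualForm, Fin.sum_univ_three]
  refine ⟨⟨?_, ?_, ?_, ?_⟩, ⟨?_, ?_, ?_⟩, ⟨?_, ?_⟩, ?_⟩ <;> linarith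

theorem exists_orthogonal_form {u : Fin 3 → CircleForm}
    (ip_self : ∀ j, (u j).ip (u j) = 1) (ip_ne : ∀ j k, j ≠ k → (u j).ip (u k) = -1)
    (a_nonneg : ∀ j, 0 ≤ (u j).a) (a_add_pos : ∀ j k, j ≠ k → 0 < (u j).a + (u k).a) :
    ∃ b, IsTangentFrame u b := by
  have s0 := ip_self 0
  have s1 := ip_self 1
  have s2 := ip_self 2
  have n01 := ip_ne 0 1 (by decide)
  have n02 := ip_ne 0 2 (by decide)
  have n12 := ip_ne 1 2 (by decide)
  let minor (p q r : CircleForm → ℝ) : ℝ :=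
    (p (u 0) * (q (u 1) * r (u 2) - q (u 2) * r (u 1)) -
      q (u 0) * (p (u 1) * r (u 2) - p (u 2) * r (u 1)) +
      r (u 0) * (p (u 1) * q (u 2) - p (u 2) * q (u 1))) / 4
  obtain ⟨b, ip_orth, ip_b⟩ : ∃ b : CircleForm, (∀ j, (u j).ip b = 0) ∧ b.ip b = 1 := by
    refine ⟨⟨-2 * minor a x y, minor a y c, -minor a x c, 2 * minor x y c⟩, ?_, ?_⟩
    · intro j
      fin_cases j <;> simp only [ip, minor] <;> simp <;> ring
    · have gram : ip ⟨-2 * minor a x y, minor a y c, -minor a x c, 2 * minor x y c⟩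
          ⟨-2 * minor a x y, minor a y c, -minor a x c, 2 * minor x y c⟩ =
          -((u 0).ip (u 0) * ((u 1).ip (u 1) * (u 2).ip (u 2) - (u 1).ip (u 2) ^ 2) -
            (u 0).ip (u 1) * ((u 0).ip (u 1) * (u 2).ip (u 2) - (u 1).ip (u 2) * (u 0).ip (u 2)) +
            (u 0).ip (u 2) * ((u 0).ip (u 1) * (u 1).ip (u 2) - (u 1).ip (u 1) * (u 0).ip (u 2)))
            / 4 := by
        simp only [ip, minor]; ring
      rw [gram, s0, s1, s2, n01, n02, n12]; norm_num
  have haa := (dualForm_completeness ip_self ip_ne ip_orth ip_b).1.1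
  have hne : b.a ≠ 0 := by
    intro h0
    have h01 := a_add_pos 0 1 (by decide)
    have h02 := a_add_pos 0 2 (by decide)
    have h12 := a_add_pos 1 2 (by decide)
    simp only [dualForm, Fin.sum_univ_three, h0] at haa
    have p01 := mul_nonneg (a_nonneg 0) (a_nonneg 1)
    have p02 := mul_nonneg (a_nonneg 0) (a_nonneg 2)
    have p12 := mul_nonneg (a_nonneg 1) (a_nonneg 2)
    have z01 : (u 0).a * (u 1).a = 0 := by linarith
    have z02 : (u 0).a * (u 2).a = 0 := by linarith
    have z12 : (u 1).a * (u 2).a = 0 := by linarith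
    rcases mul_eq_zero.1 z01 with h | h
    · rcases mul_eq_zero.1 z12 with h' | h' <;> linarith
    · rcases mul_eq_zero.1 z02 with h' | h' <;> linarith
  rcases lt_or_gt_of_ne hne with h | h
  · refine ⟨⟨-b.a, -b.x, -b.y, -b.c⟩, ip_self, ip_ne, ?_, ?_, a_nonneg, a_add_pos, by simpa⟩
    · intro j
      have := ip_orth j
      simp only [ip] at this ⊢
      linarith
    · simp only [ip] at ip_b ⊢
      linarith
  · exact ⟨b, ip_self, ip_ne, ip_orth, ip_b, a_nonneg, a_add_pos, h⟩

theorem IsTDT.exists_frame {𝒟 : Fin 3 → Set ℂ} (h : IsTDT 𝒟) :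
    ∃ u b, IsTangentFrame u b ∧ ∀ j, 𝒟 j = (u j).disk := by
  obtain ⟨hshape, htan⟩ := h
  obtain ⟨u, ip_self, a_nonneg, a_add_pos, hD⟩ : ∃ u : Fin 3 → CircleForm,
      (∀ j, (u j).ip (u j) = 1) ∧ (∀ j, 0 ≤ (u j).a) ∧
      (∀ j k, j ≠ k → 0 < (u j).a + (u k).a) ∧ ∀ j, 𝒟 j = (u j).disk := by
    rcases hshape with hd | ⟨i, hi, hd⟩
    · choose u h1 h2 h3 using fun j => (hd j).exists_circleForm
      exact ⟨u, h1, fun j => (h2 j).le, fun j k _ => add_pos (h2 j) (h2 k), h3⟩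
    · have : ∀ j, ∃ v : CircleForm, v.ip v = 1 ∧ 0 ≤ v.a ∧ (j ≠ i → 0 < v.a) ∧ 𝒟 j = v.disk := by
        intro j
        by_cases hj : j = i
        · obtain ⟨v, h1, h2, h3⟩ := hi.exists_circleForm
          exact ⟨v, h1, h2.ge, fun h => absurd hj h, hj ▸ h3⟩
        · obtain ⟨v, h1, h2, h3⟩ := (hd j hj).exists_circleForm
          exact ⟨v, h1, h2.le, fun _ => h2, h3⟩
      choose u h1 h2 h3 h4 using this
      refine ⟨u, h1, h2, fun j k hjk => ?_, h4⟩
      by_cases hj : j = i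
      · exact add_pos_of_nonneg_of_pos (h2 j) (h3 k (fun hk => hjk (hj.trans hk.symm)))
      · exact add_pos_of_pos_of_nonneg (h3 j hj) (h2 k)
  have ip_ne : ∀ j k, j ≠ k → (u j).ip (u k) = -1 := by
    intro j k hjk
    obtain ⟨p, hp⟩ := htan j k hjk
    rw [hD j, hD k] at hp
    exact ip_eq_neg_one (ip_self j) (ip_self k) hp
  obtain ⟨b, hb⟩ := exists_orthogonal_form ip_self ip_ne a_nonneg a_add_pos
  exact ⟨u, b, hb, hD⟩

/-- The point with given homogeneous coordinates relative to a tangent frame. -/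
noncomputable def pointOfCoords (u : Fin 3 → CircleForm) (b : CircleForm) (X : Fin 3 → ℝ) (X' : ℝ) : ℂ :=
  ⟨-dualForm (fun j => (u j).x) b.x X X' / dualForm (fun j => (u j).a) b.a X X',
    -dualForm (fun j => (u j).y) b.y X X' / dualForm (fun j => (u j).a) b.a X X'⟩

namespace IsTangentFrame

variable {u : Fin 3 → CircleForm} {b : CircleForm}

theorem dualForm_ev_ev (h : IsTangentFrame u b) (z w : ℂ) :
    dualForm (fun j => (u j).ev z) (b.ev z) (fun j => (u j).ev w) (b.ev w) =
      -2 * ((z.re - w.re) ^ 2 + (z.im - w.im) ^ 2) := by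
  obtain ⟨⟨haa, hax, hay, hac⟩, ⟨hxx, hxy, hxc⟩, ⟨hyy, hyc⟩, hcc⟩ :=
    dualForm_completeness h.ip_self h.ip_ne h.ip_orth h.ip_b
  simp only [dualForm, Fin.sum_univ_three, ev] at *
  linear_combination (z.re ^ 2 + z.im ^ 2) * (w.re ^ 2 + w.im ^ 2) * haa +
    2 * ((z.re ^ 2 + z.im ^ 2) * w.re + z.re * (w.re ^ 2 + w.im ^ 2)) * hax +
    2 * ((z.re ^ 2 + z.im ^ 2) * w.im + z.im * (w.re ^ 2 + w.im ^ 2)) * hay +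
    ((z.re ^ 2 + z.im ^ 2) + (w.re ^ 2 + w.im ^ 2)) * hac +
    4 * z.re * w.re * hxx + 4 * (z.re * w.im + z.im * w.re) * hxy + 2 * (z.re + w.re) * hxc +
    4 * z.im * w.im * hyy + 2 * (z.im + w.im) * hyc + hcc

theorem dualForm_ev_self (h : IsTangentFrame u b) (z : ℂ) :
    dualForm (fun j => (u j).ev z) (b.ev z) (fun j => (u j).ev z) (b.ev z) = 0 := by
  rw [h.dualForm_ev_ev]; ring

theorem ev_b_sq (h : IsTangentFrame u b) (z : ℂ) :
    b.ev z ^ 2 = (u 0).ev z * (u 1).ev z + (u 1).ev z * (u 2).ev z + (u 0).ev z * (u 2).ev z := by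
  have := h.dualForm_ev_self z
  simp only [dualForm, Fin.sum_univ_three] at this
  linarith

theorem dualForm_a_ev (h : IsTangentFrame u b) (z : ℂ) :
    dualForm (fun j => (u j).a) b.a (fun j => (u j).ev z) (b.ev z) = -2 := by
  obtain ⟨⟨haa, hax, hay, hac⟩, -⟩ :=
    dualForm_completeness h.ip_self h.ip_ne h.ip_orth h.ip_b
  simp only [dualForm, Fin.sum_univ_three, ev] at *
  linear_combination (z.re ^ 2 + z.im ^ 2) * haa + 2 * z.re * hax + 2 * z.im * hay + hac

theorem dualForm_x_ev (h : IsTangentFrame u b) (z : ℂ) :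
    dualForm (fun j => (u j).x) b.x (fun j => (u j).ev z) (b.ev z) = 2 * z.re := by
  obtain ⟨⟨haa, hax, hay, hac⟩, ⟨hxx, hxy, hxc⟩, -⟩ :=
    dualForm_completeness h.ip_self h.ip_ne h.ip_orth h.ip_b
  simp only [dualForm, Fin.sum_univ_three, ev] at *
  linear_combination (z.re ^ 2 + z.im ^ 2) * hax + 2 * z.re * hxx + 2 * z.im * hxy + hxc

theorem dualForm_y_ev (h : IsTangentFrame u b) (z : ℂ) :
    dualForm (fun j => (u j).y) b.y (fun j => (u j).ev z) (b.ev z) = 2 * z.im := by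
  obtain ⟨⟨haa, hax, hay, hac⟩, ⟨hxx, hxy, hxc⟩, ⟨hyy, hyc⟩, hcc⟩ :=
    dualForm_completeness h.ip_self h.ip_ne h.ip_orth h.ip_b
  simp only [dualForm, Fin.sum_univ_three, ev] at *
  linear_combination (z.re ^ 2 + z.im ^ 2) * hay + 2 * z.re * hxy + 2 * z.im * hyy + hyc

theorem pointOfCoords_ev (h : IsTangentFrame u b) (z : ℂ) :
    pointOfCoords u b (fun j => (u j).ev z) (b.ev z) = z := by
  apply Complex.ext
  · simp only [pointOfCoords, h.dualForm_a_ev, h.dualForm_x_ev]; ring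
  · simp only [pointOfCoords, h.dualForm_a_ev, h.dualForm_y_ev]; ring

theorem ev_pointOfCoords (h : IsTangentFrame u b) {X : Fin 3 → ℝ} {X' : ℝ}
    (hX : dualForm X X' X X' = 0) (ha : dualForm (fun j => (u j).a) b.a X X' ≠ 0) :
    (∀ j, (u j).ev (pointOfCoords u b X X') =
        -2 / dualForm (fun j => (u j).a) b.a X X' * X j) ∧
      b.ev (pointOfCoords u b X X') = -2 / dualForm (fun j => (u j).a) b.a X X' * X' := by
  have s0 := h.ip_self 0
  have s1 := h.ip_self 1
  have s2 := h.ip_self 2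
  have n01 := h.ip_ne 0 1 (by decide)
  have n02 := h.ip_ne 0 2 (by decide)
  have n12 := h.ip_ne 1 2 (by decide)
  have o0 := h.ip_orth 0
  have o1 := h.ip_orth 1
  have o2 := h.ip_orth 2
  have sb := h.ip_b
  obtain ⟨m0, hm0⟩ : ∃ m, m = -(X 1 + X 2) / 2 := ⟨_, rfl⟩
  obtain ⟨m1, hm1⟩ : ∃ m, m = -(X 0 + X 2) / 2 := ⟨_, rfl⟩
  obtain ⟨m2, hm2⟩ : ∃ m, m = -(X 0 + X 1) / 2 := ⟨_, rfl⟩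
  have hk : ∀ f : CircleForm → ℝ, dualForm (fun j => f (u j)) (f b) X X' =
      m0 * f (u 0) + m1 * f (u 1) + m2 * f (u 2) + X' * f b := by
    intro f
    rw [hm0, hm1, hm2]
    simp only [dualForm, Fin.sum_univ_three]; ring
  have hnull : m0 ^ 2 + m1 ^ 2 + m2 ^ 2 - 2 * (m0 * m1 + m1 * m2 + m0 * m2) + X' ^ 2 = 0 := by
    rw [hm0, hm1, hm2]
    simp only [dualForm, Fin.sum_univ_three] at hX
    linear_combination hX
  have hpt : ∀ v : CircleForm, v.ev (pointOfCoords u b X X') =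
      -2 / dualForm (fun j => (u j).a) b.a X X' * (m0 * v.ip (u 0) + m1 * v.ip (u 1) +
        m2 * v.ip (u 2) + X' * v.ip b) := by
    intro v
    have hkx := hk CircleForm.x
    have hky := hk CircleForm.y
    have hka := hk CircleForm.a
    obtain ⟨kc, hkc⟩ : ∃ k, k = m0 * (u 0).c + m1 * (u 1).c + m2 * (u 2).c + X' * b.c := ⟨_, rfl⟩
    obtain ⟨ka, hka'⟩ : ∃ k, k = dualForm (fun j => (u j).a) b.a X X' := ⟨_, rfl⟩
    obtain ⟨kx, hkx'⟩ : ∃ k, k = dualForm (fun j => (u j).x) b.x X X' := ⟨_, rfl⟩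
    obtain ⟨ky, hky'⟩ : ∃ k, k = dualForm (fun j => (u j).y) b.y X X' := ⟨_, rfl⟩
    simp only [pointOfCoords]
    rw [← hka'] at ha hka ⊢
    rw [← hkx'] at hkx ⊢
    rw [← hky'] at hky ⊢
    have hq : kx ^ 2 + ky ^ 2 - ka * kc = 0 := by
      rw [hkx, hky, hka, hkc]
      simp only [ip] at s0 s1 s2 n01 n02 n12 o0 o1 o2 sb
      linear_combination hnull + m0 ^ 2 * s0 + m1 ^ 2 * s1 + m2 ^ 2 * s2 + X' ^ 2 * sb +
        2 * m0 * m1 * n01 + 2 * m0 * m2 * n02 + 2 * m1 * m2 * n12 + 2 * m0 * X' * o0 +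
        2 * m1 * X' * o1 + 2 * m2 * X' * o2
    have hl : m0 * v.ip (u 0) + m1 * v.ip (u 1) + m2 * v.ip (u 2) + X' * v.ip b =
        v.x * kx + v.y * ky - (v.a * kc + v.c * ka) / 2 := by
      rw [hkx, hky, hka, hkc]; simp only [ip]; ring
    rw [hl]
    simp only [ev]
    field_simp
    linear_combination v.a * hq
  have n10 := (ip_comm (u 1) (u 0)).trans n01
  have n20 := (ip_comm (u 2) (u 0)).trans n02
  have n21 := (ip_comm (u 2) (u 1)).trans n12
  have p0 := (ip_comm b (u 0)).trans o0
  have p1 := (ip_comm b (u 1)).trans o1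
  have p2 := (ip_comm b (u 2)).trans o2
  constructor
  · intro j
    rw [hpt]
    congr 1
    fin_cases j
    · simp only [Fin.zero_eta]; rw [s0, n01, n02, o0, hm0, hm1, hm2]; ring
    · simp only [Fin.mk_one]; rw [n10, s1, n12, o1, hm0, hm1, hm2]; ring
    · simp only [Fin.reduceFinMk]; rw [n20, n21, s2, o2, hm0, hm1, hm2]; ring
  · rw [hpt, p0, p1, p2, sb]; ring

/-- The open ideal triangle of a tangent frame. -/
def triangle (u : Fin 3 → CircleForm) (b : CircleForm) : Set ℂ :=
  {z | (∀ j, 0 < (u j).ev z) ∧ b.ev z < 0}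

theorem dualForm_a_neg (h : IsTangentFrame u b) {X : Fin 3 → ℝ} {X' : ℝ} (hX : ∀ j, 0 < X j)
    (hX' : X' < 0) : dualForm (fun j => (u j).a) b.a X X' < 0 := by
  simp only [dualForm, Fin.sum_univ_three]
  have h1 := mul_neg_of_pos_of_neg h.b_pos hX'
  have h2 := fun i j => mul_nonneg (h.a_nonneg i) (hX j).le
  linarith [h2 0 1, h2 0 2, h2 1 0, h2 1 2, h2 2 0, h2 2 1]

theorem triangle_eq_image (h : IsTangentFrame u b) :
    triangle u b = (fun X : Fin 3 → ℝ => pointOfCoords u b X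
      (-√(X 0 * X 1 + X 1 * X 2 + X 0 * X 2))) '' {X | ∀ j, 0 < X j} := by
  ext z
  constructor
  · rintro ⟨h1, h2⟩
    refine ⟨fun j => (u j).ev z, h1, ?_⟩
    have : -√((u 0).ev z * (u 1).ev z + (u 1).ev z * (u 2).ev z + (u 0).ev z * (u 2).ev z)
        = b.ev z := by
      rw [← h.ev_b_sq, Real.sqrt_sq_eq_abs, abs_of_neg h2, neg_neg]
    simp only [this]
    exact h.pointOfCoords_ev z
  · rintro ⟨X, hX, rfl⟩
    have hX : ∀ j, 0 < X j := hX
    have hs : 0 < X 0 * X 1 + X 1 * X 2 + X 0 * X 2 := by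
      have := hX 0; have := hX 1; have := hX 2; positivity
    have hX' := neg_neg_of_pos (Real.sqrt_pos.2 hs)
    have hsq := Real.sq_sqrt hs.le
    have hneg := h.dualForm_a_neg hX hX'
    have hnull : dualForm X (-√(X 0 * X 1 + X 1 * X 2 + X 0 * X 2)) X
        (-√(X 0 * X 1 + X 1 * X 2 + X 0 * X 2)) = 0 := by
      simp only [dualForm, Fin.sum_univ_three]
      linear_combination hsq
    obtain ⟨e1, e2⟩ := h.ev_pointOfCoords hnull hneg.ne
    have hpos := div_pos_of_neg_of_neg (neg_neg_of_pos two_pos) hneg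
    refine ⟨fun j => ?_, ?_⟩
    · rw [e1]; exact mul_pos hpos (hX j)
    · rw [e2]; exact mul_neg_of_pos_of_neg hpos hX'

theorem triangle_nonempty (h : IsTangentFrame u b) : (triangle u b).Nonempty := by
  rw [h.triangle_eq_image]
  exact ⟨_, fun _ => 1, fun _ => one_pos, rfl⟩

theorem isPreconnected_triangle (h : IsTangentFrame u b) : IsPreconnected (triangle u b) := by
  rw [h.triangle_eq_image]
  have hconv : Convex ℝ {X : Fin 3 → ℝ | ∀ j, 0 < X j} := by
    intro X hX Y hY s t hs ht hst j
    have h1 := hX j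
    have h2 := hY j
    simp only [Pi.add_apply, Pi.smul_apply, smul_eq_mul]
    rcases hs.lt_or_eq with hs' | hs'
    · exact add_pos_of_pos_of_nonneg (mul_pos hs' h1) (mul_nonneg ht h2.le)
    · have : t = 1 := by linarith
      rw [← hs', this]; linarith
  refine hconv.isPreconnected.image _ ?_
  have hne : ∀ X ∈ {X : Fin 3 → ℝ | ∀ j, 0 < X j}, dualForm (fun j => (u j).a) b.a X
      (-√(X 0 * X 1 + X 1 * X 2 + X 0 * X 2)) ≠ 0 := by
    intro X hX
    have hX : ∀ j, 0 < X j := hX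
    have hs : 0 < X 0 * X 1 + X 1 * X 2 + X 0 * X 2 := by
      have := hX 0; have := hX 1; have := hX 2; positivity
    exact (h.dualForm_a_neg hX (neg_neg_of_pos (Real.sqrt_pos.2 hs))).ne
  have hc : ∀ (p : Fin 3 → ℝ) (p' : ℝ), Continuous fun X : Fin 3 → ℝ => dualForm p p' X
      (-√(X 0 * X 1 + X 1 * X 2 + X 0 * X 2)) := by
    intro p p'
    unfold dualForm
    fun_prop
  have hmk : ∀ r i : ℝ, (⟨r, i⟩ : ℂ) = Complex.equivRealProdCLM.symm (r, i) := fun _ _ => rfl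
  simp only [pointOfCoords, hmk]
  refine Complex.equivRealProdCLM.symm.continuous.comp_continuousOn ?_
  exact ((hc _ _).neg.continuousOn.div (hc _ _).continuousOn hne).prodMk
    ((hc _ _).neg.continuousOn.div (hc _ _).continuousOn hne)

theorem compl_iUnion_closure (h : IsTangentFrame u b) :
    (⋃ j, closure (u j).disk)ᶜ = {z | ∀ j, 0 < (u j).ev z} := by
  ext z
  simp [closure_disk (h.ip_self _)]

theorem ev_b_ne_zero (h : IsTangentFrame u b) {z : ℂ} (hz : ∀ j, 0 < (u j).ev z) :
    b.ev z ≠ 0 := by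
  intro h0
  have h1 := h.ev_b_sq z
  rw [h0] at h1
  have := hz 0; have := hz 1; have := hz 2
  have : 0 < (u 0).ev z * (u 1).ev z + (u 1).ev z * (u 2).ev z + (u 0).ev z * (u 2).ev z := by
    positivity
  linarith

theorem connectedComponentIn_eq_triangle (h : IsTangentFrame u b) {z : ℂ}
    (hz : z ∈ triangle u b) :
    connectedComponentIn {z | ∀ j, 0 < (u j).ev z} z = triangle u b := by
  apply Set.Subset.antisymm
  · intro w hw
    have hsub := connectedComponentIn_subset {z | ∀ j, 0 < (u j).ev z} z
    refine ⟨hsub hw, ?_⟩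
    by_contra! hbw
    obtain ⟨p, hp, hp0⟩ := (isPreconnected_connectedComponentIn
      (F := {z | ∀ j, 0 < (u j).ev z}) (x := z)).intermediate_value
      (mem_connectedComponentIn hz.1) hw b.continuous_ev.continuousOn ⟨hz.2.le, hbw⟩
    exact h.ev_b_ne_zero (hsub hp) hp0
  · exact h.isPreconnected_triangle.subset_connectedComponentIn hz (fun w hw => hw.1)

theorem isBounded_triangle (h : IsTangentFrame u b) : Bornology.IsBounded (triangle u b) := by
  refine (Metric.isBounded_ball (x := (⟨-b.x / b.a, -b.y / b.a⟩ : ℂ)) (r := 1 / b.a)).subset ?_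
  rw [← isOpenDisk_disk h.ip_b h.b_pos]
  exact fun z hz => hz.2

theorem not_isBounded_component (h : IsTangentFrame u b) {z : ℂ} (hz : ∀ j, 0 < (u j).ev z)
    (hb : 0 < b.ev z) :
    ¬ Bornology.IsBounded (connectedComponentIn {z | ∀ j, 0 < (u j).ev z} z) := by
  have hba := h.b_pos
  have hba' := hba.ne'
  obtain ⟨o, ho⟩ : ∃ o : ℂ, o = ⟨-b.x / b.a, -b.y / b.a⟩ := ⟨_, rfl⟩
  obtain ⟨d, hd⟩ : ∃ d : ℂ, d = z - o := ⟨_, rfl⟩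
  have hdn : 1 / b.a ^ 2 < d.re ^ 2 + d.im ^ 2 := by
    have hbb := h.ip_b
    have key : b.ev z = b.a * (d.re ^ 2 + d.im ^ 2 - 1 / b.a ^ 2) := by
      rw [hd, ho]
      simp only [ev, ip, Complex.sub_re, Complex.sub_im] at *
      field_simp
      linear_combination -hbb
    rw [key] at hb
    linarith [pos_of_mul_pos_right hb hba.le]
  have hd0 : d ≠ 0 := by
    rintro rfl
    have : 0 < 1 / b.a ^ 2 := by positivity
    simp at hdn
    simp at this
    linarith [hdn, sq_nonneg b.a]
  have hray : ∀ t : ℝ, 1 ≤ t → ∀ j, 0 < (u j).ev (o + t * d) := by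
    intro t ht j
    have horth := h.ip_orth j
    have hbb := h.ip_b
    have hzo : z = o + d := by rw [hd]; ring
    have hz1 := hz j
    rw [hzo] at hz1
    obtain ⟨s, hs⟩ : ∃ s, s = ((u j).a * o.re + (u j).x) * d.re +
      ((u j).a * o.im + (u j).y) * d.im := ⟨_, rfl⟩
    have hexp : ∀ t : ℝ, (u j).ev (o + t * d) =
        (u j).a * (d.re ^ 2 + d.im ^ 2) * t ^ 2 + 2 * s * t + (u j).a / b.a ^ 2 := by
      intro t
      have hc : (u j).ev o = (u j).a / b.a ^ 2 := by
        rw [ho]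
        simp only [ev, ip] at *
        field_simp
        linear_combination (u j).a * hbb - 2 * b.a * horth
      rw [← hc, hs]
      simp only [ev, Complex.add_re, Complex.add_im, Complex.mul_re, Complex.mul_im,
          Complex.ofReal_re, Complex.ofReal_im]
      ring
    have h1 := hexp 1
    simp only [Complex.ofReal_one, one_mul] at h1
    rw [h1] at hz1
    rw [hexp]
    have ht0 : 0 < t := by linarith
    have hp := mul_pos ht0 hz1
    have hR : 0 ≤ (d.re ^ 2 + d.im ^ 2) * t - 1 / b.a ^ 2 := by
      nlinarith [sq_nonneg d.re, sq_nonneg d.im]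
    have hq := mul_nonneg (h.a_nonneg j) (mul_nonneg hR (sub_nonneg.2 ht))
    have hdiv : (u j).a / b.a ^ 2 = (u j).a * (1 / b.a ^ 2) := by ring
    rw [hdiv] at hp ⊢
    nlinarith
  have hsub : (fun t : ℝ => o + t * d) '' Set.Ici 1 ⊆
      connectedComponentIn {z | ∀ j, 0 < (u j).ev z} z := by
    refine IsPreconnected.subset_connectedComponentIn ?_ ⟨1, Set.mem_Ici.2 le_rfl, ?_⟩ ?_
    · exact isPreconnected_Ici.image _ (by fun_prop)
    · simp [hd]
    · rintro _ ⟨t, ht, rfl⟩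
      exact hray t ht
  intro hbd
  obtain ⟨C, hC⟩ := (hbd.subset hsub).exists_norm_le
  have hdpos : 0 < ‖d‖ := norm_pos_iff.2 hd0
  have hC0 : 0 ≤ C := (norm_nonneg _).trans (hC _ ⟨1, Set.mem_Ici.2 le_rfl, rfl⟩)
  have ht : (1 : ℝ) ≤ 1 + (C + ‖o‖) / ‖d‖ := by
    have : 0 ≤ (C + ‖o‖) / ‖d‖ := by positivity
    linarith
  have h1 := hC _ ⟨1 + (C + ‖o‖) / ‖d‖, ht, rfl⟩
  have h2 : ‖((1 + (C + ‖o‖) / ‖d‖ : ℝ) : ℂ) * d‖ = ‖d‖ + (C + ‖o‖) := by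
    rw [norm_mul, Complex.norm_real, Real.norm_eq_abs, abs_of_nonneg (by linarith)]
    field_simp
  have h3 := norm_sub_le (o + ((1 + (C + ‖o‖) / ‖d‖ : ℝ) : ℂ) * d) o
  rw [add_sub_cancel_left, h2] at h3
  linarith

theorem idealTriangle_eq (h : IsTangentFrame u b) {𝒟 : Fin 3 → Set ℂ}
    (hD : ∀ j, 𝒟 j = (u j).disk) : idealTriangle 𝒟 = triangle u b := by
  have hO : (⋃ j, closure (𝒟 j))ᶜ = {z | ∀ j, 0 < (u j).ev z} := by
    rw [← h.compl_iUnion_closure]; simp only [hD]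
  unfold idealTriangle
  rw [hO]
  obtain ⟨z, hz⟩ := h.triangle_nonempty
  have hex : ∃ T : Set ℂ, Bornology.IsBounded T ∧ ∃ z ∈ {z | ∀ j, 0 < (u j).ev z},
      T = connectedComponentIn {z | ∀ j, 0 < (u j).ev z} z :=
    ⟨triangle u b, h.isBounded_triangle, z, hz.1, (h.connectedComponentIn_eq_triangle hz).symm⟩
  obtain ⟨hbd, w, hw, hTw⟩ := Classical.epsilon_spec hex
  rcases lt_or_gt_of_ne (h.ev_b_ne_zero hw) with hb | hb
  · rw [hTw]; exact h.connectedComponentIn_eq_triangle ⟨hw, hb⟩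
  · rw [hTw] at hbd
    exact absurd hbd (h.not_isBounded_component hw hb)

/-- The form of the inscribed disk. -/
noncomputable def inscribed (u : Fin 3 → CircleForm) (b : CircleForm) : CircleForm where
  a := (u 0).a + (u 1).a + (u 2).a + 2 * b.a
  x := (u 0).x + (u 1).x + (u 2).x + 2 * b.x
  y := (u 0).y + (u 1).y + (u 2).y + 2 * b.y
  c := (u 0).c + (u 1).c + (u 2).c + 2 * b.c

theorem ev_inscribed (u : Fin 3 → CircleForm) (b : CircleForm) (z : ℂ) :
    (inscribed u b).ev z = (u 0).ev z + (u 1).ev z + (u 2).ev z + 2 * b.ev z := by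
  simp only [ev, inscribed]; ring

theorem ip_inscribed (v : CircleForm) (u : Fin 3 → CircleForm) (b : CircleForm) :
    v.ip (inscribed u b) = v.ip (u 0) + v.ip (u 1) + v.ip (u 2) + 2 * v.ip b := by
  simp only [ip, inscribed]; ring

theorem ip_frame_inscribed (h : IsTangentFrame u b) (j : Fin 3) :
    (u j).ip (inscribed u b) = -1 := by
  rw [ip_inscribed, h.ip_orth]
  fin_cases j <;> simp [h.ip_self, h.ip_ne]

theorem ip_b_inscribed (h : IsTangentFrame u b) : b.ip (inscribed u b) = 2 := by
  rw [ip_inscribed, h.ip_b, ip_comm b, ip_comm b, ip_comm b, h.ip_orth, h.ip_orth, h.ip_orth]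
  norm_num

theorem ip_inscribed_self (h : IsTangentFrame u b) :
    (inscribed u b).ip (inscribed u b) = 1 := by
  rw [ip_inscribed, ip_comm _ (u 0), ip_comm _ (u 1), ip_comm _ (u 2), ip_comm _ b,
    h.ip_frame_inscribed, h.ip_frame_inscribed, h.ip_frame_inscribed, h.ip_b_inscribed]
  norm_num

theorem inscribed_a_pos (h : IsTangentFrame u b) : 0 < (inscribed u b).a := by
  have := h.a_nonneg 0
  have := h.a_nonneg 1
  have := h.a_nonneg 2
  have := h.b_pos
  simp only [inscribed]
  linarith

theorem isInscribedDisk_inscribed (h : IsTangentFrame u b) {𝒟 : Fin 3 → Set ℂ}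
    (hD : ∀ j, 𝒟 j = (u j).disk) : IsInscribedDisk 𝒟 (inscribed u b).disk := by
  have ha := h.inscribed_a_pos
  have hs := h.ip_inscribed_self
  have hpos : ∀ j, 0 < (u j).a + (inscribed u b).a := fun j =>
    add_pos_of_nonneg_of_pos (h.a_nonneg j) ha
  refine ⟨⟨_, _, one_div_pos.2 ha, isOpenDisk_disk hs ha⟩, ?_, fun j => ?_⟩
  · rw [h.idealTriangle_eq hD]
    intro z (hz : (inscribed u b).ev z < 0)
    have hj : ∀ j, 0 < (u j).ev z := by
      intro j
      have h1 := ev_add_ev (h.ip_self j) hs (h.ip_frame_inscribed j) (hpos j) z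
      have h2 : 0 ≤ (u j).ev z + (inscribed u b).ev z := by
        rw [h1]
        have := hpos j
        positivity
      linarith
    refine ⟨hj, ?_⟩
    rw [ev_inscribed] at hz
    linarith [hj 0, hj 1, hj 2]
  · rw [hD j, Set.inter_comm]
    exact ⟨_, closure_disk_inter_closure_disk (h.ip_self j) hs (h.ip_frame_inscribed j) (hpos j)⟩

theorem ev_eq_of_ip (h : IsTangentFrame u b) {v : CircleForm} (hv : v.ip v = 1)
    (hvu : ∀ j, (u j).ip v = -1) :
    ∃ t : ℝ, t ^ 2 = 4 ∧ ∀ z, v.ev z = (u 0).ev z + (u 1).ev z + (u 2).ev z + t * b.ev z := by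
  obtain ⟨⟨haa, hax, hay, hac⟩, ⟨hxx, hxy, hxc⟩, ⟨hyy, hyc⟩, hcc⟩ :=
    dualForm_completeness h.ip_self h.ip_ne h.ip_orth h.ip_b
  have v0 := hvu 0
  have v1 := hvu 1
  have v2 := hvu 2
  obtain ⟨t, ht⟩ : ∃ t, t = b.ip v := ⟨_, rfl⟩
  simp only [dualForm, Fin.sum_univ_three, ip] at haa hax hay hac hxx hxy hxc hyy hyc hcc v0 v1 v2 ht
  have ea : v.a = (u 0).a + (u 1).a + (u 2).a + t * b.a := by
    linear_combination -(v.x * hax + v.y * hay - v.c / 2 * haa - v.a / 2 * hac) -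
      ((u 1).a + (u 2).a) / 2 * v0 - ((u 0).a + (u 2).a) / 2 * v1 -
      ((u 0).a + (u 1).a) / 2 * v2 - b.a * ht
  have ex : v.x = (u 0).x + (u 1).x + (u 2).x + t * b.x := by
    linear_combination -(v.x * hxx + v.y * hxy - v.c / 2 * hax - v.a / 2 * hxc) -
      ((u 1).x + (u 2).x) / 2 * v0 - ((u 0).x + (u 2).x) / 2 * v1 -
      ((u 0).x + (u 1).x) / 2 * v2 - b.x * ht
  have ey : v.y = (u 0).y + (u 1).y + (u 2).y + t * b.y := by
    linear_combination -(v.x * hxy + v.y * hyy - v.c / 2 * hay - v.a / 2 * hyc) -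
      ((u 1).y + (u 2).y) / 2 * v0 - ((u 0).y + (u 2).y) / 2 * v1 -
      ((u 0).y + (u 1).y) / 2 * v2 - b.y * ht
  have ec : v.c = (u 0).c + (u 1).c + (u 2).c + t * b.c := by
    linear_combination -(v.x * hxc + v.y * hyc - v.c / 2 * hac - v.a / 2 * hcc) -
      ((u 1).c + (u 2).c) / 2 * v0 - ((u 0).c + (u 2).c) / 2 * v1 -
      ((u 0).c + (u 1).c) / 2 * v2 - b.c * ht
  refine ⟨t, ?_, fun z => ?_⟩
  · simp only [ip] at hv
    linear_combination t * ht + hv - v0 - v1 - v2 - v.x * ex - v.y * ey +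
      (v.c * ea + v.a * ec) / 2
  · simp only [ev]
    linear_combination (z.re ^ 2 + z.im ^ 2) * ea + 2 * z.re * ex + 2 * z.im * ey + ec

theorem Din_eq (h : IsTangentFrame u b) {𝒟 : Fin 3 → Set ℂ}
    (hD : ∀ j, 𝒟 j = (u j).disk) : Din 𝒟 = (inscribed u b).disk := by
  have hspec : IsInscribedDisk 𝒟 (Din 𝒟) :=
    Classical.epsilon_spec ⟨_, h.isInscribedDisk_inscribed hD⟩
  obtain ⟨hopen, hsub, htan⟩ := hspec
  obtain ⟨v, hv, hva, hDv⟩ := hopen.exists_circleForm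
  rw [hDv] at hsub htan ⊢
  rw [h.idealTriangle_eq hD] at hsub
  have hvu : ∀ j, (u j).ip v = -1 := by
    intro j
    obtain ⟨p, hp⟩ := htan j
    rw [hD j, Set.inter_comm] at hp
    exact ip_eq_neg_one (h.ip_self j) hv hp
  obtain ⟨t, ht, hev⟩ := h.ev_eq_of_ip hv hvu
  have hne : v.disk.Nonempty := by
    rw [isOpenDisk_disk hv hva]
    exact Metric.nonempty_ball.2 (one_div_pos.2 hva)
  obtain ⟨z, hz⟩ := hne
  obtain ⟨hzj, hzb⟩ := hsub hz
  have hz : v.ev z < 0 := hz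
  rw [hev] at hz
  have htpos : 0 < t := by
    by_contra! htn
    nlinarith [hzj 0, hzj 1, hzj 2, mul_nonneg_of_nonpos_of_nonpos htn hzb.le]
  have ht2 : t = 2 := by nlinarith
  ext w
  change v.ev w < 0 ↔ (inscribed u b).ev w < 0
  rw [hev, ht2, ev_inscribed]

/-- The form of the disk orthogonal to the triple obtained by replacing the `j`-th disk by the
inscribed one. -/
noncomputable def nextOrth (u : Fin 3 → CircleForm) (b : CircleForm) (j : Fin 3) : CircleForm where
  a := (u (j + 1)).a + (u (j + 2)).a + b.a
  x := (u (j + 1)).x + (u (j + 2)).x + b.x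
  y := (u (j + 1)).y + (u (j + 2)).y + b.y
  c := (u (j + 1)).c + (u (j + 2)).c + b.c

theorem ev_nextOrth (u : Fin 3 → CircleForm) (b : CircleForm) (j : Fin 3) (z : ℂ) :
    (nextOrth u b j).ev z = (u (j + 1)).ev z + (u (j + 2)).ev z + b.ev z := by
  simp only [ev, nextOrth]; ring

theorem ip_nextOrth (v : CircleForm) (u : Fin 3 → CircleForm) (b : CircleForm) (j : Fin 3) :
    v.ip (nextOrth u b j) = v.ip (u (j + 1)) + v.ip (u (j + 2)) + v.ip b := by
  simp only [ip, nextOrth]; ring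

theorem next (h : IsTangentFrame u b) (j : Fin 3) :
    IsTangentFrame (Function.update u j (inscribed u b)) (nextOrth u b j) := by
  have ha := h.inscribed_a_pos
  have hs := h.ip_inscribed_self
  have hi := h.ip_frame_inscribed
  have hi' : ∀ k, (inscribed u b).ip (u k) = -1 := fun k => (ip_comm _ _).trans (hi k)
  have hne1 : j + 1 ≠ j + 2 := by fin_cases j <;> decide
  have hne2 : j + 2 ≠ j + 1 := hne1.symm
  have hb : ∀ k, b.ip (u k) = 0 := fun k => (ip_comm _ _).trans (h.ip_orth k)
  refine ⟨fun k => ?_, fun k l hkl => ?_, fun k => ?_, ?_, fun k => ?_, fun k l hkl => ?_, ?_⟩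
  · by_cases hk : k = j
    · subst hk; simpa using hs
    · simpa [hk] using h.ip_self k
  · by_cases hk : k = j
    · subst hk
      simpa [hkl.symm] using hi' l
    · by_cases hl : l = j
      · subst hl; simpa [hk] using hi k
      · simpa [hk, hl] using h.ip_ne k l hkl
  · by_cases hk : k = j
    · subst hk
      rw [Function.update_self, ip_nextOrth, hi', hi', ip_comm, h.ip_b_inscribed]
      norm_num
    · rw [Function.update_of_ne hk, ip_nextOrth, h.ip_orth]
      have hk' : k = j + 1 ∨ k = j + 2 := by
        revert hk; revert j k; decide
      rcases hk' with rfl | rfl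
      · rw [h.ip_self, h.ip_ne _ _ hne1]; norm_num
      · rw [h.ip_self, h.ip_ne _ _ hne2]; norm_num
  · rw [ip_nextOrth, ip_comm (nextOrth u b j) (u (j + 1)), ip_comm (nextOrth u b j) (u (j + 2)),
      ip_comm (nextOrth u b j) b, ip_nextOrth, ip_nextOrth, ip_nextOrth, h.ip_self, h.ip_self,
      h.ip_ne _ _ hne1, h.ip_ne _ _ hne2, h.ip_orth, h.ip_orth, hb, hb, h.ip_b]
    norm_num
  · by_cases hk : k = j
    · subst hk; simpa using ha.le
    · simpa [hk] using h.a_nonneg k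
  · by_cases hk : k = j
    · subst hk
      simpa [hkl.symm] using add_pos_of_pos_of_nonneg ha (h.a_nonneg l)
    · by_cases hl : l = j
      · subst hl; simpa [hk] using add_pos_of_nonneg_of_pos (h.a_nonneg k) ha
      · simpa [hk, hl] using h.a_add_pos k l hkl
  · have := h.a_nonneg (j + 1)
    have := h.a_nonneg (j + 2)
    have := h.b_pos
    simp only [nextOrth]
    linarith

theorem Phi_eq (h : IsTangentFrame u b) {𝒟 : Fin 3 → Set ℂ} (hD : ∀ j, 𝒟 j = (u j).disk)
    (j k : Fin 3) : Phi j 𝒟 k = (Function.update u j (inscribed u b) k).disk := by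
  unfold Phi
  by_cases hk : k = j
  · subst hk; simpa using h.Din_eq hD
  · simpa [hk] using hD k

/-- Points with proportional coordinates relative to two frames lie in corresponding disks. -/
theorem mem_Din_applyWord_iff (w : Word) :
    ∀ {u u' : Fin 3 → CircleForm} {b b' : CircleForm} {𝒟 𝒟' : Fin 3 → Set ℂ}
      (_ : IsTangentFrame u b) (_ : IsTangentFrame u' b')
      (_ : ∀ j, 𝒟 j = (u j).disk) (_ : ∀ j, 𝒟' j = (u' j).disk) {z z' : ℂ} {t : ℝ} (_ : 0 < t)
      (_ : ∀ j, (u' j).ev z' = t * (u j).ev z) (_ : b'.ev z' = t * b.ev z),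
      z' ∈ Din (applyWord 𝒟' w) ↔ z ∈ Din (applyWord 𝒟 w) := by
  induction w with
  | nil =>
    intro u u' b b' 𝒟 𝒟' h h' hD hD' z z' t ht hev hevb
    change z' ∈ Din 𝒟' ↔ z ∈ Din 𝒟
    rw [h.Din_eq hD, h'.Din_eq hD']
    change (inscribed u' b').ev z' < 0 ↔ (inscribed u b).ev z < 0
    have : (inscribed u' b').ev z' = t * (inscribed u b).ev z := by
      rw [ev_inscribed, ev_inscribed, hev, hev, hev, hevb]; ring
    rw [this]
    exact ⟨fun hlt => by by_contra! hge; linarith [mul_nonneg ht.le hge],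
      mul_neg_of_pos_of_neg ht⟩
  | cons i w ih =>
    intro u u' b b' 𝒟 𝒟' h h' hD hD' z z' t ht hev hevb
    refine ih (h.next i) (h'.next i) (h.Phi_eq hD i) (h'.Phi_eq hD' i) ht (fun k => ?_) ?_
    · by_cases hk : k = i
      · subst hk
        rw [Function.update_self, Function.update_self, ev_inscribed, ev_inscribed, hev, hev, hev,
          hevb]
        ring
      · rw [Function.update_of_ne hk, Function.update_of_ne hk, hev]
    · rw [ev_nextOrth, ev_nextOrth, hev, hev, hevb]; ring

/-- The set of points where the coordinates have the signs taken on the closed triangle. -/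
def closedTriangle (u : Fin 3 → CircleForm) (b : CircleForm) : Set ℂ :=
  {z | (∀ j, 0 ≤ (u j).ev z) ∧ b.ev z ≤ 0}

theorem closure_triangle_subset (u : Fin 3 → CircleForm) (b : CircleForm) :
    closure (triangle u b) ⊆ closedTriangle u b := by
  refine closure_minimal (fun z hz => ⟨fun j => (hz.1 j).le, hz.2.le⟩) ?_
  refine IsClosed.and ?_ (isClosed_le b.continuous_ev continuous_const)
  simp only [Set.ofPred_forall]
  exact isClosed_iInter fun j => isClosed_le continuous_const (u j).continuous_ev

/-- The map preserving homogeneous coordinates relative to two frames. -/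
noncomputable def transfer (u : Fin 3 → CircleForm) (b : CircleForm) (u' : Fin 3 → CircleForm)
    (b' : CircleForm) (z : ℂ) : ℂ :=
  pointOfCoords u' b' (fun j => (u j).ev z) (b.ev z)

variable {u' : Fin 3 → CircleForm} {b' : CircleForm}

theorem exists_transfer_scale (h : IsTangentFrame u b) (h' : IsTangentFrame u' b') :
    ∃ L : ℝ, 0 < L ∧ ∀ z ∈ closedTriangle u b, ∃ t, 0 < t ∧ t ≤ L ∧
      (∀ j, (u' j).ev (transfer u b u' b' z) = t * (u j).ev z) ∧
      b'.ev (transfer u b u' b' z) = t * b.ev z := by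
  have hsmall : ∀ p q : ℝ, 0 < q → ∀ᶠ m : ℝ in 𝓝[>] 0, m * p < q := by
    intro p q hq
    have : Continuous (fun m : ℝ => m * p) := by fun_prop
    have h0 := this.tendsto 0
    rw [zero_mul] at h0
    exact (h0.mono_left nhdsWithin_le_nhds).eventually (gt_mem_nhds hq)
  have hmpos : ∀ᶠ m : ℝ in 𝓝[>] 0, 0 < m := self_mem_nhdsWithin
  obtain ⟨m, hm0, m01, m02, m12, mb⟩ := (hmpos.and
    ((hsmall ((u 0).a + (u 1).a) _ (h'.a_add_pos 0 1 (by decide))).and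
    ((hsmall ((u 0).a + (u 2).a) _ (h'.a_add_pos 0 2 (by decide))).and
    ((hsmall ((u 1).a + (u 2).a) _ (h'.a_add_pos 1 2 (by decide))).and
    (hsmall b.a _ h'.b_pos))))).exists
  refine ⟨1 / m, one_div_pos.2 hm0, fun z hz => ?_⟩
  obtain ⟨hzj, hzb⟩ := hz
  have hden : dualForm (fun j => (u' j).a) b'.a (fun j => (u j).ev z) (b.ev z) ≤ -2 * m := by
    have h1 := h.dualForm_a_ev z
    simp only [dualForm, Fin.sum_univ_three] at h1 ⊢
    have e0 := mul_le_mul_of_nonneg_right m12.le (hzj 0)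
    have e1 := mul_le_mul_of_nonneg_right m02.le (hzj 1)
    have e2 := mul_le_mul_of_nonneg_right m01.le (hzj 2)
    have eb := mul_le_mul_of_nonneg_right mb.le (neg_nonneg.2 hzb)
    nlinarith [congrArg (m * ·) h1]
  have hneg : dualForm (fun j => (u' j).a) b'.a (fun j => (u j).ev z) (b.ev z) < 0 := by linarith
  obtain ⟨e1, e2⟩ := h'.ev_pointOfCoords (h.dualForm_ev_self z) hneg.ne
  refine ⟨_, div_pos_of_neg_of_neg (neg_neg_of_pos two_pos) hneg, ?_, e1, e2⟩
  rw [← neg_div_neg_eq, neg_neg, div_le_div_iff₀ (by linarith) hm0]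
  linarith

theorem dist_sq_of_proportional (h : IsTangentFrame u b) (h' : IsTangentFrame u' b')
    {z w z' w' : ℂ} {s t : ℝ} (hz : ∀ j, (u' j).ev z' = s * (u j).ev z)
    (hzb : b'.ev z' = s * b.ev z) (hw : ∀ j, (u' j).ev w' = t * (u j).ev w)
    (hwb : b'.ev w' = t * b.ev w) : dist z' w' ^ 2 = s * t * dist z w ^ 2 := by
  have hd : ∀ p q : ℂ, dist p q ^ 2 = (p.re - q.re) ^ 2 + (p.im - q.im) ^ 2 := by
    intro p q
    rw [Complex.dist_eq, Complex.sq_norm, Complex.normSq_apply, Complex.sub_re, Complex.sub_im]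
    ring
  have h1 := h.dualForm_ev_ev z w
  have h2 := h'.dualForm_ev_ev z' w'
  simp only [hz, hzb, hw, hwb] at h2
  rw [hd, hd]
  simp only [dualForm, Fin.sum_univ_three] at h1 h2
  linear_combination h2 / 2 - s * t * h1 / 2

theorem exists_lipschitzOnWith_transfer (h : IsTangentFrame u b) (h' : IsTangentFrame u' b') :
    ∃ L : ℝ≥0, 0 < L ∧ LipschitzOnWith L (transfer u b u' b') (closedTriangle u b) := by
  obtain ⟨L, hL, hscale⟩ := h.exists_transfer_scale h'
  refine ⟨⟨L, hL.le⟩, hL, LipschitzOnWith.of_dist_le_mul fun z hz w hw => ?_⟩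
  obtain ⟨s, hs, hsL, hz1, hz2⟩ := hscale z hz
  obtain ⟨t, ht, htL, hw1, hw2⟩ := hscale w hw
  have hd := h.dist_sq_of_proportional h' hz1 hz2 hw1 hw2
  refine abs_le_of_sq_le_sq' ?_ (by positivity) |>.2
  rw [hd, mul_pow]
  refine mul_le_mul_of_nonneg_right ?_ (sq_nonneg _)
  change s * t ≤ L ^ 2
  nlinarith [mul_le_mul hsL htL ht.le hL.le]

theorem AG_subset_image (h : IsTangentFrame u b) (h' : IsTangentFrame u' b')
    {𝒟 𝒟' : Fin 3 → Set ℂ} (hD : ∀ j, 𝒟 j = (u j).disk) (hD' : ∀ j, 𝒟' j = (u' j).disk) :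
    AG 𝒟 ⊆ transfer u' b' u b '' AG 𝒟' := by
  rintro z ⟨hzT, hzD⟩
  rw [h.idealTriangle_eq hD] at hzT
  have hzC := closure_triangle_subset u b hzT
  obtain ⟨L, hL, hscale⟩ := h.exists_transfer_scale h'
  obtain ⟨L', hL', hscale'⟩ := h'.exists_transfer_scale h
  obtain ⟨M, -, hlip⟩ := h.exists_lipschitzOnWith_transfer h'
  obtain ⟨t, ht, -, ht1, ht2⟩ := hscale z hzC
  have hT' : transfer u b u' b' z ∈ closure (triangle u' b') := by
    have hcont : ContinuousWithinAt (transfer u b u' b') (triangle u b) z :=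
      (hlip.continuousOn z hzC).mono (subset_closure.trans (closure_triangle_subset u b))
    refine hcont.mem_closure hzT fun w hw => ?_
    obtain ⟨s, hs, -, hs1, hs2⟩ := hscale w (closure_triangle_subset u b (subset_closure hw))
    exact ⟨fun j => by rw [hs1]; exact mul_pos hs (hw.1 j),
      by rw [hs2]; exact mul_neg_of_pos_of_neg hs hw.2⟩
  refine ⟨transfer u b u' b' z, ⟨by rwa [h'.idealTriangle_eq hD'], ?_⟩, ?_⟩
  · simp only [Set.mem_iUnion, not_exists] at hzD ⊢
    exact fun w hw => hzD w ((mem_Din_applyWord_iff w h h' hD hD' ht ht1 ht2).1 hw)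
  · obtain ⟨s, hs, -, hs1, hs2⟩ := hscale' _ (closure_triangle_subset u' b' hT')
    have hd := h.dist_sq_of_proportional h (z := z) (w := z)
      (z' := transfer u' b' u b (transfer u b u' b' z)) (w' := z) (s := s * t) (t := 1)
      (fun j => by rw [hs1, ht1]; ring) (by rw [hs2, ht2]; ring) (fun j => by ring) (by ring)
    rw [dist_self] at hd
    exact dist_eq_zero.1 (pow_eq_zero_iff two_ne_zero |>.1 (hd.trans (by ring)))

theorem AG_subset_closedTriangle (h : IsTangentFrame u b) {𝒟 : Fin 3 → Set ℂ}
    (hD : ∀ j, 𝒟 j = (u j).disk) : AG 𝒟 ⊆ closedTriangle u b := by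
  intro z hz
  have := hz.1
  rw [h.idealTriangle_eq hD] at this
  exact closure_triangle_subset u b this

end IsTangentFrame

theorem exists_lipschitzOnWith_AG_subset_image {𝒟 𝒟' : Fin 3 → Set ℂ} (h : IsTDT 𝒟)
    (h' : IsTDT 𝒟') :
    ∃ (L : ℝ≥0) (f : ℂ → ℂ), 0 < L ∧ LipschitzOnWith L f (AG 𝒟') ∧ AG 𝒟 ⊆ f '' AG 𝒟' := by
  obtain ⟨u, b, hu, hD⟩ := h.exists_frame
  obtain ⟨u', b', hu', hD'⟩ := h'.exists_frame
  obtain ⟨L, hL, hlip⟩ := hu'.exists_lipschitzOnWith_transfer hu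
  exact ⟨L, _, hL, hlip.mono (hu'.AG_subset_closedTriangle hD'), hu.AG_subset_image hu' hD hD'⟩

theorem dimH_AG_le {𝒟 𝒟' : Fin 3 → Set ℂ} (h : IsTDT 𝒟) (h' : IsTDT 𝒟') :
    dimH (AG 𝒟) ≤ dimH (AG 𝒟') := by
  obtain ⟨L, f, -, hlip, hsub⟩ := exists_lipschitzOnWith_AG_subset_image h h'
  exact (dimH_mono hsub).trans hlip.dimH_image_le

/-- comparison of Hausdorff measures of two Apollonian gaskets, and
equality of their Hausdorff dimensions. -/
theorem hausdorffMeasure_AG_comparable (𝒟 𝒟' : Fin 3 → Set ℂ)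
    (h : IsTDTplus 𝒟) (h' : IsTDTplus 𝒟') :
    (∃ c : ℝ, 0 < c ∧ ∀ s : ℝ, 0 < s →
      μH[s] (AG 𝒟) ≤ ENNReal.ofReal (c ^ s) * μH[s] (AG 𝒟')) ∧
    dimH (AG 𝒟) = dimH (AG 𝒟') := by
  refine ⟨?_, le_antisymm (dimH_AG_le h.1 h'.1) (dimH_AG_le h'.1 h.1)⟩
  obtain ⟨L, f, hL, hlip, hsub⟩ := exists_lipschitzOnWith_AG_subset_image h.1 h'.1
  refine ⟨L, hL, fun s hs => ?_⟩
  have hLs : ENNReal.ofReal ((L : ℝ) ^ s) = (L : ℝ≥0∞) ^ s := by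
    rw [← ENNReal.ofReal_rpow_of_pos (NNReal.coe_pos.2 hL), ENNReal.ofReal_coe_nnreal]
  rw [hLs]
  exact (measure_mono hsub).trans (hlip.hausdorffMeasure_image_le hs.le)
end

section
/- There exists c₁∈(0,+∞) such that for each ε∈(0,1), all g₁,g₂∈Γ_ε and all w∈W_*: |ℋ_Γ(g₁M_w) − ℋ_Γ(g₂M_w)| ≤ c₁·ε^{1−30d}·ℋ_Γ(g₁M_w)·ρ_Γ(g₁,g₂). -/
open MeasureTheory Filter Topology Matrix
open scoped ENNReal NNReal BigOperators

/-- A generalized disk, encoded by the coefficients of the Hermitian form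
`k |z|² + 2 Re (conj B * z) + l`. -/
@[ext] structure GenDisk where
  k : ℝ
  B : ℂ
  l : ℝ

/-- A Möbius transformation, encoded by a matrix of determinant one. -/
@[ext] structure Moeb where
  a : ℂ
  b : ℂ
  c : ℂ
  d : ℂ
  det : a * d - b * c = 1

namespace Moeb

instance : Mul Moeb := ⟨fun A P =>
  ⟨A.a * P.a + A.b * P.c, A.a * P.b + A.b * P.d, A.c * P.a + A.d * P.c, A.c * P.b + A.d * P.d, by
    linear_combination (P.a * P.d - P.b * P.c) * A.det + P.det⟩⟩

instance : One Moeb := ⟨⟨1, 0, 0, 1, by norm_num⟩⟩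

@[simp] lemma mul_a (A P : Moeb) : (A * P).a = A.a * P.a + A.b * P.c := rfl
@[simp] lemma mul_b (A P : Moeb) : (A * P).b = A.a * P.b + A.b * P.d := rfl
@[simp] lemma mul_c (A P : Moeb) : (A * P).c = A.c * P.a + A.d * P.c := rfl
@[simp] lemma mul_d (A P : Moeb) : (A * P).d = A.c * P.b + A.d * P.d := rfl
@[simp] lemma one_a : (1 : Moeb).a = 1 := rfl
@[simp] lemma one_b : (1 : Moeb).b = 0 := rfl
@[simp] lemma one_c : (1 : Moeb).c = 0 := rfl
@[simp] lemma one_d : (1 : Moeb).d = 1 := rfl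

protected lemma mul_assoc (A P Q : Moeb) : A * P * Q = A * (P * Q) := by
  ext <;> simp <;> ring

protected lemma mul_one (A : Moeb) : A * 1 = A := by
  ext <;> simp

/-- The denominator of the Möbius transformation. -/
def den (A : Moeb) (z : ℂ) : ℂ := A.c * z + A.d

/-- The Möbius transformation as a function (with junk value at the pole). -/
noncomputable def map (A : Moeb) (z : ℂ) : ℂ := (A.a * z + A.b) / A.den z

/-- The inverse Möbius transformation as a function. -/
noncomputable def inv (A : Moeb) (w : ℂ) : ℂ := (A.d * w - A.b) / (A.a - A.c * w)

lemma map_sub_map (A : Moeb) {x y : ℂ} (hx : A.den x ≠ 0) (hy : A.den y ≠ 0) :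
    A.map x - A.map y = (x - y) / (A.den x * A.den y) := by
  unfold map
  rw [div_sub_div _ _ hx hy]
  congr 1
  unfold den
  linear_combination (x - y) * A.det

lemma sub_mul_map (A : Moeb) {z : ℂ} (hz : A.den z ≠ 0) :
    A.a - A.c * A.map z = (A.den z)⁻¹ := by
  unfold map
  field_simp
  unfold den
  linear_combination A.det

lemma map_inv (A : Moeb) {w : ℂ} (hw : A.a - A.c * w ≠ 0) :
    A.den (A.inv w) ≠ 0 ∧ A.map (A.inv w) = w := by
  have h : A.den (A.inv w) = (A.a - A.c * w)⁻¹ := by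
    unfold den inv
    field_simp
    linear_combination A.det
  refine ⟨by rw [h]; exact inv_ne_zero hw, ?_⟩
  unfold map
  rw [h]
  unfold inv
  rw [div_inv_eq_mul, add_mul, mul_assoc, div_mul_cancel₀ _ hw]
  linear_combination w * A.det

lemma inv_map (A : Moeb) {z : ℂ} (hz : A.den z ≠ 0) : A.inv (A.map z) = z := by
  unfold inv
  rw [A.sub_mul_map hz]
  unfold map
  field_simp
  unfold den
  linear_combination z * A.det

end Moeb

namespace GenDisk

open ComplexConjugate

/-- The value of the Hermitian form of a generalized disk. -/
def ev (G : GenDisk) (z : ℂ) : ℝ := G.k * Complex.normSq z + 2 * (conj G.B * z).re + G.l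

/-- The open set bounded by a generalized circle. -/
def carrier (G : GenDisk) : Set ℂ := {z | G.ev z < 0}

/-- The polar form of the discriminant `2 (|B|² - k l)`. -/
def pair (G G' : GenDisk) : ℝ := 2 * (conj G.B * G'.B).re - G.k * G'.l - G'.k * G.l

/-- The image of a generalized disk under a Möbius transformation. -/
def act (A : Moeb) (G : GenDisk) : GenDisk where
  k := G.k * Complex.normSq A.d - 2 * (conj G.B * A.d * conj A.c).re + G.l * Complex.normSq A.c
  B := -G.k * A.b * conj A.d + G.B * conj A.d * A.a + conj G.B * A.b * conj A.c
    - G.l * A.a * conj A.c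
  l := G.k * Complex.normSq A.b - 2 * (conj G.B * A.b * conj A.a).re + G.l * Complex.normSq A.a

lemma act_mul (A P : Moeb) (G : GenDisk) : act (A * P) G = act A (act P G) := by
  ext
  · simp [act, Complex.normSq_apply]; ring
  · apply Complex.ext <;> simp [act, Complex.normSq_apply] <;> ring
  · simp [act, Complex.normSq_apply]; ring

lemma pair_act (A : Moeb) (G G' : GenDisk) : pair (act A G) (act A G') = pair G G' := by
  have h : pair (act A G) (act A G')
      = pair G G' * Complex.normSq (A.a * A.d - A.b * A.c) := by
    simp [act, pair, Complex.normSq_apply]; ring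
  rw [h, A.det]; simp

lemma ev_act (A : Moeb) (G : GenDisk) (w : ℂ) :
    (act A G).ev w = G.k * Complex.normSq (A.d * w - A.b)
      + 2 * (conj G.B * (A.d * w - A.b) * conj (A.a - A.c * w)).re
      + G.l * Complex.normSq (A.a - A.c * w) := by
  simp [act, ev, Complex.normSq_apply]; ring

lemma ev_act_eq (A : Moeb) (G : GenDisk) {w : ℂ} (hw : A.a - A.c * w ≠ 0) :
    (act A G).ev w = G.ev (A.inv w) * Complex.normSq (A.a - A.c * w) := by
  have h0 : Complex.normSq (A.a - A.c * w) ≠ 0 := by simpa using hw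
  rw [ev_act]
  unfold ev Moeb.inv
  rw [Complex.normSq_div, add_mul, add_mul, mul_assoc G.k, div_mul_cancel₀ _ h0]
  congr 2
  rw [mul_assoc 2, mul_div_assoc', ← Complex.re_mul_ofReal, ← Complex.mul_conj]
  congr 2
  rw [← mul_assoc, div_mul_cancel₀ _ hw]

lemma ev_act_map (A : Moeb) (G : GenDisk) {z : ℂ} (hz : A.den z ≠ 0) :
    (act A G).ev (A.map z) = G.ev z / Complex.normSq (A.den z) := by
  have h := A.sub_mul_map hz
  rw [ev_act_eq A G (by rw [h]; exact inv_ne_zero hz), A.inv_map hz, h, map_inv₀, div_eq_mul_inv]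

/-- The three generalized disks `Im z < 0`, `Im z > 1` and `|z - i/2| < 1/2`. -/
def std : Fin 3 → GenDisk :=
  ![⟨0, Complex.I, 0⟩, ⟨0, -Complex.I, 2⟩, ⟨2, -Complex.I, 0⟩]

/-- The disk `|z - 1 - i/2| < 1/2`, tangent to the members of `std`. -/
def inner : GenDisk := ⟨2, -2 - Complex.I, 2⟩

end GenDisk

namespace Moeb

open ComplexConjugate

/-- The parabolic transformations replacing one member of `GenDisk.std` by `GenDisk.inner`. -/
def gen : Fin 3 → Moeb :=
  ![⟨1 + Complex.I, 1, 1, 1 - Complex.I, by ring_nf; simp⟩, ⟨1, 0, 1, 1, by norm_num⟩,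
    ⟨1, 1, 0, 1, by norm_num⟩]

lemma act_gen (j : Fin 3) :
    (fun k => GenDisk.act (gen j) (GenDisk.std k))
      = Function.update GenDisk.std j GenDisk.inner := by
  funext k
  fin_cases j <;> fin_cases k <;> ext <;>
    simp [gen, GenDisk.std, GenDisk.act, GenDisk.inner, Function.update, Complex.normSq_apply,
      Complex.ext_iff] <;> norm_num

/-- The curvatures of the images of the members of `GenDisk.std`, followed by `κ`. -/
def curvatures (A : Moeb) : Fin 4 → ℝ :=
  ![-2 * (A.d * conj A.c).im, 2 * Complex.normSq A.c + 2 * (A.d * conj A.c).im,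
    2 * Complex.normSq A.d + 2 * (A.d * conj A.c).im, 2 * (A.d * conj A.c).re]

lemma curvatures_mul_gen (A : Moeb) (j : Fin 3) :
    (A * gen j).curvatures = Matrix.vecMul A.curvatures (Mmat j) := by
  funext i
  fin_cases j <;> fin_cases i <;>
    simp [curvatures, gen, Mmat, Matrix.vecMul, dotProduct, Fin.sum_univ_four,
      Complex.normSq_apply] <;> ring

lemma act_std_k (A : Moeb) (j : Fin 3) :
    (GenDisk.act A (GenDisk.std j)).k = A.curvatures j.castSucc := by
  fin_cases j <;> simp [GenDisk.act, GenDisk.std, curvatures, Complex.normSq_apply] <;> ring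

/-- The pole lies outside the standard triple and to the left of the strip region. -/
def Good (A : Moeb) : Prop := (∀ j : Fin 3, 0 ≤ A.curvatures j.castSucc) ∧ 0 < A.curvatures 3

lemma Good.mul_gen {A : Moeb} (h : A.Good) (j : Fin 3) : (A * gen j).Good := by
  obtain ⟨h1, h2⟩ := h
  have h10 : 0 ≤ A.curvatures 0 := h1 0
  have h11 : 0 ≤ A.curvatures 1 := h1 1
  have h12 : 0 ≤ A.curvatures 2 := h1 2
  unfold Good
  rw [curvatures_mul_gen]
  generalize A.curvatures = g at *
  refine ⟨fun i => ?_, ?_⟩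
  · fin_cases j <;> fin_cases i <;>
      simp [Mmat, Matrix.vecMul, dotProduct, Fin.sum_univ_four] <;> linarith
  · fin_cases j <;> simp [Mmat, Matrix.vecMul, dotProduct, Fin.sum_univ_four] <;> linarith

lemma Good.c_ne_zero {A : Moeb} (h : A.Good) : A.c ≠ 0 := by
  intro hc
  have := h.2
  simp [curvatures, hc] at this

/-- Append the generators of a word on the right. -/
def mulWord (A : Moeb) (w : Word) : Moeb := w.foldl (fun A j => A * gen j) A

lemma mulWord_cons (A : Moeb) (j : Fin 3) (w : Word) :
    A.mulWord (j :: w) = (A * gen j).mulWord w := rfl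

lemma mul_mulWord (P A : Moeb) (w : Word) : P * A.mulWord w = (P * A).mulWord w := by
  induction w generalizing A with
  | nil => rfl
  | cons j w ih => rw [mulWord_cons, ih, mulWord_cons, Moeb.mul_assoc]

lemma mulWord_eq (A : Moeb) (w : Word) : A.mulWord w = A * (1 : Moeb).mulWord w := by
  rw [mul_mulWord, Moeb.mul_one]

lemma Good.mulWord {A : Moeb} (h : A.Good) (w : Word) : (A.mulWord w).Good := by
  induction w generalizing A with
  | nil => exact h
  | cons j w ih => exact ih (h.mul_gen j)

lemma curvatures_mulWord (A : Moeb) (w : Word) :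
    (A.mulWord w).curvatures = Matrix.vecMul A.curvatures (Mword w) := by
  induction w generalizing A with
  | nil => simp [Moeb.mulWord, Mword]
  | cons j w ih =>
    rw [mulWord_cons, ih, curvatures_mul_gen]
    simp [Mword, Matrix.vecMul_vecMul]

/-- The image of the standard triple. -/
def triple (A : Moeb) (j : Fin 3) : Set ℂ := (GenDisk.act A (GenDisk.std j)).carrier

lemma triple_mul_gen (A : Moeb) (j : Fin 3) :
    (A * gen j).triple = Function.update A.triple j (GenDisk.act A GenDisk.inner).carrier := by
  funext k
  have h := congrFun (act_gen j) k
  unfold triple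
  rw [GenDisk.act_mul, h]
  rcases eq_or_ne k j with rfl | hk
  · simp
  · simp [hk]

end Moeb

namespace GenDisk

open ComplexConjugate

/-- Normalized forms of open disks and half-planes. -/
structure Normalized (G : GenDisk) : Prop where
  k_nonneg : 0 ≤ G.k
  pair_self : pair G G = 2

lemma Normalized.normSq_B {G : GenDisk} (h : G.Normalized) :
    Complex.normSq G.B = 1 + G.k * G.l := by
  have := h.pair_self
  simp only [pair, Complex.mul_re, Complex.conj_re, Complex.conj_im] at this
  rw [Complex.normSq_apply]
  linarith

/-- Half the gradient of the form. -/
def grad (G : GenDisk) (z : ℂ) : ℂ := G.k * z + G.B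

lemma ev_add (G : GenDisk) (z h : ℂ) :
    G.ev (z + h) = G.ev z + 2 * (conj (G.grad z) * h).re + G.k * Complex.normSq h := by
  simp [ev, grad, Complex.normSq_apply]; ring

lemma Normalized.normSq_grad {G : GenDisk} (h : G.Normalized) (z : ℂ) :
    Complex.normSq (G.grad z) = 1 + G.k * G.ev z := by
  have := h.normSq_B
  simp only [ev, grad, Complex.normSq_apply, Complex.add_re, Complex.add_im, Complex.mul_re,
    Complex.mul_im, Complex.ofReal_re, Complex.ofReal_im, Complex.conj_re, Complex.conj_im] at *
  linear_combination this

lemma pair_eq (G G' : GenDisk) (z : ℂ) :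
    pair G G' = 2 * (conj (G.grad z) * G'.grad z).re - G.k * G'.ev z - G'.k * G.ev z := by
  simp [ev, grad, pair, Complex.normSq_apply]; ring

lemma continuous_ev (G : GenDisk) : Continuous G.ev := by
  unfold ev
  have := Complex.continuous_normSq
  fun_prop

lemma isOpen_carrier (G : GenDisk) : IsOpen G.carrier :=
  isOpen_lt G.continuous_ev continuous_const

lemma eventually_quadratic_neg (a : ℝ) {b : ℝ} (hb : b < 0) :
    ∀ᶠ t : ℝ in 𝓝[>] 0, b * t + a * t ^ 2 < 0 := by
  have h : Tendsto (fun t : ℝ => b + a * t) (𝓝[>] 0) (𝓝 (b + a * 0)) :=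
    ((continuous_const.add (continuous_const.mul continuous_id)).tendsto 0).mono_left
      nhdsWithin_le_nhds
  filter_upwards [h.eventually_lt_const (show b + a * 0 < 0 by simpa using hb),
    self_mem_nhdsWithin] with t h1 h2
  nlinarith [mul_neg_of_neg_of_pos h1 h2]

lemma Normalized.closure_carrier {G : GenDisk} (h : G.Normalized) :
    closure G.carrier = {z | G.ev z ≤ 0} := by
  apply Set.Subset.antisymm
  · exact closure_minimal (fun z (hz : G.ev z < 0) => hz.le) (isClosed_le G.continuous_ev continuous_const)
  · intro z hz
    rcases lt_or_eq_of_le (show G.ev z ≤ 0 from hz) with hz | hz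
    · exact subset_closure hz
    · have hn := h.normSq_grad z
      rw [hz, mul_zero, add_zero] at hn
      have ht : Tendsto (fun t : ℝ => z + (t : ℂ) * (-G.grad z)) (𝓝[>] 0) (𝓝 z) := by
        have : Continuous (fun t : ℝ => z + (t : ℂ) * (-G.grad z)) := by fun_prop
        simpa using (this.tendsto 0).mono_left nhdsWithin_le_nhds
      refine mem_closure_of_tendsto ht ?_
      filter_upwards [eventually_quadratic_neg G.k (show (-2 : ℝ) < 0 by norm_num)] with t h1
      show G.ev _ < 0
      rw [ev_add, hz]
      have e : 2 * (conj (G.grad z) * ((t : ℂ) * -G.grad z)).re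
          = -2 * t * Complex.normSq (G.grad z) := by
        simp [Complex.normSq_apply]; ring
      rw [e, Complex.normSq_mul, Complex.normSq_neg, hn, Complex.normSq_ofReal]
      linarith

/-- The tangency point of two generalized disks. -/
noncomputable def contact (G G' : GenDisk) : ℂ := -(G.B + G'.B) / ((G.k + G'.k : ℝ) : ℂ)

lemma k_add_k_pos {G G' : GenDisk} (h : G.Normalized) (h' : G'.Normalized)
    (hk : 0 < G.k ∨ 0 < G'.k) : 0 < G.k + G'.k := by
  rcases hk with hk | hk
  · linarith [h'.k_nonneg]
  · linarith [h.k_nonneg]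

lemma ev_add_ev {G G' : GenDisk} (h : G.Normalized) (h' : G'.Normalized)
    (hp : pair G G' = -2) (hk : 0 < G.k + G'.k) (z : ℂ) :
    G.ev z + G'.ev z = (G.k + G'.k) * Complex.normSq (z - contact G G') := by
  have h1 := h.normSq_B
  have h2 := h'.normSq_B
  obtain ⟨k, B, l⟩ := G
  obtain ⟨k', B', l'⟩ := G'
  have hz : z - contact ⟨k, B, l⟩ ⟨k', B', l'⟩
      = (((k + k' : ℝ) : ℂ) * z + (B + B')) / ((k + k' : ℝ) : ℂ) := by
    have : ((k + k' : ℝ) : ℂ) ≠ 0 := by exact_mod_cast hk.ne'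
    unfold contact
    field_simp
    ring
  rw [hz, Complex.normSq_div, Complex.normSq_ofReal]
  dsimp only at *
  rw [mul_div_assoc', mul_div_mul_left _ _ hk.ne', eq_div_iff hk.ne']
  simp only [pair, Complex.mul_re, Complex.conj_re, Complex.conj_im, Complex.normSq_apply] at *
  simp only [ev, Complex.normSq_apply, Complex.add_re, Complex.add_im, Complex.mul_re,
    Complex.mul_im, Complex.ofReal_re, Complex.ofReal_im, Complex.conj_re, Complex.conj_im] at *
  linear_combination -h1 - h2 - hp

lemma ev_contact {G G' : GenDisk} (h : G.Normalized) (h' : G'.Normalized)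
    (hp : pair G G' = -2) (hk : 0 < G.k + G'.k) : G.ev (contact G G') = 0 := by
  have h0 := ev_add_ev h h' hp hk (contact G G')
  rw [sub_self, map_zero, mul_zero] at h0
  have h1 := pair_eq G G' (contact G G')
  have h2 : G'.grad (contact G G') = -G.grad (contact G G') := by
    have : ((G.k + G'.k : ℝ) : ℂ) ≠ 0 := by exact_mod_cast hk.ne'
    unfold grad contact
    field_simp
    push_cast
    ring_nf
  have h3 := h.normSq_grad (contact G G')
  rw [h2, hp] at h1
  have h4 : (conj (G.grad (contact G G')) * -G.grad (contact G G')).re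
      = -Complex.normSq (G.grad (contact G G')) := by
    simp [Complex.normSq_apply]
  rw [h4, h3] at h1
  have h5 : (G.k + G'.k) * G.ev (contact G G') = 0 := by
    linear_combination h1 - G.k * h0
  exact (mul_eq_zero.1 h5).resolve_left hk.ne'

lemma contact_comm (G G' : GenDisk) : contact G G' = contact G' G := by
  unfold contact; rw [add_comm G.B, add_comm G.k]

lemma pair_comm (G G' : GenDisk) : pair G G' = pair G' G := by
  simp [pair]; ring

lemma closure_inter_closure {G G' : GenDisk} (h : G.Normalized) (h' : G'.Normalized)
    (hp : pair G G' = -2) (hk : 0 < G.k + G'.k) :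
    closure G.carrier ∩ closure G'.carrier = {contact G G'} := by
  rw [h.closure_carrier, h'.closure_carrier]
  apply Set.Subset.antisymm
  · rintro z ⟨h1, h2⟩
    have h0 := ev_add_ev h h' hp hk z
    have h1 : G.ev z ≤ 0 := h1
    have h2 : G'.ev z ≤ 0 := h2
    have h3 : Complex.normSq (z - contact G G') = 0 :=
      le_antisymm (by nlinarith [Complex.normSq_nonneg (z - contact G G')])
        (Complex.normSq_nonneg _)
    simpa [sub_eq_zero] using h3
  · rintro z rfl
    refine ⟨(ev_contact h h' hp hk).le, ?_⟩
    rw [contact_comm]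
    exact (ev_contact h' h (by rwa [pair_comm]) (by rwa [add_comm])).le

lemma pair_eq_of_closure_inter {G G' : GenDisk} (h : G.Normalized) (h' : G'.Normalized) {p : ℂ}
    (hp : closure G.carrier ∩ closure G'.carrier = {p}) : pair G G' = -2 := by
  have hpm : p ∈ closure G.carrier ∩ closure G'.carrier := by rw [hp]; rfl
  have hd : ∀ x, ¬ (x ∈ G.carrier ∧ x ∈ G'.carrier) := by
    intro x hx
    have hs : G.carrier ∩ G'.carrier = {p} := by
      refine Set.Nonempty.subset_singleton_iff ⟨x, hx⟩ |>.1 ?_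
      rw [← hp]
      exact Set.inter_subset_inter subset_closure subset_closure
    exact not_isOpen_singleton p (hs ▸ G.isOpen_carrier.inter G'.isOpen_carrier)
  have hp1 : G.ev p ≤ 0 := by
    have := hpm.1; rwa [h.closure_carrier] at this
  have hp2 : G'.ev p ≤ 0 := by
    have := hpm.2; rwa [h'.closure_carrier] at this
  have e1 : G.ev p = 0 := by
    by_contra hne
    obtain ⟨x, hx⟩ := mem_closure_iff.1 hpm.2 _ G.isOpen_carrier (lt_of_le_of_ne hp1 hne)
    exact hd x hx
  have e2 : G'.ev p = 0 := by
    by_contra hne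
    obtain ⟨x, hx⟩ := mem_closure_iff.1 hpm.1 _ G'.isOpen_carrier (lt_of_le_of_ne hp2 hne)
    exact hd x ⟨hx.2, hx.1⟩
  have n1 := h.normSq_grad p
  have n2 := h'.normSq_grad p
  rw [e1, mul_zero, add_zero] at n1
  rw [e2, mul_zero, add_zero] at n2
  rw [pair_eq G G' p, e1, e2]
  generalize hn : G.grad p = n at *
  generalize hn' : G'.grad p = n' at *
  set s := (conj n * n').re with hs
  have hs1 : Complex.normSq (n + n') = 2 + 2 * s := by
    rw [Complex.normSq_add, n1, n2, hs]; simp; ring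
  have hs2 : 0 ≤ 2 + 2 * s := hs1 ▸ Complex.normSq_nonneg _
  have hs3 : s ≤ -1 := by
    by_contra! hlt
    have hb : -2 * (1 + s) < 0 := by linarith
    obtain ⟨t, ht1, ht2⟩ := ((eventually_quadratic_neg (G.k * (2 + 2 * s)) hb).and
      (eventually_quadratic_neg (G'.k * (2 + 2 * s)) hb)).exists
    have q1 : (conj n * ((t : ℂ) * -(n + n'))).re = -t * (1 + s) := by
      rw [← n1, hs]; simp [Complex.normSq_apply]; ring
    have q2 : (conj n' * ((t : ℂ) * -(n + n'))).re = -t * (1 + s) := by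
      rw [← n2, hs]; simp [Complex.normSq_apply]; ring
    refine hd (p + (t : ℂ) * -(n + n')) ⟨?_, ?_⟩
    · show G.ev _ < 0
      rw [ev_add, hn, e1, q1, Complex.normSq_mul, Complex.normSq_neg, hs1, Complex.normSq_ofReal]
      linarith
    · show G'.ev _ < 0
      rw [ev_add, hn', e2, q2, Complex.normSq_mul, Complex.normSq_neg, hs1, Complex.normSq_ofReal]
      linarith
  linarith

lemma Normalized.ev_eq_of_pos {G : GenDisk} (h : G.Normalized) (hk : 0 < G.k) (z : ℂ) :
    G.ev z = G.k * (Complex.normSq (z - -G.B / (G.k : ℂ)) - (G.k⁻¹) ^ 2) := by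
  have h1 := h.normSq_B
  have hk' : (G.k : ℂ) ≠ 0 := by exact_mod_cast hk.ne'
  have hz : z - -G.B / (G.k : ℂ) = ((G.k : ℂ) * z + G.B) / (G.k : ℂ) := by
    field_simp; ring
  rw [hz, Complex.normSq_div, Complex.normSq_ofReal]
  have h2 := h.normSq_grad z
  unfold grad at h2
  rw [h2]
  field_simp
  ring

lemma Normalized.carrier_eq_ball {G : GenDisk} (h : G.Normalized) (hk : 0 < G.k) :
    G.carrier = Metric.ball (-G.B / (G.k : ℂ)) G.k⁻¹ := by
  ext z
  show G.ev z < 0 ↔ _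
  rw [h.ev_eq_of_pos hk, mul_neg_iff, Metric.mem_ball, Complex.dist_eq,
    ← sq_lt_sq₀ (norm_nonneg _) (inv_nonneg.2 hk.le), Complex.sq_norm]
  constructor
  · rintro (⟨-, h⟩ | ⟨h, -⟩) <;> linarith
  · intro h
    exact Or.inl ⟨hk, by linarith⟩

lemma exists_of_ball (z : ℂ) {r : ℝ} (hr : 0 < r) :
    ∃ G : GenDisk, G.Normalized ∧ G.k = r⁻¹ ∧ Metric.ball z r = G.carrier := by
  have hr' : (r : ℂ) ≠ 0 := by exact_mod_cast hr.ne'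
  have hn : GenDisk.Normalized ⟨r⁻¹, -z / r, (Complex.normSq z - r ^ 2) / r⟩ := by
    refine ⟨(inv_pos.2 hr).le, ?_⟩
    simp only [pair, ← Complex.normSq_eq_conj_mul_self, Complex.ofReal_re, Complex.normSq_div,
      Complex.normSq_neg, Complex.normSq_ofReal]
    field_simp
    ring
  refine ⟨_, hn, rfl, ?_⟩
  rw [hn.carrier_eq_ball (inv_pos.2 hr)]
  dsimp only
  congr 1
  · push_cast; field_simp
  · simp

lemma not_isBounded_halfPlane {a : ℂ} (ha : a ≠ 0) (c : ℝ) :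
    ¬ Bornology.IsBounded {z : ℂ | (a * z).re < c} := by
  intro hb
  obtain ⟨R, hR⟩ := hb.exists_norm_le
  have hn : 0 < ‖a‖ := norm_pos_iff.2 ha
  set t : ℝ := (|c| + 1) / ‖a‖ ^ 2 + (|R| + 1) / ‖a‖ with ht
  have ht1 : |c| + 1 ≤ t * ‖a‖ ^ 2 := by
    have : t * ‖a‖ ^ 2 = |c| + 1 + (|R| + 1) * ‖a‖ := by rw [ht]; field_simp
    rw [this]
    have := mul_nonneg (add_nonneg (abs_nonneg R) zero_le_one) hn.le
    linarith
  have ht2 : |R| + 1 ≤ t * ‖a‖ := by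
    have : t * ‖a‖ = (|c| + 1) / ‖a‖ + (|R| + 1) := by rw [ht]; field_simp
    rw [this]
    have : 0 ≤ (|c| + 1) / ‖a‖ := by positivity
    linarith
  have ht0 : 0 ≤ t := by positivity
  have hm : -(t : ℂ) * conj a ∈ {z : ℂ | (a * z).re < c} := by
    show (a * (-(t : ℂ) * conj a)).re < c
    have : (a * (-(t : ℂ) * conj a)).re = -(t * ‖a‖ ^ 2) := by
      rw [Complex.sq_norm, Complex.normSq_apply]; simp; ring
    rw [this]
    linarith [neg_abs_le c]
  have := hR _ hm
  rw [norm_mul, norm_neg, Complex.norm_real, Real.norm_of_nonneg ht0, RCLike.norm_conj] at this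
  linarith [le_abs_self R]

lemma exists_of_halfPlane {a : ℂ} (ha : a ≠ 0) (c : ℝ) :
    ∃ G : GenDisk, G.Normalized ∧ G.k = 0 ∧ {z : ℂ | (a * z).re < c} = G.carrier := by
  have hn : 0 < ‖a‖ := norm_pos_iff.2 ha
  have hn' : (‖a‖ : ℂ) ≠ 0 := by exact_mod_cast hn.ne'
  refine ⟨⟨0, conj a / ‖a‖, -2 * c / ‖a‖⟩, ⟨le_rfl, ?_⟩, rfl, ?_⟩
  · simp only [pair, ← Complex.normSq_eq_conj_mul_self, Complex.ofReal_re, Complex.normSq_div,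
      Complex.normSq_conj, Complex.normSq_ofReal]
    rw [← Complex.sq_norm]
    field_simp
    ring
  · ext z
    show (a * z).re < c ↔ ev _ z < 0
    have : (conj (conj a / (‖a‖ : ℂ)) * z).re = (a * z).re / ‖a‖ := by
      rw [map_div₀, Complex.conj_conj, Complex.conj_ofReal, div_mul_eq_mul_div,
        Complex.div_ofReal_re]
    unfold ev
    rw [this]
    dsimp only
    rw [zero_mul, zero_add, mul_div_assoc', ← add_div, div_neg_iff]
    constructor
    · intro h; right; exact ⟨by linarith, hn⟩
    · rintro (⟨-, h⟩ | ⟨h, -⟩)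
      · linarith
      · linarith

lemma curv_ball (z : ℂ) {r : ℝ} (hr : 0 < r) : curv (Metric.ball z r) = r⁻¹ := by
  have hd : IsOpenDisk (Metric.ball z r) := ⟨z, r, hr, rfl⟩
  unfold curv
  rw [if_pos hd]
  obtain ⟨h1, z', h2⟩ : 0 < diskRadius (Metric.ball z r) ∧
      ∃ z' : ℂ, Metric.ball z r = Metric.ball z' (diskRadius (Metric.ball z r)) :=
    Classical.epsilon_spec (p := fun s : ℝ => 0 < s ∧ ∃ z' : ℂ, Metric.ball z r = Metric.ball z' s)
      ⟨r, hr, z, rfl⟩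
  have h3 := congrArg Metric.diam h2
  rw [Metric.diam_ball_eq _ hr.le, Metric.diam_ball_eq _ h1.le] at h3
  congr 1
  linarith

lemma Normalized.isOpenHalfPlane {G : GenDisk} (h : G.Normalized) (hk : G.k = 0) :
    IsOpenHalfPlane G.carrier := by
  have h1 := h.normSq_B
  refine ⟨conj G.B, ?_, -G.l / 2, ?_⟩
  · intro h0
    rw [map_eq_zero] at h0
    simp [h0, hk] at h1
  · ext z
    show G.ev z < 0 ↔ _
    unfold ev
    show _ ↔ (conj G.B * z).re < -G.l / 2
    rw [hk]
    constructor <;> intro h <;> linarith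

lemma Normalized.isOpenDisk {G : GenDisk} (h : G.Normalized) (hk : 0 < G.k) :
    IsOpenDisk G.carrier := ⟨_, _, inv_pos.2 hk, h.carrier_eq_ball hk⟩

lemma Normalized.curv_carrier {G : GenDisk} (h : G.Normalized) : curv G.carrier = G.k := by
  rcases h.k_nonneg.eq_or_lt with hk | hk
  · obtain ⟨a, ha, c, hc⟩ := h.isOpenHalfPlane hk.symm
    unfold curv
    rw [if_neg, hk]
    rintro ⟨z, r, hr, hz⟩
    exact not_isBounded_halfPlane ha c (by rw [← hc, hz]; exact Metric.isBounded_ball)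
  · rw [h.carrier_eq_ball hk, curv_ball _ (inv_pos.2 hk), inv_inv]

end GenDisk

namespace GenDisk

open ComplexConjugate

lemma std_pair (j k : Fin 3) : pair (std j) (std k) = if j = k then 2 else -2 := by
  fin_cases j <;> fin_cases k <;> simp [pair, std] <;> norm_num

lemma inner_pair_std (j : Fin 3) : pair inner (std j) = -2 := by
  fin_cases j <;> simp [pair, std, inner] <;> norm_num

lemma inner_pair_inner : pair inner inner = 2 := by
  simp [pair, inner]; norm_num

@[simp] lemma ev_std_zero (z : ℂ) : (std 0).ev z = 2 * z.im := by
  simp [ev, std]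

@[simp] lemma ev_std_one (z : ℂ) : (std 1).ev z = 2 - 2 * z.im := by
  simp [ev, std]; ring

@[simp] lemma ev_std_two (z : ℂ) : (std 2).ev z = 2 * (z.re ^ 2 + z.im ^ 2 - z.im) := by
  simp [ev, std, Complex.normSq_apply]; ring

end GenDisk

namespace Moeb

open ComplexConjugate

lemma curvatures_three_sq (A : Moeb) :
    A.curvatures 3 ^ 2 = A.curvatures 1 * A.curvatures 2 + A.curvatures 2 * A.curvatures 0
      + A.curvatures 0 * A.curvatures 1 := by
  simp [curvatures, Complex.normSq_apply]; ring

lemma Good.add_pos {A : Moeb} (h : A.Good) {j k : Fin 3} (hjk : j ≠ k) :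
    0 < A.curvatures j.castSucc + A.curvatures k.castSucc := by
  have h0 : 0 ≤ A.curvatures 0 := h.1 0
  have h1 : 0 ≤ A.curvatures 1 := h.1 1
  have h2 : 0 ≤ A.curvatures 2 := h.1 2
  have h3 := A.curvatures_three_sq
  have h4 : 0 < A.curvatures 3 ^ 2 := pow_pos h.2 2
  rw [h3] at h4
  generalize A.curvatures = g at *
  have key : ∀ x y z : ℝ, 0 ≤ x → 0 ≤ y → 0 ≤ z → 0 < x * y + y * z + z * x → 0 < x + y := by
    intro x y z hx hy hz hp
    by_contra! hn
    have hx0 : x = 0 := by linarith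
    have hy0 : y = 0 := by linarith
    simp [hx0, hy0] at hp
  fin_cases j <;> fin_cases k <;> simp at hjk ⊢
  · exact key _ _ (g 2) h0 h1 h2 (by linarith)
  · exact key _ _ (g 1) h0 h2 h1 (by linarith)
  · exact key _ _ (g 2) h1 h0 h2 (by linarith)
  · exact key _ _ (g 0) h1 h2 h0 (by linarith)
  · exact key _ _ (g 1) h2 h0 h1 (by linarith)
  · exact key _ _ (g 0) h2 h1 h0 (by linarith)

lemma Good.normalized {A : Moeb} (h : A.Good) (j : Fin 3) :
    (GenDisk.act A (GenDisk.std j)).Normalized :=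
  ⟨by rw [act_std_k]; exact h.1 j, by rw [GenDisk.pair_act, GenDisk.std_pair, if_pos rfl]⟩

lemma Good.curv_triple {A : Moeb} (h : A.Good) (j : Fin 3) :
    curv (A.triple j) = A.curvatures j.castSucc := by
  rw [triple, (h.normalized j).curv_carrier, act_std_k]

lemma act_inner_k (A : Moeb) : (GenDisk.act A GenDisk.inner).k
    = A.curvatures 0 + A.curvatures 1 + A.curvatures 2 + 2 * A.curvatures 3 := by
  simp [GenDisk.act, GenDisk.inner, curvatures, Complex.normSq_apply]; ring

lemma Good.act_inner_k_pos {A : Moeb} (h : A.Good) : 0 < (GenDisk.act A GenDisk.inner).k := by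
  have h0 : 0 ≤ A.curvatures 0 := h.1 0
  have h1 : 0 ≤ A.curvatures 1 := h.1 1
  have h2 : 0 ≤ A.curvatures 2 := h.1 2
  rw [act_inner_k]
  linarith [h.2]

lemma Good.normalized_inner {A : Moeb} (h : A.Good) :
    (GenDisk.act A GenDisk.inner).Normalized :=
  ⟨h.act_inner_k_pos.le, by rw [GenDisk.pair_act, GenDisk.inner_pair_inner]⟩

lemma Good.closure_inter_closure {A : Moeb} (h : A.Good) {j k : Fin 3} (hjk : j ≠ k) :
    closure (A.triple j) ∩ closure (A.triple k)
      = {GenDisk.contact (GenDisk.act A (GenDisk.std j)) (GenDisk.act A (GenDisk.std k))} :=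
  GenDisk.closure_inter_closure (h.normalized j) (h.normalized k)
    (by rw [GenDisk.pair_act, GenDisk.std_pair, if_neg hjk])
    (by rw [act_std_k, act_std_k]; exact h.add_pos hjk)

lemma Good.isTDT {A : Moeb} (h : A.Good) : IsTDT A.triple := by
  refine ⟨?_, fun j k hjk => ⟨_, h.closure_inter_closure hjk⟩⟩
  by_cases hall : ∀ j, 0 < A.curvatures (Fin.castSucc j)
  · left
    intro j
    exact (h.normalized j).isOpenDisk (by rw [act_std_k]; exact hall j)
  · right
    push Not at hall
    obtain ⟨j, hj⟩ := hall
    have hj0 : A.curvatures j.castSucc = 0 := le_antisymm hj (h.1 j)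
    refine ⟨j, (h.normalized j).isOpenHalfPlane (by rw [act_std_k, hj0]), fun k hk => ?_⟩
    refine (h.normalized k).isOpenDisk ?_
    have := h.add_pos hk
    rw [act_std_k]
    linarith

lemma Good.den_ne_zero {A : Moeb} (h : A.Good) {z : ℂ} (hz : 0 ≤ z.re) : A.den z ≠ 0 := by
  intro h0
  have hd : A.d = -(A.c * z) := by
    unfold den at h0; linear_combination h0
  have h2 := h.2
  simp only [curvatures, Matrix.cons_val, hd] at h2
  have h3 : (-(A.c * z) * conj A.c).re = -(z.re * Complex.normSq A.c) := by
    simp [Complex.normSq_apply]; ring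
  rw [h3] at h2
  nlinarith [mul_nonneg hz (Complex.normSq_nonneg A.c)]

/-- The ideal triangle to the right of the disk `GenDisk.std 2`. -/
def region : Set ℂ := {z | 0 < z.re ∧ ∀ j, 0 < (GenDisk.std j).ev z}

lemma Good.mem_compl_iff {A : Moeb} (h : A.Good) (w : ℂ) :
    w ∈ (⋃ j, closure (A.triple j))ᶜ ↔ ∀ j, 0 < (GenDisk.act A (GenDisk.std j)).ev w := by
  simp only [Set.mem_compl_iff, Set.mem_iUnion, not_exists, triple]
  refine forall_congr' fun j => ?_
  rw [(h.normalized j).closure_carrier]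
  exact not_le (a := (GenDisk.act A (GenDisk.std j)).ev w)

lemma Good.a_sub_ne_zero {A : Moeb} (h : A.Good) {w : ℂ}
    (hw : w ∈ (⋃ j, closure (A.triple j))ᶜ) : A.a - A.c * w ≠ 0 := by
  intro h0
  have := (h.mem_compl_iff w).1 hw 0
  rw [GenDisk.ev_act, h0] at this
  simp [GenDisk.std] at this

lemma Good.map_mem_compl_iff {A : Moeb} (h : A.Good) {z : ℂ} (hz : A.den z ≠ 0) :
    A.map z ∈ (⋃ j, closure (A.triple j))ᶜ ↔ ∀ j, 0 < (GenDisk.std j).ev z := by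
  rw [h.mem_compl_iff]
  refine forall_congr' fun j => ?_
  rw [GenDisk.ev_act_map A _ hz]
  exact div_pos_iff_of_pos_right (Complex.normSq_pos.2 hz)

lemma re_ne_zero_of_ev_pos {z : ℂ} (hz : ∀ j, 0 < (GenDisk.std j).ev z) : z.re ≠ 0 := by
  intro h
  have h0 := hz 0
  have h1 := hz 1
  have h2 := hz 2
  simp only [GenDisk.ev_std_zero, GenDisk.ev_std_one, GenDisk.ev_std_two, h] at h0 h1 h2
  nlinarith

lemma Good.exists_of_mem_compl {A : Moeb} (h : A.Good) {w : ℂ}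
    (hw : w ∈ (⋃ j, closure (A.triple j))ᶜ) :
    A.den (A.inv w) ≠ 0 ∧ A.map (A.inv w) = w ∧ ∀ j, 0 < (GenDisk.std j).ev (A.inv w) := by
  obtain ⟨h1, h2⟩ := A.map_inv (h.a_sub_ne_zero hw)
  refine ⟨h1, h2, ?_⟩
  rwa [← h.map_mem_compl_iff h1, h2]

lemma isPreconnected_region : IsPreconnected region := by
  have hs : IsPreconnected (Set.Ioi (0 : ℝ) ×ˢ Set.Ioo (0 : ℝ) 1) :=
    isPreconnected_Ioi.prod isPreconnected_Ioo
  have hc : Continuous fun p : ℝ × ℝ =>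
      ((Real.sqrt (p.2 - p.2 ^ 2) + p.1 : ℝ) : ℂ) + (p.2 : ℂ) * Complex.I := by fun_prop
  have := hs.image _ hc.continuousOn
  convert this using 1
  ext z
  simp only [region, Set.mem_image, Set.mem_prod, Set.mem_Ioi, Set.mem_Ioo, Prod.exists]
  constructor
  · rintro ⟨hx, hz⟩
    have h0 := hz 0
    have h1 := hz 1
    have h2 := hz 2
    simp only [GenDisk.ev_std_zero, GenDisk.ev_std_one, GenDisk.ev_std_two] at h0 h1 h2
    refine ⟨z.re - Real.sqrt (z.im - z.im ^ 2), z.im, ⟨?_, by linarith, by linarith⟩, ?_⟩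
    · rw [sub_pos, Real.sqrt_lt' hx]; linarith
    · simp [Complex.re_add_im]
  · rintro ⟨t, y, ⟨ht, hy0, hy1⟩, rfl⟩
    have hn : 0 ≤ y - y ^ 2 := by nlinarith
    have hs := Real.sq_sqrt hn
    have hs0 := Real.sqrt_nonneg (y - y ^ 2)
    refine ⟨by simp; linarith, fun j => ?_⟩
    fin_cases j
    · simpa using hy0
    · simpa using hy1
    · simp
      nlinarith [mul_nonneg hs0 ht.le, pow_pos ht 2]

lemma continuousOn_map (A : Moeb) : ContinuousOn A.map {z | A.den z ≠ 0} := by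
  unfold map den
  exact ContinuousOn.div (by fun_prop) (by fun_prop) fun z hz => hz

lemma continuousOn_inv (A : Moeb) : ContinuousOn A.inv {w | A.a - A.c * w ≠ 0} := by
  unfold inv
  exact ContinuousOn.div (by fun_prop) (by fun_prop) fun z hz => hz

lemma Good.image_region_subset {A : Moeb} (h : A.Good) :
    A.map '' region ⊆ (⋃ j, closure (A.triple j))ᶜ := by
  rintro _ ⟨z, hz, rfl⟩
  exact (h.map_mem_compl_iff (h.den_ne_zero hz.1.le)).2 hz.2

lemma Good.connectedComponentIn_region {A : Moeb} (h : A.Good) {z : ℂ} (hz : z ∈ region) :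
    connectedComponentIn (⋃ j, closure (A.triple j))ᶜ (A.map z) = A.map '' region := by
  apply Set.Subset.antisymm
  · set C := connectedComponentIn (⋃ j, closure (A.triple j))ᶜ (A.map z)
    have hCU : C ⊆ (⋃ j, closure (A.triple j))ᶜ := connectedComponentIn_subset _ _
    have hcont : ContinuousOn (fun w => (A.inv w).re) C :=
      Complex.continuous_re.comp_continuousOn
        (A.continuousOn_inv.mono fun w hw => h.a_sub_ne_zero (hCU hw))
    have hpre := (isPreconnected_connectedComponentIn (F := (⋃ j, closure (A.triple j))ᶜ)
      (x := A.map z)).image _ hcont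
    have hzC : A.map z ∈ C :=
      mem_connectedComponentIn (h.image_region_subset ⟨z, hz, rfl⟩)
    intro w hw
    obtain ⟨h1, h2, h3⟩ := h.exists_of_mem_compl (hCU hw)
    refine ⟨A.inv w, ⟨?_, h3⟩, h2⟩
    by_contra! hle
    have hz' : (A.inv (A.map z)).re = z.re := by rw [A.inv_map (h.den_ne_zero hz.1.le)]
    have hmem : (0 : ℝ) ∈ (fun w => (A.inv w).re) '' C :=
      hpre.ordConnected.out ⟨w, hw, rfl⟩ ⟨A.map z, hzC, rfl⟩ ⟨hle, by
        show 0 ≤ (A.inv (A.map z)).re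
        rw [hz']; exact hz.1.le⟩
    obtain ⟨v, hv, hv0⟩ := hmem
    exact re_ne_zero_of_ev_pos (h.exists_of_mem_compl (hCU hv)).2.2 hv0
  · refine IsPreconnected.subset_connectedComponentIn ?_ ⟨z, hz, rfl⟩ h.image_region_subset
    exact isPreconnected_region.image _
      (A.continuousOn_map.mono fun z hz => h.den_ne_zero hz.1.le)

lemma norm_den_ge (A : Moeb) {z : ℂ} (hz : 0 ≤ z.re) :
    A.curvatures 3 / 2 ≤ ‖A.den z‖ * ‖A.c‖ := by
  have h1 : (A.den z * conj A.c).re = z.re * Complex.normSq A.c + (A.d * conj A.c).re := by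
    simp [den, Complex.normSq_apply]; ring
  have h2 : A.curvatures 3 = 2 * (A.d * conj A.c).re := by simp [curvatures]
  calc A.curvatures 3 / 2 ≤ (A.den z * conj A.c).re := by
        rw [h1, h2]
        linarith [mul_nonneg hz (Complex.normSq_nonneg A.c)]
    _ ≤ ‖A.den z * conj A.c‖ := Complex.re_le_norm _
    _ = _ := by rw [norm_mul, RCLike.norm_conj]

lemma Good.isBounded_image_region {A : Moeb} (h : A.Good) :
    Bornology.IsBounded (A.map '' region) := by
  have hc : 0 < ‖A.c‖ := norm_pos_iff.2 h.c_ne_zero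
  rw [isBounded_iff_forall_norm_le]
  refine ⟨(‖A.a‖ + (A.curvatures 3 / 2 / ‖A.c‖)⁻¹) / ‖A.c‖, ?_⟩
  rintro _ ⟨z, hz, rfl⟩
  have h1 := A.sub_mul_map (h.den_ne_zero hz.1.le)
  have h2 : A.c * A.map z = A.a - (A.den z)⁻¹ := by rw [← h1]; ring
  rw [le_div_iff₀ hc, mul_comm, ← norm_mul, h2]
  refine (norm_sub_le _ _).trans ?_
  rw [norm_inv]
  gcongr
  · exact div_pos (half_pos h.2) hc
  · rw [div_le_iff₀ hc]
    exact A.norm_den_ge hz.1.le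

end Moeb

namespace Moeb

open ComplexConjugate

lemma ev_pole_nonneg {A : Moeb} (h : A.Good) (j : Fin 3) :
    0 ≤ (GenDisk.std j).ev (-(A.d / A.c)) := by
  have hc : 0 < Complex.normSq A.c := Complex.normSq_pos.2 h.c_ne_zero
  set p := -(A.d / A.c)
  have hd : A.d = -(A.c * p) := by simp only [p]; field_simp [h.c_ne_zero]
  have hcurv : A.curvatures j.castSucc = Complex.normSq A.c * (GenDisk.std j).ev p := by
    fin_cases j
    · simp [curvatures, hd, Complex.normSq_apply]; ring
    · simp [curvatures, hd, Complex.normSq_apply]; ring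
    · simp [curvatures, hd, Complex.normSq_apply]; ring
  have h1 := h.1 j
  rw [hcurv] at h1
  exact nonneg_of_mul_nonneg_right h1 hc

lemma re_pole_neg {A : Moeb} (h : A.Good) : (-(A.d / A.c)).re < 0 := by
  by_contra! hn
  apply h.den_ne_zero hn
  unfold den
  field_simp [h.c_ne_zero]
  ring

lemma Good.not_isBounded_component {A : Moeb} (h : A.Good) {z : ℂ}
    (hz : ∀ j, 0 < (GenDisk.std j).ev z) (hre : z.re < 0) (hden : A.den z ≠ 0) :
    ¬ Bornology.IsBounded (connectedComponentIn (⋃ j, closure (A.triple j))ᶜ (A.map z)) := by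
  intro hb
  obtain ⟨R, hR⟩ := isBounded_iff_forall_norm_le.1 hb
  have h0 := hz 0
  have h1 := hz 1
  have h2 := hz 2
  simp only [GenDisk.ev_std_zero, GenDisk.ev_std_one, GenDisk.ev_std_two] at h0 h1 h2
  set p := -(A.d / A.c) with hp
  have p0 : 0 ≤ (GenDisk.std 0).ev p := ev_pole_nonneg h 0
  have p1 : 0 ≤ (GenDisk.std 1).ev p := ev_pole_nonneg h 1
  have p2 : 0 ≤ (GenDisk.std 2).ev p := ev_pole_nonneg h 2
  have hpre : p.re < 0 := re_pole_neg h
  have hdp : A.den p = 0 := by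
    unfold den; rw [hp]; field_simp [h.c_ne_zero]; ring
  simp only [GenDisk.ev_std_zero, GenDisk.ev_std_one, GenDisk.ev_std_two] at p0 p1 p2
  set s : ℂ → ℝ := fun z => -z.re - Real.sqrt (z.im - z.im ^ 2) with hs
  have hsz : 0 < s z := by
    simp only [hs]
    rw [sub_pos, Real.sqrt_lt' (by linarith)]
    nlinarith
  have hsp : 0 ≤ s p := by
    simp only [hs]
    rw [sub_nonneg, Real.sqrt_le_left (by linarith)]
    nlinarith
  set y : ℝ → ℝ := fun t => (1 - t) * z.im + t * p.im with hy
  set σ : ℝ → ℝ := fun t => (1 - t) * s z + t * s p with hσ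
  set γ : ℝ → ℂ := fun t =>
    ((-(Real.sqrt (y t - y t ^ 2) + σ t) : ℝ) : ℂ) + (y t : ℂ) * Complex.I with hγ
  have hγre : ∀ t, (γ t).re = -(Real.sqrt (y t - y t ^ 2) + σ t) := fun t => by simp [hγ]
  have hγim : ∀ t, (γ t).im = y t := fun t => by simp [hγ]
  have hγc : Continuous γ := by fun_prop
  have hγ0 : γ 0 = z := by
    apply Complex.ext
    · rw [hγre]; simp [hy, hσ, hs]
    · rw [hγim]; simp [hy]
  have hγ1 : γ 1 = p := by
    apply Complex.ext
    · rw [hγre]; simp [hy, hσ, hs]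
    · rw [hγim]; simp [hy]
  have hev : ∀ t ∈ Set.Ico (0 : ℝ) 1, ∀ j, 0 < (GenDisk.std j).ev (γ t) := by
    rintro t ⟨ht0, ht1⟩ j
    have hy0 : 0 < y t := by
      simp only [hy]
      have := mul_pos (sub_pos.2 ht1) (show 0 < z.im by linarith)
      nlinarith
    have hy1 : y t < 1 := by
      simp only [hy]
      have := mul_pos (sub_pos.2 ht1) (show 0 < 1 - z.im by linarith)
      nlinarith
    have hσ0 : 0 < σ t := by
      simp only [hσ]
      have := mul_pos (sub_pos.2 ht1) hsz
      nlinarith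
    fin_cases j
    · simp only [Fin.zero_eta, GenDisk.ev_std_zero, hγim]; linarith
    · simp only [Fin.mk_one, GenDisk.ev_std_one, hγim]; linarith
    · simp only [Fin.reduceFinMk, GenDisk.ev_std_two, hγim, hγre]
      have hn : 0 ≤ y t - y t ^ 2 := by nlinarith
      have hq := Real.sq_sqrt hn
      have hq0 := Real.sqrt_nonneg (y t - y t ^ 2)
      nlinarith [mul_nonneg hq0 hσ0.le, pow_pos hσ0 2]
  have hne : ∀ t ∈ Set.Ico (0 : ℝ) 1, A.den (γ t) ≠ 0 := by
    rintro t ⟨ht0, ht1⟩ hd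
    have hγp : γ t = p := by
      have : A.c * γ t = A.c * p := by
        unfold den at hd hdp; linear_combination hd - hdp
      exact mul_left_cancel₀ h.c_ne_zero this
    have e1 : y t = p.im := by rw [← hγim, hγp]
    have e2 := hγre t
    rw [hγp, e1] at e2
    have e3 : σ t = s p := by simp only [hs]; linarith
    have e4 : z.im = p.im := by
      have : (1 - t) * (z.im - p.im) = 0 := by simp only [hy] at e1; linarith
      rcases mul_eq_zero.1 this with h' | h' <;> linarith
    have e5 : s z = s p := by
      have : (1 - t) * (s z - s p) = 0 := by simp only [hσ] at e3; linarith
      rcases mul_eq_zero.1 this with h' | h' <;> linarith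
    have e6 : z.re = p.re := by
      simp only [hs, e4] at e5; linarith
    exact hden (by rw [Complex.ext e6 e4]; exact hdp)
  have hsub : (fun t => A.map (γ t)) '' Set.Ico (0 : ℝ) 1 ⊆
      connectedComponentIn (⋃ j, closure (A.triple j))ᶜ (A.map z) := by
    refine IsPreconnected.subset_connectedComponentIn ?_ ⟨0, by simp, by simp [hγ0]⟩ ?_
    · exact isPreconnected_Ico.image _
        (A.continuousOn_map.comp hγc.continuousOn fun t ht => hne t ht)
    · rintro _ ⟨t, ht, rfl⟩
      exact (h.map_mem_compl_iff (hne t ht)).2 (hev t ht)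
  have hle : Set.Ico (0 : ℝ) 1 ⊆ {t | 1 ≤ (‖A.a‖ + ‖A.c‖ * R) * ‖A.den (γ t)‖} := by
    intro t ht
    have hR' := hR _ (hsub ⟨t, ht, rfl⟩)
    have hk := A.sub_mul_map (hne t ht)
    have h3 : 1 = (A.a - A.c * A.map (γ t)) * A.den (γ t) := by
      rw [hk, inv_mul_cancel₀ (hne t ht)]
    show 1 ≤ (‖A.a‖ + ‖A.c‖ * R) * ‖A.den (γ t)‖
    calc (1 : ℝ) = ‖(A.a - A.c * A.map (γ t)) * A.den (γ t)‖ := by rw [← h3]; simp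
      _ = ‖A.a - A.c * A.map (γ t)‖ * ‖A.den (γ t)‖ := norm_mul _ _
      _ ≤ _ := by
        gcongr
        refine (norm_sub_le _ _).trans ?_
        rw [norm_mul]
        gcongr
  have hclosed : IsClosed {t : ℝ | 1 ≤ (‖A.a‖ + ‖A.c‖ * R) * ‖A.den (γ t)‖} := by
    refine isClosed_le continuous_const ?_
    unfold den
    fun_prop
  have := closure_minimal hle hclosed
  rw [closure_Ico (by norm_num)] at this
  have h1 : (1 : ℝ) ≤ (‖A.a‖ + ‖A.c‖ * R) * ‖A.den (γ 1)‖ :=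
    this (Set.right_mem_Icc.2 zero_le_one)
  rw [hγ1, hdp] at h1
  norm_num at h1

lemma region_nonempty : region.Nonempty := by
  refine ⟨1 + Complex.I / 2, by simp, fun j => ?_⟩
  fin_cases j <;> (simp; try norm_num)

lemma Good.idealTriangle_triple {A : Moeb} (h : A.Good) :
    idealTriangle A.triple = A.map '' region := by
  obtain ⟨z₀, hz₀⟩ := region_nonempty
  have hex : ∃ T : Set ℂ, Bornology.IsBounded T ∧ ∃ z ∈ (⋃ j, closure (A.triple j))ᶜ,
      T = connectedComponentIn (⋃ j, closure (A.triple j))ᶜ z :=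
    ⟨A.map '' region, h.isBounded_image_region, A.map z₀, h.image_region_subset ⟨z₀, hz₀, rfl⟩,
      (h.connectedComponentIn_region hz₀).symm⟩
  obtain ⟨hb, w, hw, hT⟩ := Classical.epsilon_spec hex
  change Bornology.IsBounded (idealTriangle A.triple) at hb
  change idealTriangle A.triple = _ at hT
  rw [hT] at hb ⊢
  obtain ⟨h1, h2, h3⟩ := h.exists_of_mem_compl hw
  rw [← h2] at hb ⊢
  rcases lt_or_gt_of_ne (re_ne_zero_of_ev_pos h3) with hlt | hgt
  · exact absurd hb (h.not_isBounded_component h3 hlt h1)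
  · exact h.connectedComponentIn_region ⟨hgt, h3⟩

end Moeb

lemma GenDisk.ev_inner (z : ℂ) :
    GenDisk.inner.ev z = 2 * ((z.re - 1) ^ 2 + (z.im - 1 / 2) ^ 2 - 1 / 4) := by
  simp [GenDisk.ev, GenDisk.inner, Complex.normSq_apply]; ring

lemma GenDisk.act_one (G : GenDisk) : GenDisk.act 1 G = G := by
  ext <;> simp [GenDisk.act]

namespace Moeb

open ComplexConjugate

/-- The inverse Möbius transformation. -/
def adj (A : Moeb) : Moeb := ⟨A.d, -A.b, -A.c, A.a, by linear_combination A.det⟩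

lemma mul_adj (A : Moeb) : A * A.adj = 1 := by
  have := A.det
  ext <;> simp [adj] <;> first | linear_combination this | ring

lemma act_act_adj (A : Moeb) (G : GenDisk) : GenDisk.act A (GenDisk.act A.adj G) = G := by
  rw [← GenDisk.act_mul, mul_adj, GenDisk.act_one]

lemma mem_region_of_ev_inner_neg {z : ℂ} (hz : GenDisk.inner.ev z < 0) : z ∈ region := by
  rw [GenDisk.ev_inner] at hz
  have hx : 0 < z.re := by nlinarith [sq_nonneg (z.im - 1 / 2)]
  have hy : 0 < z.im := by nlinarith [sq_nonneg (z.re - 1)]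
  have hy' : z.im < 1 := by nlinarith [sq_nonneg (z.re - 1)]
  refine ⟨hx, fun j => ?_⟩
  fin_cases j
  · simpa using hy
  · simpa using hy'
  · simp only [Fin.reduceFinMk, GenDisk.ev_std_two]
    by_contra! hn
    nlinarith

lemma carrier_inner_subset (A : Moeb) :
    (GenDisk.act A GenDisk.inner).carrier ⊆ A.map '' region := by
  intro w hw
  change (GenDisk.act A GenDisk.inner).ev w < 0 at hw
  have hne : A.a - A.c * w ≠ 0 := by
    intro h0
    rw [GenDisk.ev_act, h0] at hw
    simp only [GenDisk.inner, map_zero, mul_zero, Complex.zero_re, add_zero] at hw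
    linarith [Complex.normSq_nonneg (A.d * w - A.b)]
  obtain ⟨h1, h2⟩ := A.map_inv hne
  rw [← h2, GenDisk.ev_act_map A _ h1] at hw
  refine ⟨A.inv w, mem_region_of_ev_inner_neg ?_, h2⟩
  rwa [div_lt_iff₀ (Complex.normSq_pos.2 h1), zero_mul] at hw

lemma Good.isInscribedDisk {A : Moeb} (h : A.Good) :
    IsInscribedDisk A.triple (GenDisk.act A GenDisk.inner).carrier := by
  refine ⟨h.normalized_inner.isOpenDisk h.act_inner_k_pos, ?_, fun j => ⟨_, GenDisk.closure_inter_closure h.normalized_inner (h.normalized j)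
      (by rw [GenDisk.pair_act, GenDisk.inner_pair_std])
      (GenDisk.k_add_k_pos h.normalized_inner (h.normalized j) (Or.inl h.act_inner_k_pos))⟩⟩
  rw [h.idealTriangle_triple]; exact A.carrier_inner_subset

lemma eq_of_pair_std {G : GenDisk} (h : ∀ j, GenDisk.pair G (GenDisk.std j) = -2)
    (hG : GenDisk.pair G G = 2) : G = GenDisk.inner ∨ G = ⟨2, 2 - Complex.I, 2⟩ := by
  obtain ⟨k, B, l⟩ := G
  have h0 := h 0
  have h1 := h 1
  have h2 := h 2
  simp [GenDisk.pair, GenDisk.std] at h0 h1 h2 hG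
  have hi : B.im = -1 := by linarith
  have hk : k = 2 := by linarith
  have hl : l = 2 := by linarith
  subst hk hl
  have hr : (B.re - 2) * (B.re + 2) = 0 := by rw [hi] at hG; linarith
  rcases mul_eq_zero.1 hr with hr | hr
  · right
    have : B = 2 - Complex.I := Complex.ext (by simp; linarith) (by simp [hi])
    rw [this]
  · left
    have : B = -2 - Complex.I := Complex.ext (by simp; linarith) (by simp [hi])
    rw [this, GenDisk.inner]

lemma Good.eq_of_isInscribedDisk {A : Moeb} (h : A.Good) {D : Set ℂ}
    (hD : IsInscribedDisk A.triple D) : D = (GenDisk.act A GenDisk.inner).carrier := by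
  obtain ⟨⟨z, r, hr, rfl⟩, hsub, htan⟩ := hD
  obtain ⟨G, hG, hk, hGc⟩ := GenDisk.exists_of_ball z hr
  have hzG : G.ev z < 0 := by
    have : z ∈ G.carrier := hGc ▸ Metric.mem_ball_self hr
    exact this
  have hzm := hsub (Metric.mem_ball_self hr)
  rw [hGc] at htan ⊢
  set G' := GenDisk.act A.adj G with hG'
  have hGG : G = GenDisk.act A G' := (A.act_act_adj G).symm
  have hp : ∀ j, GenDisk.pair G' (GenDisk.std j) = -2 := by
    intro j
    obtain ⟨p, hp⟩ := htan j
    rw [← GenDisk.pair_act A, ← hGG]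
    exact GenDisk.pair_eq_of_closure_inter hG (h.normalized j) hp
  have hpp : GenDisk.pair G' G' = 2 := by
    rw [hG', GenDisk.pair_act]; exact hG.pair_self
  rcases eq_of_pair_std hp hpp with h1 | h1
  · rw [hGG, h1]
  · exfalso
    rw [h.idealTriangle_triple] at hzm
    obtain ⟨x, hx, rfl⟩ := hzm
    have hd := h.den_ne_zero hx.1.le
    rw [hGG, GenDisk.ev_act_map A _ hd, div_lt_iff₀ (Complex.normSq_pos.2 hd), zero_mul, h1] at hzG
    have h3 := hx.2 1
    have h4 := hx.1
    simp only [GenDisk.ev_std_one] at h3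
    simp [GenDisk.ev, Complex.normSq_apply] at hzG
    nlinarith [sq_nonneg x.re, sq_nonneg x.im]

lemma Good.Din_triple {A : Moeb} (h : A.Good) :
    Din A.triple = (GenDisk.act A GenDisk.inner).carrier :=
  h.eq_of_isInscribedDisk (Classical.epsilon_spec ⟨_, h.isInscribedDisk⟩)

lemma Good.Phi_triple {A : Moeb} (h : A.Good) (j : Fin 3) :
    Phi j A.triple = (A * gen j).triple := by
  rw [Phi, h.Din_triple, triple_mul_gen]

lemma Good.applyWord_triple {A : Moeb} (h : A.Good) (w : Word) :
    applyWord A.triple w = (A.mulWord w).triple := by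
  induction w generalizing A with
  | nil => rfl
  | cons j w ih =>
    rw [mulWord_cons, ← ih (h.mul_gen j), ← h.Phi_triple]
    rfl

lemma Good.AG_triple {A : Moeb} (h : A.Good) :
    AG A.triple = closure (A.map '' region)
      \ ⋃ w : Word, (GenDisk.act (A.mulWord w) GenDisk.inner).carrier := by
  unfold AG
  rw [h.idealTriangle_triple]
  congr 2
  ext1 w
  rw [h.applyWord_triple, (h.mulWord w).Din_triple]

/-- The gasket in the normalized unbounded region. -/
def gasket : Set ℂ :=
  {z | z ∈ closure region ∧ ∀ w : Word, 0 ≤ (GenDisk.act ((1 : Moeb).mulWord w) GenDisk.inner).ev z}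

lemma mem_of_mem_closure_region {z : ℂ} (hz : z ∈ closure region) :
    0 ≤ z.re ∧ ∀ j, 0 ≤ (GenDisk.std j).ev z := by
  have hc : IsClosed {z : ℂ | 0 ≤ z.re ∧ ∀ j, 0 ≤ (GenDisk.std j).ev z} := by
    refine IsClosed.and (isClosed_le continuous_const Complex.continuous_re) ?_
    simp only [Set.ofPred_forall]
    exact isClosed_iInter fun j => isClosed_le continuous_const (GenDisk.continuous_ev _)
  have hs : region ⊆ {z : ℂ | 0 ≤ z.re ∧ ∀ j, 0 ≤ (GenDisk.std j).ev z} :=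
    fun z hz => ⟨hz.1.le, fun j => (hz.2 j).le⟩
  exact closure_minimal hs hc hz

lemma Good.AG_diff {A : Moeb} (h : A.Good) :
    AG A.triple \ {A.a / A.c} = A.map '' gasket := by
  rw [h.AG_triple]
  have hmem : ∀ z, A.den z ≠ 0 → ((A.map z ∉ ⋃ w : Word,
      (GenDisk.act (A.mulWord w) GenDisk.inner).carrier) ↔
      ∀ w : Word, 0 ≤ (GenDisk.act ((1 : Moeb).mulWord w) GenDisk.inner).ev z) := by
    intro z hz
    simp only [Set.mem_iUnion, not_exists]
    refine forall_congr' fun w => ?_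
    rw [mulWord_eq, GenDisk.act_mul]
    show ¬ (GenDisk.ev _ _ < 0) ↔ _
    rw [not_lt, GenDisk.ev_act_map A _ hz]
    rw [le_div_iff₀ (Complex.normSq_pos.2 hz), zero_mul]
  apply Set.Subset.antisymm
  · rintro w ⟨⟨hw, hn⟩, hne⟩
    have hne' : A.a - A.c * w ≠ 0 := by
      intro h0
      apply hne
      rw [Set.mem_singleton_iff, eq_div_iff h.c_ne_zero]
      linear_combination -h0
    obtain ⟨h1, h2⟩ := A.map_inv hne'
    refine ⟨A.inv w, ⟨?_, ?_⟩, h2⟩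
    · have hca : ContinuousAt A.inv w := by
        refine A.continuousOn_inv.continuousAt (IsOpen.mem_nhds ?_ hne')
        exact isOpen_ne_fun (by fun_prop) continuous_const
      have := hca.continuousWithinAt.mem_closure_image hw
      rw [Set.image_image] at this
      refine closure_mono ?_ this
      rintro _ ⟨z, hz, rfl⟩
      show A.inv (A.map z) ∈ region
      rwa [A.inv_map (h.den_ne_zero hz.1.le)]
    · rw [← hmem _ h1, h2]; exact hn
  · rintro _ ⟨z, ⟨hz, hzw⟩, rfl⟩
    have hd := h.den_ne_zero (mem_of_mem_closure_region hz).1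
    refine ⟨⟨?_, (hmem z hd).2 hzw⟩, ?_⟩
    · have hca : ContinuousAt A.map z := by
        refine A.continuousOn_map.continuousAt (IsOpen.mem_nhds ?_ hd)
        unfold den
        exact isOpen_ne_fun (by fun_prop) continuous_const
      exact hca.continuousWithinAt.mem_closure_image hz
    · intro h0
      rw [Set.mem_singleton_iff, eq_div_iff h.c_ne_zero] at h0
      have := A.sub_mul_map hd
      rw [← h0, mul_comm, sub_self] at this
      exact inv_ne_zero hd this.symm

end Moeb

lemma tangencyPoint_eq {𝒟 : Fin 3 → Set ℂ} {j : Fin 3} {p : ℂ}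
    (h : closure (𝒟 (j + 1)) ∩ closure (𝒟 (j + 2)) = {p}) : tangencyPoint 𝒟 j = p := by
  have hs : closure (𝒟 (j + 1)) ∩ closure (𝒟 (j + 2)) = {tangencyPoint 𝒟 j} :=
    Classical.epsilon_spec (p := fun p => closure (𝒟 (j + 1)) ∩ closure (𝒟 (j + 2)) = {p}) ⟨p, h⟩
  rw [h] at hs
  exact (Set.singleton_injective hs).symm

lemma exists_rotation_of_congruent {x y x' y' : ℂ} (hx : Complex.normSq x = Complex.normSq x')
    (hy : Complex.normSq y = Complex.normSq y')
    (hxy : Complex.normSq (y - x) = Complex.normSq (y' - x'))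
    (hp : 0 < x.re * y.im - x.im * y.re) (hp' : 0 < x'.re * y'.im - x'.im * y'.re) :
    ∃ u : ℂ, Complex.normSq u = 1 ∧ x' = u * x ∧ y' = u * y := by
  have hx0 : x ≠ 0 := by rintro rfl; simp at hp
  have hn0 : Complex.normSq x ≠ 0 := by simpa using hx0
  have hre : x.re * y.re + x.im * y.im = x'.re * y'.re + x'.im * y'.im := by
    simp only [Complex.normSq_apply, Complex.sub_re, Complex.sub_im] at hx hy hxy
    linarith
  have him : x.re * y.im - x.im * y.re = x'.re * y'.im - x'.im * y'.re := by
    have e1 : ∀ x y : ℂ, (x.re * y.im - x.im * y.re) ^ 2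
        = Complex.normSq x * Complex.normSq y - (x.re * y.re + x.im * y.im) ^ 2 := by
      intro x y
      simp only [Complex.normSq_apply]; ring
    have e2 : (x.re * y.im - x.im * y.re) ^ 2 = (x'.re * y'.im - x'.im * y'.re) ^ 2 := by
      rw [e1, e1, hx, hy, hre]
    exact (pow_left_inj₀ hp.le hp'.le two_ne_zero).1 e2
  refine ⟨x' / x, ?_, by field_simp, ?_⟩
  · rw [Complex.normSq_div, ← hx, div_self hn0]
  · have h1 : x' * y = x * y' := by
      have e : (starRingEnd ℂ) x * y = (starRingEnd ℂ) x' * y' := by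
        apply Complex.ext <;> simp <;> linarith
      have e3 : (Complex.normSq x : ℂ) * y' = Complex.normSq x' * y' := by rw [hx]
      rw [← Complex.mul_conj, ← Complex.mul_conj] at e3
      have hc : (starRingEnd ℂ) x ≠ 0 := by simpa using hx0
      apply mul_left_cancel₀ hc
      linear_combination x' * e - e3
    rw [div_mul_eq_mul_div, h1, mul_div_cancel_left₀ _ hx0]

namespace GenDisk

open ComplexConjugate

lemma ev_contact_third {G₀ G₁ G₂ : GenDisk} (h₀ : G₀.Normalized) (h₁ : G₁.Normalized)
    (h01 : pair G₀ G₁ = -2) (h20 : pair G₂ G₀ = -2) (h21 : pair G₂ G₁ = -2)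
    (hk : 0 < G₀.k + G₁.k) : G₂.ev (contact G₀ G₁) = 4 / (G₀.k + G₁.k) := by
  have e0 := h₀.normSq_B
  have e1 := h₁.normSq_B
  unfold ev contact
  set s := G₀.k + G₁.k with hs
  have hs0 : s ≠ 0 := hk.ne'
  rw [Complex.normSq_div, Complex.normSq_neg, Complex.normSq_ofReal, 
    ← mul_div_assoc, ← mul_div_assoc, Complex.div_ofReal_re]
  have e2 : Complex.normSq (G₀.B + G₁.B) = s * (G₀.l + G₁.l) := by
    rw [Complex.normSq_add, e0, e1]
    simp only [pair, Complex.mul_re, Complex.conj_re, Complex.conj_im] at h01 ⊢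
    linarith
  have e3 : 2 * (conj G₂.B * -(G₀.B + G₁.B)).re
      = 4 - G₂.k * (G₀.l + G₁.l) - s * G₂.l := by
    simp only [pair, Complex.mul_re, Complex.conj_re, Complex.conj_im, Complex.neg_re,
      Complex.neg_im, Complex.add_re, Complex.add_im] at h20 h21 ⊢
    linarith
  rw [e2, ← mul_div_assoc, e3]
  field_simp
  ring

lemma normSq_contact_sub {G₀ G₁ G₂ : GenDisk} (h₀ : G₀.Normalized) (h₁ : G₁.Normalized)
    (h₂ : G₂.Normalized) (h01 : pair G₀ G₁ = -2) (h20 : pair G₂ G₀ = -2)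
    (h21 : pair G₂ G₁ = -2) (hk : 0 < G₀.k + G₁.k) (hk' : 0 < G₁.k + G₂.k) :
    Complex.normSq (contact G₀ G₁ - contact G₁ G₂) = 4 / ((G₀.k + G₁.k) * (G₁.k + G₂.k)) := by
  have e1 := ev_contact_third h₀ h₁ h01 h20 h21 hk
  have e2 := ev_add_ev h₁ h₂ (by rw [pair_comm, h21]) hk' (contact G₀ G₁)
  have e3 := ev_contact h₁ h₀ (by rw [pair_comm, h01]) (by rwa [add_comm])
  rw [contact_comm] at e3
  rw [e1, e3] at e2
  rw [eq_div_iff (mul_pos hk hk').ne', mul_comm (G₀.k + G₁.k), ← mul_assoc, mul_comm _ (G₁.k + _),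
    ← e2, zero_add, div_mul_cancel₀ _ hk.ne']

/-- The contact point of the two members other than the `j`-th one. -/
noncomputable def vertex (G : Fin 3 → GenDisk) (j : Fin 3) : ℂ := contact (G (j + 1)) (G (j + 2))

lemma eq_of_k_of_B {F G : Fin 3 → GenDisk} (hF : ∀ j, (F j).Normalized)
    (hG : ∀ j, (G j).Normalized) (hFp : ∀ j k, j ≠ k → pair (F j) (F k) = -2)
    (hGp : ∀ j k, j ≠ k → pair (G j) (G k) = -2) (hs : ∀ j k, j ≠ k → 0 < (F j).k + (F k).k)
    (hk : ∀ j, (F j).k = (G j).k) (hB : ∀ j, (F j).B = (G j).B) : F = G := by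
  funext j
  refine GenDisk.ext (hk j) (hB j) ?_
  by_cases h0 : (F j).k = 0
  · obtain ⟨i, hi⟩ : ∃ i : Fin 3, j ≠ i := ⟨j + 1, by fin_cases j <;> simp⟩
    have h1 := hFp j i hi
    have h2 := hGp j i hi
    have h3 := hs j i hi
    simp only [pair, ← hB, ← hk, h0] at h1 h2 h3
    exact mul_left_cancel₀ (show (F i).k ≠ 0 by linarith) (by linarith)
  · have h1 := (hF j).normSq_B
    have h2 := (hG j).normSq_B
    rw [← hB, ← hk] at h2
    exact mul_left_cancel₀ h0 (by linarith)

lemma exists_isometry {F G : Fin 3 → GenDisk} (hF : ∀ j, (F j).Normalized)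
    (hG : ∀ j, (G j).Normalized) (hFp : ∀ j k, j ≠ k → pair (F j) (F k) = -2)
    (hGp : ∀ j k, j ≠ k → pair (G j) (G k) = -2) (hs : ∀ j k, j ≠ k → 0 < (F j).k + (F k).k)
    (hk : ∀ j, (G j).k = (F j).k)
    (hFo : 0 < (vertex F 1 - vertex F 0).re * (vertex F 2 - vertex F 0).im
      - (vertex F 1 - vertex F 0).im * (vertex F 2 - vertex F 0).re)
    (hGo : 0 < (vertex G 1 - vertex G 0).re * (vertex G 2 - vertex G 0).im
      - (vertex G 1 - vertex G 0).im * (vertex G 2 - vertex G 0).re) :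
    ∃ P : Moeb, (∀ A : Moeb, (P * A).curvatures = A.curvatures) ∧ ∀ j, G j = act P (F j) := by
  have hs' : ∀ j k, j ≠ k → 0 < (G j).k + (G k).k := by simpa only [hk] using hs
  have hd : ∀ i j k : Fin 3, i ≠ j → j ≠ k → i ≠ k →
      Complex.normSq (contact (F i) (F j) - contact (F j) (F k))
        = Complex.normSq (contact (G i) (G j) - contact (G j) (G k)) := by
    intro i j k hij hjk hik
    rw [normSq_contact_sub (hF i) (hF j) (hF k) (hFp _ _ hij) (hFp _ _ hik.symm)
      (hFp _ _ hjk.symm) (hs _ _ hij) (hs _ _ hjk), normSq_contact_sub (hG i) (hG j) (hG k)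
      (hGp _ _ hij) (hGp _ _ hik.symm) (hGp _ _ hjk.symm) (hs' _ _ hij) (hs' _ _ hjk)]
    simp only [hk]
  obtain ⟨u, hu, h1, h2⟩ := exists_rotation_of_congruent
    (x := vertex F 1 - vertex F 0) (y := vertex F 2 - vertex F 0)
    (x' := vertex G 1 - vertex G 0) (y' := vertex G 2 - vertex G 0)
    (by simpa [vertex, contact_comm] using hd 0 2 1 (by decide) (by decide) (by decide))
    (by simpa [vertex, contact_comm] using hd 0 1 2 (by decide) (by decide) (by decide))
    (by simpa [vertex, contact_comm] using hd 1 0 2 (by decide) (by decide) (by decide))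
    hFo hGo
  obtain ⟨v, hv⟩ := IsAlgClosed.exists_pow_nat_eq u (n := 2) (by norm_num)
  have hvn : Complex.normSq v = 1 := by
    have : Complex.normSq v ^ 2 = 1 := by rw [← map_pow, hv, hu]
    exact (pow_eq_one_iff_of_nonneg (Complex.normSq_nonneg v) two_ne_zero).1 this
  have hv0 : v ≠ 0 := by rintro rfl; simp at hvn
  have hvc : conj v⁻¹ = v := by
    rw [map_inv₀, inv_eq_iff_eq_inv]
    apply eq_inv_of_mul_eq_one_left
    rw [← Complex.normSq_eq_conj_mul_self, hvn]; simp
  set t := vertex G 0 - u * vertex F 0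
  have hvert : ∀ j, vertex G j = u * vertex F j + t := by
    intro j
    fin_cases j
    · simp only [t, Fin.zero_eta]; ring
    · simp only [t, Fin.mk_one]; linear_combination h1
    · simp only [t, Fin.reduceFinMk]; linear_combination h2
  set P : Moeb := ⟨v, t * v⁻¹, 0, v⁻¹, by rw [mul_inv_cancel₀ hv0]; ring⟩ with hP
  have hPk : ∀ H : GenDisk, (act P H).k = H.k := by
    intro H
    simp [act, hP, hvn]
  have hPB : ∀ H : GenDisk, (act P H).B = u * H.B - H.k * t := by
    intro H
    simp only [act, hP, hvc, map_zero, mul_zero, sub_zero, add_zero, ← hv]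
    field_simp
    ring
  have hPn : ∀ j, (act P (F j)).Normalized := fun j =>
    ⟨by rw [hPk]; exact (hF j).k_nonneg, by rw [pair_act]; exact (hF j).pair_self⟩
  refine ⟨P, fun A => ?_, ?_⟩
  · have hc : (P * A).c = v⁻¹ * A.c := by simp [hP]
    have hd' : (P * A).d = v⁻¹ * A.d := by simp [hP]
    have e1 : (P * A).d * conj (P * A).c = A.d * conj A.c := by
      rw [hc, hd', map_mul, hvc]; field_simp
    simp only [Moeb.curvatures, e1]
    rw [hc, hd', map_mul, map_mul, map_inv₀, hvn]
    simp
  · refine congrFun (eq_of_k_of_B hG hPn hGp (fun j k hjk => by rw [pair_act, hFp j k hjk]) hs'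
      (fun j => by rw [hPk, hk]) ?_)
    have hsum : ∀ j, (G (j + 1)).B + (G (j + 2)).B
        = u * ((F (j + 1)).B + (F (j + 2)).B) - ((F (j + 1)).k + (F (j + 2)).k) * t := by
      intro j
      have hne : j + 1 ≠ j + 2 := by fin_cases j <;> decide
      have h0 : (((F (j + 1)).k + (F (j + 2)).k : ℝ) : ℂ) ≠ 0 := by
        exact_mod_cast (hs _ _ hne).ne'
      have := hvert j
      unfold vertex contact at this
      rw [hk, hk] at this
      rw [div_eq_iff h0, add_mul, mul_assoc, div_mul_cancel₀ _ h0] at this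
      push_cast at this
      linear_combination -this
    have s0 := hsum 0
    have s1 := hsum 1
    have s2 := hsum 2
    simp only [Fin.isValue, zero_add, Fin.reduceAdd] at s0 s1 s2
    intro j
    rw [hPB]
    fin_cases j
    · simp only [Fin.zero_eta]; linear_combination (s1 + s2 - s0) / 2
    · simp only [Fin.mk_one]; linear_combination (s0 + s2 - s1) / 2
    · simp only [Fin.reduceFinMk]; linear_combination (s0 + s1 - s2) / 2

end GenDisk

namespace Moeb

open ComplexConjugate

lemma Good.vertex_eq {A : Moeb} (h : A.Good) {j : Fin 3} {p : ℂ}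
    (h1 : (GenDisk.act A (GenDisk.std (j + 1))).ev p = 0)
    (h2 : (GenDisk.act A (GenDisk.std (j + 2))).ev p = 0) :
    GenDisk.vertex (fun j => GenDisk.act A (GenDisk.std j)) j = p := by
  have hne : j + 1 ≠ j + 2 := by fin_cases j <;> decide
  have hc := h.closure_inter_closure hne
  rw [triple, triple, (h.normalized _).closure_carrier, (h.normalized _).closure_carrier] at hc
  have : p ∈ ({GenDisk.vertex (fun j => GenDisk.act A (GenDisk.std j)) j} : Set ℂ) := by
    rw [GenDisk.vertex, ← hc]
    exact ⟨h1.le, h2.le⟩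
  exact (Set.mem_singleton_iff.1 this).symm

lemma Good.vertex_zero {A : Moeb} (h : A.Good) :
    GenDisk.vertex (fun j => GenDisk.act A (GenDisk.std j)) 0 = A.map Complex.I := by
  have hd : A.den Complex.I ≠ 0 := h.den_ne_zero (by simp)
  apply h.vertex_eq <;> rw [GenDisk.ev_act_map A _ hd] <;> simp

lemma Good.vertex_one {A : Moeb} (h : A.Good) :
    GenDisk.vertex (fun j => GenDisk.act A (GenDisk.std j)) 1 = A.map 0 := by
  have hd : A.den 0 ≠ 0 := h.den_ne_zero (by simp)
  apply h.vertex_eq <;> rw [GenDisk.ev_act_map A _ hd] <;> simp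

lemma Good.vertex_two {A : Moeb} (h : A.Good) :
    GenDisk.vertex (fun j => GenDisk.act A (GenDisk.std j)) 2 = A.a / A.c := by
  have hc := h.c_ne_zero
  have h0 : A.a - A.c * (A.a / A.c) = 0 := by field_simp; ring
  apply h.vertex_eq <;> rw [GenDisk.ev_act, h0] <;> simp [GenDisk.std]

lemma Good.orientation {A : Moeb} (h : A.Good) :
    0 < (A.map 0 - A.map Complex.I).re * (A.a / A.c - A.map Complex.I).im
      - (A.map 0 - A.map Complex.I).im * (A.a / A.c - A.map Complex.I).re := by
  have hc := h.c_ne_zero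
  have hd0 : A.den 0 ≠ 0 := h.den_ne_zero (by simp)
  have hd : A.den Complex.I ≠ 0 := h.den_ne_zero (by simp)
  have h1 : A.map 0 - A.map Complex.I = -Complex.I / (A.d * A.den Complex.I) := by
    rw [A.map_sub_map hd0 hd]; simp [den]
  have h2 : A.a / A.c - A.map Complex.I = 1 / (A.c * A.den Complex.I) := by
    have := A.sub_mul_map hd
    field_simp at this ⊢
    linear_combination this
  have hd' : A.d ≠ 0 := by simpa [den] using hd0
  set e := A.den Complex.I
  have key : ∀ x y : ℂ, x.re * y.im - x.im * y.re = (conj x * y).im := by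
    intro x y; simp; ring
  rw [key, h1, h2]
  have h3 : conj (-Complex.I / (A.d * e)) * (1 / (A.c * e))
      = Complex.I * (A.d * conj A.c) / ((Complex.normSq A.d * Complex.normSq A.c
          * Complex.normSq e : ℝ) : ℂ) := by
    have c1 : conj A.c ≠ 0 := by simpa using hc
    have c2 : conj A.d ≠ 0 := by simpa using hd'
    have c3 : conj e ≠ 0 := by simpa using hd
    push_cast
    rw [← Complex.mul_conj, ← Complex.mul_conj, ← Complex.mul_conj, map_div₀, map_mul, map_neg,
      Complex.conj_I]
    field_simp
  rw [h3, Complex.div_ofReal_im]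
  have h4 := h.2
  simp only [curvatures, Matrix.cons_val] at h4
  apply div_pos
  · rw [Complex.I_mul_im]; linarith
  · exact mul_pos (mul_pos (Complex.normSq_pos.2 hd') (Complex.normSq_pos.2 hc))
      (Complex.normSq_pos.2 hd)

lemma Good.orientation_vertex {A : Moeb} (h : A.Good) :
    let F := fun j => GenDisk.act A (GenDisk.std j)
    0 < (GenDisk.vertex F 1 - GenDisk.vertex F 0).re * (GenDisk.vertex F 2 - GenDisk.vertex F 0).im
      - (GenDisk.vertex F 1 - GenDisk.vertex F 0).im
        * (GenDisk.vertex F 2 - GenDisk.vertex F 0).re := by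
  intro F
  rw [h.vertex_zero, h.vertex_one, h.vertex_two]
  exact h.orientation

lemma Good.isTDTplus {A : Moeb} (h : A.Good) : IsTDTplus A.triple := by
  refine ⟨h.isTDT, ?_⟩
  have ht : ∀ j, tangencyPoint A.triple j
      = GenDisk.vertex (fun j => GenDisk.act A (GenDisk.std j)) j := by
    intro j
    have hne : j + 1 ≠ j + 2 := by fin_cases j <;> decide
    exact tangencyPoint_eq (h.closure_inter_closure hne)
  simp only [ht]
  exact h.orientation_vertex

lemma exists_genDisk_of_isTDT {𝒟 : Fin 3 → Set ℂ} (h : IsTDT 𝒟) (j : Fin 3) :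
    ∃ G : GenDisk, G.Normalized ∧ 𝒟 j = G.carrier := by
  have hor : IsOpenDisk (𝒟 j) ∨ IsOpenHalfPlane (𝒟 j) := by
    rcases h.1 with h1 | ⟨k, hk, hd⟩
    · exact Or.inl (h1 j)
    · by_cases hjk : j = k
      · exact Or.inr (hjk ▸ hk)
      · exact Or.inl (hd j hjk)
  rcases hor with ⟨z, r, hr, hz⟩ | ⟨a, ha, c, hc⟩
  · obtain ⟨G, hG, -, hc⟩ := GenDisk.exists_of_ball z hr
    exact ⟨G, hG, hz.trans hc⟩
  · obtain ⟨G, hG, -, hc'⟩ := GenDisk.exists_of_halfPlane ha c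
    exact ⟨G, hG, hc.trans hc'⟩

lemma Good.exists_of_isTDTplus {A : Moeb} (h : A.Good) {𝒟 : Fin 3 → Set ℂ} (hD : IsTDTplus 𝒟)
    (hcurv : ∀ j, curv (𝒟 j) = A.curvatures j.castSucc) :
    ∃ P : Moeb, (∀ X : Moeb, (P * X).curvatures = X.curvatures) ∧ 𝒟 = (P * A).triple := by
  choose G hG hGc using exists_genDisk_of_isTDT hD.1
  have hk : ∀ j, (G j).k = (GenDisk.act A (GenDisk.std j)).k := by
    intro j
    rw [← (hG j).curv_carrier, ← hGc, hcurv, act_std_k]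
  have hp : ∀ j k, j ≠ k → GenDisk.pair (G j) (G k) = -2 := by
    intro j k hjk
    obtain ⟨p, hp⟩ := hD.1.2 j k hjk
    rw [hGc, hGc] at hp
    exact GenDisk.pair_eq_of_closure_inter (hG j) (hG k) hp
  have hs : ∀ j k : Fin 3, j ≠ k →
      0 < (GenDisk.act A (GenDisk.std j)).k + (GenDisk.act A (GenDisk.std k)).k := by
    intro j k hjk
    rw [act_std_k, act_std_k]
    exact h.add_pos hjk
  have ht : ∀ j, tangencyPoint 𝒟 j = GenDisk.vertex G j := by
    intro j
    have hne : j + 1 ≠ j + 2 := by fin_cases j <;> decide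
    apply tangencyPoint_eq
    rw [hGc, hGc]
    exact GenDisk.closure_inter_closure (hG _) (hG _) (hp _ _ hne)
      (by rw [hk, hk]; exact hs _ _ hne)
  have ho := hD.2
  simp only [ht] at ho
  obtain ⟨P, hP, hPG⟩ := GenDisk.exists_isometry h.normalized hG
    (fun j k hjk => by rw [GenDisk.pair_act, GenDisk.std_pair, if_neg hjk]) hp hs hk
    h.orientation_vertex ho
  refine ⟨P, hP, ?_⟩
  funext j
  rw [hGc, hPG, ← GenDisk.act_mul]
  rfl

lemma Good.tripleOf_curvatures {A : Moeb} (h : A.Good) :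
    ∃ P : Moeb, (∀ X : Moeb, (P * X).curvatures = X.curvatures) ∧
      tripleOf A.curvatures = (P * A).triple := by
  have hex : ∃ 𝒟 : Fin 3 → Set ℂ, IsTDTplus 𝒟 ∧ curv (𝒟 0) = A.curvatures 0 ∧
      curv (𝒟 1) = A.curvatures 1 ∧ curv (𝒟 2) = A.curvatures 2 :=
    ⟨A.triple, h.isTDTplus, h.curv_triple 0, h.curv_triple 1, h.curv_triple 2⟩
  obtain ⟨h1, h2, h3, h4⟩ := Classical.epsilon_spec hex
  refine h.exists_of_isTDTplus h1 fun j => ?_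
  fin_cases j
  exacts [h2, h3, h4]

lemma exists_of_mem_Gamma {g : Fin 4 → ℝ} (hg : g ∈ Gamma) : ∃ A : Moeb, A.curvatures = g := by
  obtain ⟨h0, h1, h2, h3, h4⟩ := hg
  have hsq : g 3 ^ 2 = g 1 * g 2 + g 2 * g 0 + g 0 * g 1 := by
    rw [h3, kappa, Real.sq_sqrt (by positivity)]
  have hs : 0 < g 0 + g 1 := by
    by_contra! hn
    have e0 : g 0 = 0 := by linarith
    have e1 : g 1 = 0 := by linarith
    rw [e0, e1] at hsq
    nlinarith [pow_pos h4 2]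
  set r := Real.sqrt ((g 0 + g 1) / 2) with hr
  have hr0 : 0 < r := Real.sqrt_pos.2 (by linarith)
  have hr2 : r ^ 2 = (g 0 + g 1) / 2 := Real.sq_sqrt (by linarith)
  have hrc : (r : ℂ) ≠ 0 := by exact_mod_cast hr0.ne'
  refine ⟨⟨0, -1 / r, r, ⟨g 3 / (2 * r), -g 0 / (2 * r)⟩, by field_simp; ring⟩, ?_⟩
  have e1 : ∀ x : ℝ, x / (2 * r) * r = x / 2 := by intro x; field_simp
  have e2 : (g 3 / (2 * r)) * (g 3 / (2 * r)) + (-g 0 / (2 * r)) * (-g 0 / (2 * r))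
      = (g 0 + g 2) / 2 := by
    rw [div_mul_div_comm, div_mul_div_comm, ← add_div, div_eq_iff (by positivity)]
    linear_combination hsq - 2 * (g 0 + g 2) * hr2
  funext i
  fin_cases i
  · simp [curvatures, e1]; ring
  · simp [curvatures, e1]; rw [← sq, hr2]; ring
  · simp [curvatures, Complex.normSq_apply, e1]; rw [e2]; ring
  · simp [curvatures, e1]; ring

lemma good_of_curvatures_mem {A : Moeb} (h : A.curvatures ∈ Gamma) : A.Good := by
  obtain ⟨h0, h1, h2, -, h4⟩ := h
  refine ⟨fun j => ?_, h4⟩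
  fin_cases j
  exacts [h0, h1, h2]

lemma exists_tripleOf_eq {g : Fin 4 → ℝ} (hg : g ∈ Gamma) (w : Word) :
    ∃ A : Moeb, A.Good ∧ A.curvatures = g ∧
      tripleOf (Matrix.vecMul g (Mword w)) = (A.mulWord w).triple := by
  obtain ⟨A, rfl⟩ := exists_of_mem_Gamma hg
  have hA := good_of_curvatures_mem hg
  obtain ⟨P, hP, hPt⟩ := (hA.mulWord w).tripleOf_curvatures
  refine ⟨P * A, good_of_curvatures_mem (by rwa [hP]), hP A, ?_⟩
  rw [← curvatures_mulWord, hPt, mul_mulWord]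

end Moeb

lemma rhoGamma_comm (g h : Fin 4 → ℝ) : rhoGamma g h = rhoGamma h g := by
  unfold rhoGamma; congr 1; ring

lemma rhoGamma_nonneg (g h : Fin 4 → ℝ) : 0 ≤ rhoGamma g h := Real.sqrt_nonneg _

lemma abs_sub_le_rhoGamma (g h : Fin 4 → ℝ) :
    |g 0 - h 0| ≤ rhoGamma g h ∧ |g 1 - h 1| ≤ rhoGamma g h ∧ |g 2 - h 2| ≤ rhoGamma g h := by
  unfold rhoGamma
  refine ⟨Real.abs_le_sqrt ?_, Real.abs_le_sqrt ?_, Real.abs_le_sqrt ?_⟩ <;>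
  nlinarith [sq_nonneg (g 0 - h 0), sq_nonneg (g 1 - h 1), sq_nonneg (g 2 - h 2)]

/-- Among three numbers with pairwise sums at least `ε`, two are at least `ε / 2`. -/
lemma two_large {ε a b c : ℝ} (h1 : ε ≤ b + c) (h2 : ε ≤ c + a) (h3 : ε ≤ a + b) :
    (ε / 2 ≤ a ∧ ε / 2 ≤ b) ∨ (ε / 2 ≤ b ∧ ε / 2 ≤ c) ∨ (ε / 2 ≤ c ∧ ε / 2 ≤ a) := by
  by_cases ha : ε / 2 ≤ a
  · by_cases hb : ε / 2 ≤ b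
    · exact Or.inl ⟨ha, hb⟩
    · exact Or.inr (Or.inr ⟨by linarith, ha⟩)
  · exact Or.inr (Or.inl ⟨by linarith, by linarith⟩)

lemma GammaEps.kappa_sq {ε : ℝ} {g : Fin 4 → ℝ} (hg : g ∈ GammaEps ε) :
    g 3 ^ 2 = g 1 * g 2 + g 2 * g 0 + g 0 * g 1 := by
  obtain ⟨⟨h0, -⟩, ⟨h1, -⟩, ⟨h2, -⟩, h3, -⟩ := hg
  rw [h3, kappa, Real.sq_sqrt (by positivity)]

lemma GammaEps.half_le_kappa {ε : ℝ} (hε : 0 < ε) {g : Fin 4 → ℝ} (hg : g ∈ GammaEps ε) :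
    ε / 2 ≤ g 3 := by
  have hsq := GammaEps.kappa_sq hg
  obtain ⟨⟨h0, -⟩, ⟨h1, -⟩, ⟨h2, -⟩, h3, h4, h5, h6⟩ := hg
  have h30 : 0 ≤ g 3 := h3 ▸ Real.sqrt_nonneg _
  refine abs_le_of_sq_le_sq' ?_ h30 |>.2
  have m0 := mul_nonneg h1 h2
  have m1 := mul_nonneg h2 h0
  have m2 := mul_nonneg h0 h1
  rcases two_large h4 h5 h6 with ⟨ha, hb⟩ | ⟨ha, hb⟩ | ⟨ha, hb⟩ <;>
  nlinarith [mul_le_mul ha hb (by positivity) (by linarith)]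

lemma GammaEps.mem_Gamma {ε : ℝ} (hε : 0 < ε) {g : Fin 4 → ℝ} (hg : g ∈ GammaEps ε) :
    g ∈ Gamma := by
  have h := GammaEps.half_le_kappa hε hg
  exact ⟨hg.1.1, hg.2.1.1, hg.2.2.1.1, hg.2.2.2.1, by linarith⟩

lemma GammaEps.rho_le {ε : ℝ} (hε : 0 < ε) {g h : Fin 4 → ℝ} (hg : g ∈ GammaEps ε)
    (hh : h ∈ GammaEps ε) : rhoGamma g h ≤ 2 * ε⁻¹ := by
  have hi := inv_pos.2 hε
  have key : ∀ x ∈ Set.Icc 0 ε⁻¹, ∀ y ∈ Set.Icc 0 ε⁻¹, (x - y) ^ 2 ≤ ε⁻¹ ^ 2 := by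
    rintro x ⟨hx, hx'⟩ y ⟨hy, hy'⟩
    exact sq_le_sq' (by linarith) (by linarith)
  refine Real.sqrt_le_iff.2 ⟨by positivity, ?_⟩
  have h0 := key _ hg.1 _ hh.1
  have h1 := key _ hg.2.1 _ hh.2.1
  have h2 := key _ hg.2.2.1 _ hh.2.2.1
  nlinarith [sq_nonneg ε⁻¹]

lemma GammaEps.abs_kappa_sub_le {ε : ℝ} (hε : 0 < ε) {g h : Fin 4 → ℝ} (hg : g ∈ GammaEps ε)
    (hh : h ∈ GammaEps ε) : |g 3 - h 3| ≤ 6 * ε⁻¹ ^ 2 * rhoGamma g h := by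
  have hg3 := GammaEps.half_le_kappa hε hg
  have hh3 := GammaEps.half_le_kappa hε hh
  have hgs := GammaEps.kappa_sq hg
  have hhs := GammaEps.kappa_sq hh
  obtain ⟨r0, r1, r2⟩ := abs_sub_le_rhoGamma g h
  set ρ := rhoGamma g h
  have hρ : 0 ≤ ρ := (abs_nonneg _).trans r0
  have key : ∀ x ∈ Set.Icc 0 ε⁻¹, ∀ y' ∈ Set.Icc 0 ε⁻¹, ∀ y x' : ℝ, |x - x'| ≤ ρ → |y - y'| ≤ ρ →
      |x * y - x' * y'| ≤ 2 * ε⁻¹ * ρ := by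
    rintro x ⟨hx, hx'⟩ y' ⟨hy, hy'⟩ y x' h1 h2
    have : x * y - x' * y' = x * (y - y') + (x - x') * y' := by ring
    rw [this]
    refine (abs_add_le _ _).trans ?_
    rw [abs_mul, abs_mul, abs_of_nonneg hx, abs_of_nonneg hy]
    have e1 := mul_le_mul hx' h2 (abs_nonneg _) (inv_pos.2 hε).le
    have e2 := mul_le_mul h1 hy' hy hρ
    linarith
  have k1 := key _ hg.2.1 _ hh.2.2.1 _ _ r1 r2
  have k2 := key _ hg.2.2.1 _ hh.1 _ _ r2 r0
  have k3 := key _ hg.1 _ hh.2.1 _ _ r0 r1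
  have h5 : |g 3 - h 3| * (g 3 + h 3) ≤ 6 * ε⁻¹ * ρ := by
    rw [← abs_of_pos (show 0 < g 3 + h 3 by linarith), ← abs_mul]
    have : (g 3 - h 3) * (g 3 + h 3) = (g 1 * g 2 - h 1 * h 2) + (g 2 * g 0 - h 2 * h 0)
        + (g 0 * g 1 - h 0 * h 1) := by linear_combination hgs - hhs
    rw [this]
    refine (abs_add_three _ _ _).trans ?_
    linarith
  have h6 : |g 3 - h 3| * ε ≤ 6 * ε⁻¹ * ρ :=
    (mul_le_mul_of_nonneg_left (by linarith) (abs_nonneg _)).trans h5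
  rw [← le_div_iff₀ hε] at h6
  refine h6.trans (le_of_eq ?_)
  field_simp

/-- The quadratic form giving the squared modulus of the denominator of a Möbius
transformation in terms of its curvatures. -/
def denForm (g c : Fin 4 → ℝ) : ℝ := g 0 * c 0 + g 1 * c 1 + g 2 * c 2 + g 3 * c 3

lemma GammaEps.denForm_le {ε : ℝ} (hε : 0 < ε) (hε1 : ε < 1) {g h : Fin 4 → ℝ}
    (hg : g ∈ GammaEps ε) (hh : h ∈ GammaEps ε) {c : Fin 4 → ℝ} (hc : ∀ i, 0 ≤ c i)
    (h0 : c 0 ≤ 2 * (c 1 + c 2)) (h1 : c 1 ≤ 2 * (c 2 + c 0)) (h2 : c 2 ≤ 2 * (c 0 + c 1))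
    (h3 : c 3 ≤ c 1 + c 2) :
    denForm g c ≤ (1 + 42 * ε⁻¹ ^ 3 * rhoGamma g h) * denForm h c := by
  have hi : 1 ≤ ε⁻¹ := (one_le_inv₀ hε).2 hε1.le
  have c0 := hc 0
  have c1 := hc 1
  have c2 := hc 2
  have c3 := hc 3
  have hlow : ε / 6 * (c 0 + c 1 + c 2) ≤ denForm h c := by
    have hk := GammaEps.half_le_kappa hε hh
    obtain ⟨⟨a0, -⟩, ⟨a1, -⟩, ⟨a2, -⟩, -, h4, h5, h6⟩ := hh
    unfold denForm
    have m0 := mul_nonneg a0 c0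
    have m1 := mul_nonneg a1 c1
    have m2 := mul_nonneg a2 c2
    have m3 : 0 ≤ h 3 * c 3 := mul_nonneg (by linarith) c3
    rcases two_large h4 h5 h6 with ⟨ha, hb⟩ | ⟨ha, hb⟩ | ⟨ha, hb⟩
    · have := mul_le_mul_of_nonneg_right ha c0
      have := mul_le_mul_of_nonneg_right hb c1
      have := mul_le_mul_of_nonneg_left h2 hε.le
      linarith
    · have := mul_le_mul_of_nonneg_right ha c1
      have := mul_le_mul_of_nonneg_right hb c2
      have := mul_le_mul_of_nonneg_left h0 hε.le
      linarith
    · have := mul_le_mul_of_nonneg_right ha c2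
      have := mul_le_mul_of_nonneg_right hb c0
      have := mul_le_mul_of_nonneg_left h1 hε.le
      linarith
  obtain ⟨r0, r1, r2⟩ := abs_sub_le_rhoGamma g h
  have r3 := GammaEps.abs_kappa_sub_le hε hg hh
  set ρ := rhoGamma g h
  have hρ : 0 ≤ ρ := (abs_nonneg _).trans r0
  have hup : denForm g c - denForm h c ≤ 7 * ε⁻¹ ^ 2 * ρ * (c 0 + c 1 + c 2) := by
    have m0 := mul_le_mul_of_nonneg_right ((le_abs_self _).trans r0) c0
    have m1 := mul_le_mul_of_nonneg_right ((le_abs_self _).trans r1) c1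
    have m2 := mul_le_mul_of_nonneg_right ((le_abs_self _).trans r2) c2
    have m3 := mul_le_mul_of_nonneg_right ((le_abs_self _).trans r3) c3
    have hs : 0 ≤ ρ * (c 0 + c 1 + c 2) := by positivity
    have hi2 : 1 ≤ ε⁻¹ ^ 2 := one_le_pow₀ hi
    have m4 := mul_le_mul_of_nonneg_right hi2 hs
    have m5 : 6 * ε⁻¹ ^ 2 * ρ * c 3 ≤ 6 * ε⁻¹ ^ 2 * ρ * (c 0 + c 1 + c 2) :=
      mul_le_mul_of_nonneg_left (by linarith) (by positivity)
    unfold denForm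
    linarith
  have hfin : 7 * ε⁻¹ ^ 2 * ρ * (c 0 + c 1 + c 2) ≤ 42 * ε⁻¹ ^ 3 * ρ * denForm h c := by
    have := mul_le_mul_of_nonneg_left hlow (show 0 ≤ 42 * ε⁻¹ ^ 3 * ρ by positivity)
    refine le_trans (le_of_eq ?_) this
    field_simp
    ring
  linarith

namespace Moeb

open ComplexConjugate

/-- The cone of vectors in `ℂ²` whose projectivization is the closed region `region`. -/
def InCone (p q : ℂ) : Prop :=
  0 ≤ (p * conj q).re ∧ 0 ≤ (p * conj q).im ∧ (p * conj q).im ≤ Complex.normSq p ∧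
    (p * conj q).im ≤ Complex.normSq q

lemma InCone.gen {p q : ℂ} (h : InCone p q) (j : Fin 3) :
    InCone ((Moeb.gen j).a * p + (Moeb.gen j).b * q) ((Moeb.gen j).c * p + (Moeb.gen j).d * q) := by
  have hp := Complex.normSq_nonneg p
  have hq := Complex.normSq_nonneg q
  obtain ⟨h1, h2, h3, h4⟩ := h
  simp only [Complex.normSq_apply, Complex.mul_re, Complex.mul_im, Complex.conj_re,
    Complex.conj_im] at h1 h2 h3 h4 hp hq
  fin_cases j <;> refine ⟨?_, ?_, ?_, ?_⟩ <;>
  simp [Moeb.gen, Complex.normSq_apply] <;> nlinarith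

lemma InCone.mulWord {p q : ℂ} (h : InCone p q) (w : Word) :
    InCone (((1 : Moeb).mulWord w).a * p + ((1 : Moeb).mulWord w).b * q)
      (((1 : Moeb).mulWord w).c * p + ((1 : Moeb).mulWord w).d * q) := by
  induction w with
  | nil => simpa [Moeb.mulWord] using h
  | cons j w ih =>
    have := ih.gen j
    rw [mulWord_cons, mulWord_eq]
    convert this using 1 <;> simp <;> ring

/-- The coefficients of the squared modulus of `A.c * p + A.d * q` with respect to the
curvatures of `A`. -/
noncomputable def denCoeff (p q : ℂ) : Fin 4 → ℝ :=
  ![(Complex.normSq p + Complex.normSq q) / 2 - (p * conj q).im, Complex.normSq p / 2,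
    Complex.normSq q / 2, (p * conj q).re]

lemma normSq_eq_denForm (A : Moeb) (p q : ℂ) :
    Complex.normSq (A.c * p + A.d * q) = denForm A.curvatures (denCoeff p q) := by
  simp [denForm, denCoeff, curvatures, Complex.normSq_apply]; ring

lemma normSq_den_mulWord (A : Moeb) (w : Word) (z : ℂ) :
    Complex.normSq ((A.mulWord w).den z) = denForm A.curvatures
      (denCoeff (((1 : Moeb).mulWord w).a * z + ((1 : Moeb).mulWord w).b)
        (((1 : Moeb).mulWord w).c * z + ((1 : Moeb).mulWord w).d)) := by
  rw [← normSq_eq_denForm, mulWord_eq]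
  congr 1
  simp [den]; ring

lemma denForm_denCoeff_le {ε : ℝ} (hε : 0 < ε) (hε1 : ε < 1) {g h : Fin 4 → ℝ}
    (hg : g ∈ GammaEps ε) (hh : h ∈ GammaEps ε) {p q : ℂ} (hpq : InCone p q) :
    denForm g (denCoeff p q) ≤ (1 + 42 * ε⁻¹ ^ 3 * rhoGamma g h) * denForm h (denCoeff p q) := by
  obtain ⟨h1, h2, h3, h4⟩ := hpq
  simp only [Complex.normSq_apply, Complex.mul_re, Complex.mul_im, Complex.conj_re,
    Complex.conj_im] at h1 h2 h3 h4
  refine GammaEps.denForm_le hε hε1 hg hh (fun i => ?_) ?_ ?_ ?_ ?_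
  · fin_cases i <;> simp [denCoeff, Complex.normSq_apply] <;>
    nlinarith [sq_nonneg p.re, sq_nonneg p.im, sq_nonneg q.re, sq_nonneg q.im]
  · simp [denCoeff, Complex.normSq_apply]
    nlinarith [sq_nonneg p.re, sq_nonneg p.im, sq_nonneg q.re, sq_nonneg q.im]
  · simp [denCoeff, Complex.normSq_apply]
    nlinarith [sq_nonneg (p.re + 2 * q.im), sq_nonneg (p.im - 2 * q.re)]
  · simp [denCoeff, Complex.normSq_apply]
    nlinarith [sq_nonneg (2 * p.re + q.im), sq_nonneg (2 * p.im - q.re)]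
  · simp [denCoeff, Complex.normSq_apply]
    nlinarith [sq_nonneg (p.re - q.re), sq_nonneg (p.im - q.im)]

lemma inCone_of_mem_closure_region {z : ℂ} (hz : z ∈ closure region) : InCone z 1 := by
  obtain ⟨h, hj⟩ := mem_of_mem_closure_region hz
  have h0 := hj 0
  have h1 := hj 1
  have h2 := hj 2
  simp only [GenDisk.ev_std_zero, GenDisk.ev_std_one, GenDisk.ev_std_two] at h0 h1 h2
  refine ⟨by simpa using h, by simpa using h0, ?_, ?_⟩ <;> simp [Complex.normSq_apply] <;> nlinarith

lemma norm_den_sq_le {ε : ℝ} (hε : 0 < ε) (hε1 : ε < 1) {A A' : Moeb}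
    (hg : A.curvatures ∈ GammaEps ε) (hg' : A'.curvatures ∈ GammaEps ε) (w : Word) {z : ℂ}
    (hz : z ∈ closure region) :
    ‖(A.mulWord w).den z‖ ^ 2 ≤ (1 + 42 * ε⁻¹ ^ 3 * rhoGamma A.curvatures A'.curvatures)
      * ‖(A'.mulWord w).den z‖ ^ 2 := by
  rw [← Complex.normSq_eq_norm_sq, ← Complex.normSq_eq_norm_sq, normSq_den_mulWord,
    normSq_den_mulWord]
  refine denForm_denCoeff_le hε hε1 hg hg' ?_
  simpa using (inCone_of_mem_closure_region hz).mulWord w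

end Moeb

namespace Moeb

open ComplexConjugate

lemma Good.hausdorffMeasure_AG {A : Moeb} (h : A.Good) {d : ℝ} (hd : 0 < d) :
    μH[d] (AG A.triple) = μH[d] (A.map '' gasket) := by
  have := Measure.nullSingletonClass_hausdorff ℂ hd
  rw [← h.AG_diff, measure_sdiff_null (measure_singleton _)]

lemma lipschitzOnWith_map_inv {A A' : Moeb} (hA : A.Good) (hA' : A'.Good) {R : ℝ≥0}
    (hR : ∀ z ∈ gasket, ‖A.den z‖ ^ 2 ≤ R * ‖A'.den z‖ ^ 2) :
    LipschitzOnWith R (fun w => A'.map (A.inv w)) (A.map '' gasket) := by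
  rw [lipschitzOnWith_iff_dist_le_mul]
  rintro _ ⟨x, hx, rfl⟩ _ ⟨y, hy, rfl⟩
  have hx0 := (mem_of_mem_closure_region hx.1).1
  have hy0 := (mem_of_mem_closure_region hy.1).1
  have ax := hA.den_ne_zero hx0
  have ay := hA.den_ne_zero hy0
  have ax' := hA'.den_ne_zero hx0
  have ay' := hA'.den_ne_zero hy0
  simp only [A.inv_map ax, A.inv_map ay]
  rw [dist_eq_norm, dist_eq_norm, map_sub_map _ ax ay, map_sub_map _ ax' ay', norm_div, norm_div,
    norm_mul, norm_mul, mul_div_assoc', div_le_div_iff₀ (by positivity) (by positivity)]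
  have key : ‖A.den x‖ * ‖A.den y‖ ≤ R * (‖A'.den x‖ * ‖A'.den y‖) := by
    refine le_of_sq_le_sq ?_ (by positivity)
    calc (‖A.den x‖ * ‖A.den y‖) ^ 2 = ‖A.den x‖ ^ 2 * ‖A.den y‖ ^ 2 := mul_pow _ _ _
      _ ≤ (R * ‖A'.den x‖ ^ 2) * (R * ‖A'.den y‖ ^ 2) :=
        mul_le_mul (hR x hx) (hR y hy) (by positivity) (by positivity)
      _ = _ := by ring
  calc ‖x - y‖ * (‖A.den x‖ * ‖A.den y‖) ≤ ‖x - y‖ * (R * (‖A'.den x‖ * ‖A'.den y‖)) := by gcongr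
    _ = _ := by ring

lemma hausdorffMeasure_AG_le {A A' : Moeb} (hA : A.Good) (hA' : A'.Good) {R : ℝ≥0}
    (hR : ∀ z ∈ gasket, ‖A.den z‖ ^ 2 ≤ R * ‖A'.den z‖ ^ 2) {d : ℝ} (hd : 0 < d) :
    μH[d] (AG A'.triple) ≤ (R : ℝ≥0∞) ^ d * μH[d] (AG A.triple) := by
  rw [hA.hausdorffMeasure_AG hd, hA'.hausdorffMeasure_AG hd]
  refine le_trans (le_of_eq ?_)
    ((lipschitzOnWith_map_inv hA hA' hR).hausdorffMeasure_image_le hd.le)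
  rw [Set.image_image]
  congr 1
  refine Set.image_congr fun z hz => ?_
  rw [A.inv_map (hA.den_ne_zero (mem_of_mem_closure_region hz.1).1)]

lemma HGamma_le {ε : ℝ} (hε : 0 < ε) (hε1 : ε < 1) {g h : Fin 4 → ℝ}
    (hg : g ∈ GammaEps ε) (hh : h ∈ GammaEps ε) (w : Word) (hd : 0 < dAG) :
    μH[dAG] (AG (tripleOf (Matrix.vecMul h (Mword w)))) ≤
      ENNReal.ofReal (1 + 42 * ε⁻¹ ^ 3 * rhoGamma g h) ^ dAG
        * μH[dAG] (AG (tripleOf (Matrix.vecMul g (Mword w)))) := by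
  obtain ⟨A, hA, rfl, hAt⟩ := exists_tripleOf_eq (GammaEps.mem_Gamma hε hg) w
  obtain ⟨A', hA', rfl, hAt'⟩ := exists_tripleOf_eq (GammaEps.mem_Gamma hε hh) w
  rw [hAt, hAt']
  refine hausdorffMeasure_AG_le (hA.mulWord w) (hA'.mulWord w) (fun z hz => ?_) hd
  have hρ := rhoGamma_nonneg A.curvatures A'.curvatures
  rw [Real.coe_toNNReal _ (by positivity)]
  exact norm_den_sq_le hε hε1 hg hh w hz.1

end Moeb

namespace GenDisk

lemma act_mulWord_inner_bounds (w : Word) :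
    let G := act ((1 : Moeb).mulWord w) inner
    G.B.re ≤ 0 ∧ G.B.im ≤ -1 ∧ 1 ≤ G.B.im + G.l ∧ 1 ≤ G.B.im + G.k := by
  induction w with
  | nil =>
    intro G
    have : G = inner := act_one inner
    rw [this]
    simp [inner]; norm_num
  | cons j w ih =>
    intro G
    have hG : G = act (Moeb.gen j) (act ((1 : Moeb).mulWord w) inner) := by
      rw [← act_mul]
      simp only [G]
      rw [Moeb.mulWord_cons, Moeb.mulWord_eq]
      congr 2
      ext <;> simp
    rw [hG]
    obtain ⟨h1, h2, h3, h4⟩ := ih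
    generalize act ((1 : Moeb).mulWord w) inner = H at *
    fin_cases j <;> refine ⟨?_, ?_, ?_, ?_⟩ <;>
    simp [act, Moeb.gen, Complex.normSq_apply] <;> linarith

lemma ev_act_mulWord_inner_nonneg (w : Word) (x : ℝ) :
    0 ≤ (act ((1 : Moeb).mulWord w) inner).ev x := by
  obtain ⟨h1, h2, h3, h4⟩ := act_mulWord_inner_bounds w
  have hp : pair (act ((1 : Moeb).mulWord w) inner) (act ((1 : Moeb).mulWord w) inner) = 2 := by
    rw [pair_act, inner_pair_inner]
  generalize act ((1 : Moeb).mulWord w) inner = H at *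
  have hk : 0 < H.k := by linarith
  have hdisc : H.B.re ^ 2 ≤ H.k * H.l := by
    simp [pair] at hp
    nlinarith
  have hev : H.ev x = H.k * x ^ 2 + 2 * H.B.re * x + H.l := by
    simp [ev, Complex.normSq_apply]; ring
  rw [hev]
  have : 0 ≤ H.k * (H.k * x ^ 2 + 2 * H.B.re * x + H.l) := by
    nlinarith [sq_nonneg (H.k * x + H.B.re)]
  exact nonneg_of_mul_nonneg_right this hk

end GenDisk

namespace Moeb

lemma ofReal_mem_gasket {x : ℝ} (hx : 0 < x) : (x : ℂ) ∈ gasket := by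
  refine ⟨?_, fun w => GenDisk.ev_act_mulWord_inner_nonneg w x⟩
  have ht : Tendsto (fun y : ℝ => (x : ℂ) + y * Complex.I) (𝓝[>] 0) (𝓝 ((x : ℂ) + (0 : ℝ) * Complex.I)) :=
    (Continuous.tendsto (by fun_prop) 0).mono_left nhdsWithin_le_nhds
  rw [Complex.ofReal_zero, zero_mul, add_zero] at ht
  refine mem_closure_of_tendsto ht ?_
  have h1 : ∀ᶠ y : ℝ in 𝓝[>] 0, y < min 1 (x ^ 2) :=
    nhdsWithin_le_nhds (eventually_lt_nhds (by positivity))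
  filter_upwards [h1, self_mem_nhdsWithin] with y hy hy0
  have hy0 : 0 < y := hy0
  obtain ⟨hy1, hy2⟩ := lt_min_iff.1 hy
  refine ⟨by simpa using hx, fun j => ?_⟩
  fin_cases j
  · simpa using hy0
  · simpa using hy1
  · simp
    nlinarith

/-- A Möbius transformation taking the standard triple to `baseTriple`. -/
noncomputable def base : Moeb :=
  ⟨⟨-1, -1 / 2⟩, ⟨-1, 1 / 2⟩, Complex.I, Complex.I, by apply Complex.ext <;> norm_num⟩

lemma base_good : base.Good := by
  refine ⟨fun j => ?_, ?_⟩
  · fin_cases j <;> simp [curvatures, base]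
  · simp [curvatures, base]

lemma base_triple : base.triple = baseTriple := by
  have hb : ∀ z c : ℂ, z ∈ Metric.ball c (1 / 2) ↔ Complex.normSq (z - c) < 1 / 4 := by
    intro z c
    rw [mem_ball_iff_norm, ← sq_lt_sq₀ (norm_nonneg _) (by norm_num),
      Complex.normSq_eq_norm_sq]
    norm_num
  funext j
  ext z
  change (GenDisk.act base (GenDisk.std j)).ev z < 0 ↔ _
  fin_cases j
  · simp [GenDisk.ev, GenDisk.act, base, GenDisk.std, baseTriple, Complex.normSq_apply]
    constructor <;> intro h <;> linarith
  · simp only [baseTriple, Fin.mk_one, Matrix.cons_val, hb]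
    simp [GenDisk.ev, GenDisk.act, base, GenDisk.std, Complex.normSq_apply]
    constructor <;> intro h <;> nlinarith
  · simp only [baseTriple, Fin.reduceFinMk, Matrix.cons_val, hb]
    simp [GenDisk.ev, GenDisk.act, base, GenDisk.std, Complex.normSq_apply]
    constructor <;> intro h <;> nlinarith

lemma Ioo_subset_re_image :
    Set.Ioo (-1 / 2 : ℝ) 0 ⊆ Complex.reCLM '' AG baseTriple := by
  rintro y ⟨hy, hy'⟩
  have h1 : 0 < 1 + 2 * y := by linarith
  set x : ℝ := (1 - 2 * y) / (1 + 2 * y) with hx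
  have hx0 : 0 < x := div_pos (by linarith) h1
  have hmem : base.map x ∈ AG baseTriple := by
    rw [← base_triple]
    have : base.map x ∈ base.map '' gasket := ⟨x, ofReal_mem_gasket hx0, rfl⟩
    rw [← base_good.AG_diff] at this
    exact this.1
  refine ⟨_, hmem, ?_⟩
  have hxy : x * (1 + 2 * y) = 1 - 2 * y := div_mul_cancel₀ _ h1.ne'
  have hx1 : base.den x ≠ 0 := base_good.den_ne_zero (by simpa using hx0.le)
  have he : base.map x = Complex.I + y := by
    rw [map, div_eq_iff hx1]
    apply Complex.ext <;> simp [base, den] <;> linarith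
  simp [he]

lemma one_le_dimH : 1 ≤ dimH (AG baseTriple) := by
  have h1 : dimH (Set.Ioo (-1 / 2 : ℝ) 0) = 1 := by
    rw [Real.dimH_of_nonempty_interior]
    · simp
    · rw [interior_Ioo]; exact ⟨-1 / 4, by norm_num, by norm_num⟩
  rw [← h1]
  exact (dimH_mono Ioo_subset_re_image).trans (Complex.reCLM.lipschitz.dimH_image_le _)

lemma dimH_le_two (s : Set ℂ) : dimH s ≤ 2 := by
  refine (dimH_mono (Set.subset_univ s)).trans (le_of_eq ?_)
  rw [Real.dimH_univ_eq_finrank, Complex.finrank_real_complex]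
  norm_num

end Moeb

lemma one_le_dAG : 1 ≤ dAG := by
  have h := ENNReal.toReal_mono (Real.dimH_ne_top _) Moeb.one_le_dimH
  simpa [dAG] using h

lemma dAG_le_two : dAG ≤ 2 := by
  have h := ENNReal.toReal_mono (by norm_num) (Moeb.dimH_le_two (AG baseTriple))
  simpa [dAG] using h

lemma abs_toReal_sub_le {m₁ m₂ : ℝ≥0∞} {C : ℝ} (hC : 1 ≤ C) (h12 : m₁ ≤ ENNReal.ofReal C * m₂)
    (h21 : m₂ ≤ ENNReal.ofReal C * m₁) : |m₁.toReal - m₂.toReal| ≤ (C - 1) * m₁.toReal := by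
  have hC0 : 0 ≤ C := zero_le_one.trans hC
  by_cases h1 : m₁ = ⊤
  · have h2 : m₂ = ⊤ := by
      by_contra h2
      rw [h1, top_le_iff] at h12
      exact ENNReal.mul_ne_top ENNReal.ofReal_ne_top h2 h12
    simp [h1, h2]
  · have h2 : m₂ ≠ ⊤ := ne_top_of_le_ne_top (ENNReal.mul_ne_top ENNReal.ofReal_ne_top h1) h21
    have e1 := ENNReal.toReal_mono (ENNReal.mul_ne_top ENNReal.ofReal_ne_top h2) h12
    have e2 := ENNReal.toReal_mono (ENNReal.mul_ne_top ENNReal.ofReal_ne_top h1) h21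
    rw [ENNReal.toReal_mul, ENNReal.toReal_ofReal hC0] at e1 e2
    have p1 : 0 ≤ m₁.toReal := ENNReal.toReal_nonneg
    have p2 : 0 ≤ m₂.toReal := ENNReal.toReal_nonneg
    rw [abs_le]
    constructor
    · linarith
    · rcases le_total m₁.toReal m₂.toReal with h | h
      · nlinarith
      · nlinarith

/-- Lipschitz-type estimate for `ℋ_Γ(gM_w)`. -/
theorem HGamma_Mword_lipschitz :
    ∃ c₁ : ℝ, 0 < c₁ ∧ ∀ ε : ℝ, ε ∈ Set.Ioo (0:ℝ) 1 →
      ∀ g₁ ∈ GammaEps ε, ∀ g₂ ∈ GammaEps ε, ∀ w : Word,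
        |HGamma (Matrix.vecMul g₁ (Mword w)) - HGamma (Matrix.vecMul g₂ (Mword w))| ≤
          c₁ * ε ^ (1 - 30 * dAG) * HGamma (Matrix.vecMul g₁ (Mword w)) *
            rhoGamma g₁ g₂ := by
  refine ⟨7140, by norm_num, ?_⟩
  rintro ε ⟨hε, hε1⟩ g₁ hg₁ g₂ hg₂ w
  have hd1 := one_le_dAG
  have hd2 := dAG_le_two
  have hd : 0 < dAG := by linarith
  have hi : 1 ≤ ε⁻¹ := (one_le_inv₀ hε).2 hε1.le
  have hρ := rhoGamma_nonneg g₁ g₂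
  have hρ2 := GammaEps.rho_le hε hg₁ hg₂
  set X : ℝ := 42 * ε⁻¹ ^ 3 * rhoGamma g₁ g₂ with hX
  have hX0 : 0 ≤ X := by positivity
  have hC : 1 ≤ (1 + X) ^ dAG := Real.one_le_rpow (by linarith) hd.le
  have h21 := Moeb.HGamma_le hε hε1 hg₁ hg₂ w hd
  have h12 := Moeb.HGamma_le hε hε1 hg₂ hg₁ w hd
  rw [rhoGamma_comm g₂ g₁] at h12
  rw [ENNReal.ofReal_rpow_of_pos (by linarith)] at h12 h21
  have hmain := abs_toReal_sub_le hC h12 h21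
  have hpow : (1 + X) ^ dAG - 1 ≤ 7140 * ε ^ (1 - 30 * dAG) * rhoGamma g₁ g₂ := by
    have h1 : (1 + X) ^ dAG ≤ (1 + X) ^ (2 : ℝ) :=
      Real.rpow_le_rpow_of_exponent_le (by linarith) hd2
    rw [Real.rpow_two] at h1
    have h2 : ε⁻¹ ^ 7 ≤ ε ^ (1 - 30 * dAG) := by
      rw [inv_pow, ← Real.rpow_natCast, ← Real.rpow_neg hε.le]
      exact Real.rpow_le_rpow_of_exponent_ge hε hε1.le (by push_cast; linarith)
    have h3 : 2 + X ≤ 170 * ε⁻¹ ^ 4 := by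
      have e1 : X ≤ 42 * ε⁻¹ ^ 3 * (2 * ε⁻¹) := mul_le_mul_of_nonneg_left hρ2 (by positivity)
      have e2 : 1 ≤ ε⁻¹ ^ 4 := one_le_pow₀ hi
      nlinarith
    calc (1 + X) ^ dAG - 1 ≤ X * (2 + X) := by linarith
      _ ≤ X * (170 * ε⁻¹ ^ 4) := mul_le_mul_of_nonneg_left h3 hX0
      _ = 7140 * ε⁻¹ ^ 7 * rhoGamma g₁ g₂ := by rw [hX]; ring
      _ ≤ _ := by gcongr
  calc |HGamma (Matrix.vecMul g₁ (Mword w)) - HGamma (Matrix.vecMul g₂ (Mword w))|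
      ≤ ((1 + X) ^ dAG - 1) * HGamma (Matrix.vecMul g₁ (Mword w)) := hmain
    _ ≤ (7140 * ε ^ (1 - 30 * dAG) * rhoGamma g₁ g₂) * HGamma (Matrix.vecMul g₁ (Mword w)) :=
      mul_le_mul_of_nonneg_right hpow ENNReal.toReal_nonneg
    _ = _ := by ring
end
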